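/- For every integer ω and every natural number n with n ≥ |ω| and n of opposite parity to ω, the diameter of the set B^ω_n of stable planar (or spherical) curves with Whitney number ω and at most n crossings satisfies diam B^ω_{n+1} = diam B^ω_n ≥ (1/12)n² + (1/6)(|ω| − 1)n + k_ω ≥ (1/12)(n−1)², where k_0 = 1/12 and k_ω = (1/12)(ω² − 6|ω| + 5) for ω ≠ 0. -/

import Mathlib

open Set
open scoped ENNReal

noncomputable section

namespace CurvePaper


/-- The determinant of two vectors in the plane `ℝ² ≅ ℂ`. -/
def det2 (u v : ℂ) : ℝ := u.re * v.im - u.im * v.re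

/-- The determinant of three vectors in `ℝ³`. -/
def det3 (a b c : EuclideanSpace ℝ (Fin 3)) : ℝ :=
  a 0 * (b 1 * c 2 - b 2 * c 1) - a 1 * (b 0 * c 2 - b 2 * c 0) + a 2 * (b 0 * c 1 - b 1 * c 0)

/-- The homomorphism `φ : 𝕏 → ℤ`, `X_{a,b} ↦ a - b`, on the free abelian group `𝕏`
with basis `{X_{a,b} : a b ∈ ℤ}`. -/
def phi : FreeAbelianGroup (ℤ × ℤ) →+ ℤ :=
  FreeAbelianGroup.lift fun p : ℤ × ℤ => p.1 - p.2

/-! ### Planar curves -/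

/-- A closed planar curve: a smooth immersion of the circle `ℝ/ℤ` into the plane. -/
structure PlanarCurve : Type where
  toFun : ℝ → ℂ
  periodic : Function.Periodic toFun 1
  smooth : ContDiff ℝ (⊤ : ℕ∞) toFun
  immersion : ∀ t : ℝ, deriv toFun t ≠ 0

namespace PlanarCurve

/-- The number of parameters in one period mapping to a given point. -/
def multF (f : ℝ → ℂ) (p : ℂ) : ℕ := Set.ncard {t ∈ Set.Ico (0:ℝ) 1 | f t = p}

/-- All self-intersections of `f` at the point `p` are transverse. -/
def TransverseF (f : ℝ → ℂ) (p : ℂ) : Prop :=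
  ∀ s ∈ Set.Ico (0:ℝ) 1, ∀ t ∈ Set.Ico (0:ℝ) 1, s ≠ t → f s = p → f t = p →
    det2 (deriv f s) (deriv f t) ≠ 0

/-- The set of self-intersection points of a parametrized curve. -/
def crossingSetF (f : ℝ → ℂ) : Set ℂ := {p : ℂ | 2 ≤ multF f p}

/-- A parametrized curve is stable if its only self-intersections are finitely many
transverse double points. -/
def StableF (f : ℝ → ℂ) : Prop :=
  (crossingSetF f).Finite ∧ ∀ p : ℂ, multF f p ≤ 2 ∧ (multF f p = 2 → TransverseF f p)

/-- A planar curve is stable if its only self-intersections are transverse double points. -/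
def Stable (c : PlanarCurve) : Prop := StableF c.toFun

/-- The number of crossings (self-intersection points) of a planar curve. -/
def crossings (c : PlanarCurve) : ℕ := (crossingSetF c.toFun).ncard

/-- `c` has Whitney winding number `ω`: the degree of the normalized derivative map
`S¹ → S¹`, expressed via a continuous lift of its angle. -/
def HasWhitney (c : PlanarCurve) (ω : ℤ) : Prop :=
  ∃ θ : ℝ → ℝ, Continuous θ ∧
    (∀ t : ℝ, deriv c.toFun t = (‖deriv c.toFun t‖ : ℂ) * Complex.exp ((θ t : ℂ) * Complex.I)) ∧
    θ 1 - θ 0 = 2 * Real.pi * (ω : ℝ)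

/-- `H` is a regular homotopy between parametrized curves `f` and `g`:
a continuously varying family of immersed closed curves. -/
def IsRegHomotopy (f g : ℝ → ℂ) (H : ℝ → ℝ → ℂ) : Prop :=
  (Continuous fun q : ℝ × ℝ => H q.1 q.2) ∧
  (Continuous fun q : ℝ × ℝ => deriv (H q.1) q.2) ∧
  (∀ s : ℝ, Function.Periodic (H s) 1) ∧
  (∀ s : ℝ, ContDiff ℝ (⊤ : ℕ∞) (H s)) ∧
  (∀ s t : ℝ, deriv (H s) t ≠ 0) ∧
  H 0 = f ∧ H 1 = g

/-- Two planar curves are regularly homotopic. -/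
def RegularlyHomotopic (c c' : PlanarCurve) : Prop :=
  ∃ H, IsRegHomotopy c.toFun c'.toFun H

/-- Two planar curves are homotopic through *stable* immersed curves. -/
def StablyHomotopic (c c' : PlanarCurve) : Prop :=
  ∃ H, IsRegHomotopy c.toFun c'.toFun H ∧ ∀ s ∈ Set.Icc (0:ℝ) 1, StableF (H s)

/-- A point of a curve which is either a regular point or a transverse double point. -/
def StablePointF (f : ℝ → ℂ) (p : ℂ) : Prop :=
  multF f p ≤ 1 ∨ (multF f p = 2 ∧ TransverseF f p)

/-- A curve exhibiting a single `J`-type singularity (a first-order tangency of two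
strands), all other points being stable. -/
def JSingF (f : ℝ → ℂ) : Prop :=
  ∃ p : ℂ, multF f p = 2 ∧
    (∀ s ∈ Set.Ico (0:ℝ) 1, ∀ t ∈ Set.Ico (0:ℝ) 1, s ≠ t → f s = p → f t = p →
      ∃ r : ℝ, r ≠ 0 ∧ deriv f t = (r : ℂ) * deriv f s ∧
        det2 (deriv f s) (iteratedDeriv 2 f s) * ‖deriv f t‖ ^ 3 ≠
          (if 0 < r then 1 else -1) * det2 (deriv f t) (iteratedDeriv 2 f t) * ‖deriv f s‖ ^ 3) ∧
    (∀ q : ℂ, q ≠ p → StablePointF f q) ∧ (crossingSetF f).Finite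

/-- A curve exhibiting a single `S`-type singularity (three strands meeting at one point,
pairwise transversally), all other points being stable. -/
def SSingF (f : ℝ → ℂ) : Prop :=
  ∃ p : ℂ, multF f p = 3 ∧ TransverseF f p ∧
    (∀ q : ℂ, q ≠ p → StablePointF f q) ∧ (crossingSetF f).Finite

/-- A `J` move: a regular homotopy between stable curves passing through exactly one
singular moment, of `J`-type. -/
def JMove (c c' : PlanarCurve) : Prop :=
  c.Stable ∧ c'.Stable ∧ ∃ H, IsRegHomotopy c.toFun c'.toFun H ∧
    ∃ s₀ ∈ Set.Ioo (0:ℝ) 1, (∀ s ∈ Set.Icc (0:ℝ) 1, s ≠ s₀ → StableF (H s)) ∧ JSingF (H s₀)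

/-- An `S` move: a regular homotopy between stable curves passing through exactly one
singular moment, of `S`-type. -/
def SMove (c c' : PlanarCurve) : Prop :=
  c.Stable ∧ c'.Stable ∧ ∃ H, IsRegHomotopy c.toFun c'.toFun H ∧
    ∃ s₀ ∈ Set.Ioo (0:ℝ) 1, (∀ s ∈ Set.Icc (0:ℝ) 1, s ≠ s₀ → StableF (H s)) ∧ SSingF (H s₀)

/-- A basic move is a `J` move or an `S` move. -/
def BasicMove (c c' : PlanarCurve) : Prop := JMove c c' ∨ SMove c c'

/-- An increasing `J` move adds two crossings. -/
def IncreasingJMove (c c' : PlanarCurve) : Prop :=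
  JMove c c' ∧ c'.crossings = c.crossings + 2

/-- A decreasing `J` move removes two crossings. -/
def DecreasingJMove (c c' : PlanarCurve) : Prop :=
  JMove c c' ∧ c.crossings = c'.crossings + 2

/-- A `Z` move: the composite of an increasing `J` move, an `S` move and a decreasing
`J` move (sliding an empty 1-gon past a transverse strand). -/
def ZMove (c c' : PlanarCurve) : Prop :=
  ∃ c₁ c₂, IncreasingJMove c c₁ ∧ SMove c₁ c₂ ∧ DecreasingJMove c₂ c'

/-- A sequence of `k` basic moves leading from `c` to `c'` (allowing an initial
deformation through stable curves). -/
def ChainFromTo (c c' : PlanarCurve) (seq : ℕ → PlanarCurve) (k : ℕ) : Prop :=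
  StablyHomotopic c (seq 0) ∧ seq k = c' ∧ ∀ i < k, BasicMove (seq i) (seq (i+1))

/-- The distance between two curves: the minimal number of basic moves needed to pass
from `c` to `c'` (`⊤` if they are not regularly homotopic). -/
def dist (c c' : PlanarCurve) : ℕ∞ :=
  sInf {m : ℕ∞ | ∃ k : ℕ, m = (k : ℕ∞) ∧ ∃ seq : ℕ → PlanarCurve, ChainFromTo c c' seq k}

/-- The diameter of a set of curves. -/
def diam (A : Set PlanarCurve) : ℕ∞ := ⨆ c ∈ A, ⨆ c' ∈ A, dist c c'

/-- `B^ω_n`: the set of all stable planar curves with Whitney number `ω` and at most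
`n` crossings. -/
def B (ω : ℤ) (n : ℕ) : Set PlanarCurve :=
  {c : PlanarCurve | c.Stable ∧ c.HasWhitney ω ∧ c.crossings ≤ n}

/-- A step of the algorithm: an `S` move, a decreasing `J` move, or a `Z` move whose two
intermediate curves have at most `N` crossings; `w` is the number of basic moves used. -/
def AlgStep (N : ℕ) (c c' : PlanarCurve) (w : ℕ) : Prop :=
  (SMove c c' ∧ w = 1) ∨ (DecreasingJMove c c' ∧ w = 1) ∨
  ((∃ c₁ c₂, IncreasingJMove c c₁ ∧ SMove c₁ c₂ ∧ DecreasingJMove c₂ c' ∧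
      c₁.crossings ≤ N ∧ c₂.crossings ≤ N) ∧ w = 3)

/-! #### The invariant `f^X` -/

/-- The set of parameter pairs (in one period) realizing the double points of a curve. -/
def crossingPairsF (f : ℝ → ℂ) : Set (ℝ × ℝ) :=
  {q : ℝ × ℝ | q.1 ∈ Set.Ico (0:ℝ) 1 ∧ q.2 ∈ Set.Ico (0:ℝ) 1 ∧ q.1 < q.2 ∧ f q.1 = f q.2}

/-- The sign `i(v) ∈ {1,-1}` of a double point visited first at time `s` and then at
time `t`: `1` iff the tangents, in the order visited, form a positive basis. -/
def crossSign (f : ℝ → ℂ) (s t : ℝ) : ℤ :=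
  if 0 < det2 (deriv f s) (deriv f t) then 1 else -1

/-- The index `i(e)` of the subarc `e` of `f` on the parameter interval `(α, β)`:
the sum of the signs of the double points of `e`. -/
def arcIndex (f : ℝ → ℂ) (α β : ℝ) : ℤ :=
  ∑ᶠ q ∈ {q : ℝ × ℝ | q.1 ∈ Set.Ioo α β ∧ q.2 ∈ Set.Ioo α β ∧ q.1 < q.2 ∧ f q.1 = f q.2},
    crossSign f q.1 q.2

/-- The order one invariant `f^X(c) = ∑_v X_{a(v),b(v)} ∈ 𝕏`, where for each double
point `v` the two arcs of `c` based at `v` are ordered by the orientation of the tangents. -/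
def fX (c : PlanarCurve) : FreeAbelianGroup (ℤ × ℤ) :=
  ∑ᶠ q ∈ crossingPairsF c.toFun,
    if 0 < det2 (deriv c.toFun q.1) (deriv c.toFun q.2) then
      FreeAbelianGroup.of (arcIndex c.toFun q.1 q.2, arcIndex c.toFun q.2 (q.1 + 1))
    else
      FreeAbelianGroup.of (arcIndex c.toFun q.2 (q.1 + 1), arcIndex c.toFun q.1 q.2)

/-- The integer valued invariant `g = φ ∘ f^X`. -/
def g (c : PlanarCurve) : ℤ := phi (fX c)

/-! #### The standard curves `δ_ω` -/

/-- An explicit stable curve with winding number `m ≥ 1` and `m - 1` (inward) loops. -/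
def deltaFunPos (m : ℕ) : ℝ → ℂ := fun t =>
  Complex.exp (((2 * Real.pi * (m : ℝ) * t : ℝ) : ℂ) * Complex.I) +
    ((2 * (m : ℝ) / 3 : ℝ) : ℂ) * Complex.exp (((2 * Real.pi * t : ℝ) : ℂ) * Complex.I)

/-- The standard planar curve `δ_ω` with Whitney number `ω` and `||ω|-1|` crossings:
for `ω = 0` a figure eight, and for `ω ≠ 0` a round circle with `|ω| - 1` small loops. -/
def deltaFun (ω : ℤ) : ℝ → ℂ :=
  if ω = 0 then
    fun t => ((Real.sin (2 * Real.pi * t) : ℝ) : ℂ) + ((Real.sin (4 * Real.pi * t) : ℝ) : ℂ) * Complex.I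
  else if 0 < ω then deltaFunPos ω.toNat
  else fun t => (starRingEnd ℂ) (deltaFunPos (-ω).toNat t)

end PlanarCurve


/-! ### Spherical curves -/


/-- A closed spherical curve: a smooth immersion of the circle `ℝ/ℤ` into the unit
sphere `S² ⊆ ℝ³`. -/
structure SphericalCurve : Type where
  toFun : ℝ → EuclideanSpace ℝ (Fin 3)
  norm_one : ∀ t : ℝ, ‖toFun t‖ = 1
  periodic : Function.Periodic toFun 1
  smooth : ContDiff ℝ (⊤ : ℕ∞) toFun
  immersion : ∀ t : ℝ, deriv toFun t ≠ 0

namespace SphericalCurve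

def multF (f : ℝ → EuclideanSpace ℝ (Fin 3)) (p : EuclideanSpace ℝ (Fin 3)) : ℕ :=
  Set.ncard {t ∈ Set.Ico (0:ℝ) 1 | f t = p}

/-- Transversality of the branches at `p`: tangent vectors at `p` are pairwise
independent, detected by the `3×3` determinant with the base point `p` (the outward
normal of the sphere, fixing its orientation). -/
def TransverseF (f : ℝ → EuclideanSpace ℝ (Fin 3)) (p : EuclideanSpace ℝ (Fin 3)) : Prop :=
  ∀ s ∈ Set.Ico (0:ℝ) 1, ∀ t ∈ Set.Ico (0:ℝ) 1, s ≠ t → f s = p → f t = p →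
    det3 p (deriv f s) (deriv f t) ≠ 0

def crossingSetF (f : ℝ → EuclideanSpace ℝ (Fin 3)) : Set (EuclideanSpace ℝ (Fin 3)) :=
  {p | 2 ≤ multF f p}

def StableF (f : ℝ → EuclideanSpace ℝ (Fin 3)) : Prop :=
  (crossingSetF f).Finite ∧ ∀ p, multF f p ≤ 2 ∧ (multF f p = 2 → TransverseF f p)

def Stable (c : SphericalCurve) : Prop := StableF c.toFun

def crossings (c : SphericalCurve) : ℕ := (crossingSetF c.toFun).ncard

/-- The curve as a map into the sphere as a subtype. -/
def pt (c : SphericalCurve) (t : ℝ) : Metric.sphere (0 : EuclideanSpace ℝ (Fin 3)) 1 :=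
  ⟨c.toFun t, mem_sphere_zero_iff_norm.mpr (c.norm_one t)⟩

/-- The planar curve obtained from `c` by deleting the point `v ∈ S²` not on `c`
(stereographic projection from `v`). -/
def proj (c : SphericalCurve) (v : Metric.sphere (0 : EuclideanSpace ℝ (Fin 3)) 1) :
    ℝ → EuclideanSpace ℝ (Fin 2) :=
  haveI : Fact (Module.finrank ℝ (EuclideanSpace ℝ (Fin 3)) = 2 + 1) := ⟨by simp⟩
  fun t => stereographic' 2 v (c.pt t)

/-- `c` has (spherical) Whitney number `ω ∈ ℤ/2`: the parity of the winding number of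
the planar curve obtained by deleting from `S²` a point in the complement of `c`. -/
def HasWhitney (c : SphericalCurve) (ω : ZMod 2) : Prop :=
  ∃ v : Metric.sphere (0 : EuclideanSpace ℝ (Fin 3)) 1,
    (∀ t : ℝ, c.toFun t ≠ (v : EuclideanSpace ℝ (Fin 3))) ∧
    ∃ (m : ℤ) (θ : ℝ → ℝ), Continuous θ ∧
      (∀ t : ℝ, deriv (c.proj v) t =
        ‖deriv (c.proj v) t‖ •
          ((WithLp.equiv 2 (Fin 2 → ℝ)).symm ![Real.cos (θ t), Real.sin (θ t)])) ∧
      θ 1 - θ 0 = 2 * Real.pi * (m : ℝ) ∧ ω = (m : ZMod 2)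

def IsRegHomotopy (f g : ℝ → EuclideanSpace ℝ (Fin 3))
    (H : ℝ → ℝ → EuclideanSpace ℝ (Fin 3)) : Prop :=
  (Continuous fun q : ℝ × ℝ => H q.1 q.2) ∧
  (Continuous fun q : ℝ × ℝ => deriv (H q.1) q.2) ∧
  (∀ s t : ℝ, ‖H s t‖ = 1) ∧
  (∀ s : ℝ, Function.Periodic (H s) 1) ∧
  (∀ s : ℝ, ContDiff ℝ (⊤ : ℕ∞) (H s)) ∧
  (∀ s t : ℝ, deriv (H s) t ≠ 0) ∧
  H 0 = f ∧ H 1 = g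

def RegularlyHomotopic (c c' : SphericalCurve) : Prop :=
  ∃ H, IsRegHomotopy c.toFun c'.toFun H

def StablyHomotopic (c c' : SphericalCurve) : Prop :=
  ∃ H, IsRegHomotopy c.toFun c'.toFun H ∧ ∀ s ∈ Set.Icc (0:ℝ) 1, StableF (H s)

def StablePointF (f : ℝ → EuclideanSpace ℝ (Fin 3)) (p : EuclideanSpace ℝ (Fin 3)) : Prop :=
  multF f p ≤ 1 ∨ (multF f p = 2 ∧ TransverseF f p)

def JSingF (f : ℝ → EuclideanSpace ℝ (Fin 3)) : Prop :=
  ∃ p : EuclideanSpace ℝ (Fin 3), multF f p = 2 ∧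
    (∀ s ∈ Set.Ico (0:ℝ) 1, ∀ t ∈ Set.Ico (0:ℝ) 1, s ≠ t → f s = p → f t = p →
      ∃ r : ℝ, r ≠ 0 ∧ deriv f t = r • deriv f s ∧
        det3 p (deriv f s) (iteratedDeriv 2 f s) * ‖deriv f t‖ ^ 3 ≠
          (if 0 < r then 1 else -1) * det3 p (deriv f t) (iteratedDeriv 2 f t) * ‖deriv f s‖ ^ 3) ∧
    (∀ q, q ≠ p → StablePointF f q) ∧ (crossingSetF f).Finite

def SSingF (f : ℝ → EuclideanSpace ℝ (Fin 3)) : Prop :=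
  ∃ p : EuclideanSpace ℝ (Fin 3), multF f p = 3 ∧ TransverseF f p ∧
    (∀ q, q ≠ p → StablePointF f q) ∧ (crossingSetF f).Finite

def JMove (c c' : SphericalCurve) : Prop :=
  c.Stable ∧ c'.Stable ∧ ∃ H, IsRegHomotopy c.toFun c'.toFun H ∧
    ∃ s₀ ∈ Set.Ioo (0:ℝ) 1, (∀ s ∈ Set.Icc (0:ℝ) 1, s ≠ s₀ → StableF (H s)) ∧ JSingF (H s₀)

def SMove (c c' : SphericalCurve) : Prop :=
  c.Stable ∧ c'.Stable ∧ ∃ H, IsRegHomotopy c.toFun c'.toFun H ∧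
    ∃ s₀ ∈ Set.Ioo (0:ℝ) 1, (∀ s ∈ Set.Icc (0:ℝ) 1, s ≠ s₀ → StableF (H s)) ∧ SSingF (H s₀)

def BasicMove (c c' : SphericalCurve) : Prop := JMove c c' ∨ SMove c c'

def IncreasingJMove (c c' : SphericalCurve) : Prop :=
  JMove c c' ∧ c'.crossings = c.crossings + 2

def DecreasingJMove (c c' : SphericalCurve) : Prop :=
  JMove c c' ∧ c.crossings = c'.crossings + 2

def ZMove (c c' : SphericalCurve) : Prop :=
  ∃ c₁ c₂, IncreasingJMove c c₁ ∧ SMove c₁ c₂ ∧ DecreasingJMove c₂ c'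

def ChainFromTo (c c' : SphericalCurve) (seq : ℕ → SphericalCurve) (k : ℕ) : Prop :=
  StablyHomotopic c (seq 0) ∧ seq k = c' ∧ ∀ i < k, BasicMove (seq i) (seq (i+1))

def dist (c c' : SphericalCurve) : ℕ∞ :=
  sInf {m : ℕ∞ | ∃ k : ℕ, m = (k : ℕ∞) ∧ ∃ seq : ℕ → SphericalCurve, ChainFromTo c c' seq k}

def diam (A : Set SphericalCurve) : ℕ∞ := ⨆ c ∈ A, ⨆ c' ∈ A, dist c c'

def B (ω : ZMod 2) (n : ℕ) : Set SphericalCurve :=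
  {c : SphericalCurve | c.Stable ∧ c.HasWhitney ω ∧ c.crossings ≤ n}

def AlgStep (N : ℕ) (c c' : SphericalCurve) (w : ℕ) : Prop :=
  (SMove c c' ∧ w = 1) ∨ (DecreasingJMove c c' ∧ w = 1) ∨
  ((∃ c₁ c₂, IncreasingJMove c c₁ ∧ SMove c₁ c₂ ∧ DecreasingJMove c₂ c' ∧
      c₁.crossings ≤ N ∧ c₂.crossings ≤ N) ∧ w = 3)

/-! #### The invariant `f^X` for spherical curves -/

def crossingPairsF (f : ℝ → EuclideanSpace ℝ (Fin 3)) : Set (ℝ × ℝ) :=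
  {q : ℝ × ℝ | q.1 ∈ Set.Ico (0:ℝ) 1 ∧ q.2 ∈ Set.Ico (0:ℝ) 1 ∧ q.1 < q.2 ∧ f q.1 = f q.2}

def crossSign (f : ℝ → EuclideanSpace ℝ (Fin 3)) (s t : ℝ) : ℤ :=
  if 0 < det3 (f s) (deriv f s) (deriv f t) then 1 else -1

def arcIndex (f : ℝ → EuclideanSpace ℝ (Fin 3)) (α β : ℝ) : ℤ :=
  ∑ᶠ q ∈ {q : ℝ × ℝ | q.1 ∈ Set.Ioo α β ∧ q.2 ∈ Set.Ioo α β ∧ q.1 < q.2 ∧ f q.1 = f q.2},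
    crossSign f q.1 q.2

def fX (c : SphericalCurve) : FreeAbelianGroup (ℤ × ℤ) :=
  ∑ᶠ q ∈ crossingPairsF c.toFun,
    if 0 < det3 (c.toFun q.1) (deriv c.toFun q.1) (deriv c.toFun q.2) then
      FreeAbelianGroup.of (arcIndex c.toFun q.1 q.2, arcIndex c.toFun q.2 (q.1 + 1))
    else
      FreeAbelianGroup.of (arcIndex c.toFun q.2 (q.1 + 1), arcIndex c.toFun q.1 q.2)

def g (c : SphericalCurve) : ℤ := phi (fX c)

/-- Inverse stereographic projection `ℂ → S²` from the north pole. -/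
def stereoInv (z : ℂ) : EuclideanSpace ℝ (Fin 3) :=
  (WithLp.equiv 2 (Fin 3 → ℝ)).symm
    ![2 * z.re / (Complex.normSq z + 1), 2 * z.im / (Complex.normSq z + 1),
      (Complex.normSq z - 1) / (Complex.normSq z + 1)]

/-- The standard spherical curves `δ_0` (one crossing) and `δ_1` (embedded):
the images in `S²` of the standard planar curves `δ_0`, `δ_1`. -/
def deltaFun (ω : ZMod 2) : ℝ → EuclideanSpace ℝ (Fin 3) :=
  fun t => stereoInv (PlanarCurve.deltaFun (if ω = 0 then 0 else 1) t)

end SphericalCurve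


/-- The determinant of two vectors in `ℝ × ℝ`. -/
def det2P (u v : ℝ × ℝ) : ℝ := u.1 * v.2 - u.2 * v.1

/-- The closed region bounded by a subset of the plane: the set together with all the
bounded connected components of its complement. -/
def closedRegion (S : Set ℂ) : Set ℂ :=
  S ∪ {p : ℂ | p ∉ S ∧ Bornology.IsBounded (connectedComponentIn Sᶜ p)}


lemma exists_clog {E : Type*} [NormedAddCommGroup E] [NormedSpace ℝ E] {K : Set E}
    (hK : IsCompact K) (hc : Convex ℝ K) {x0 : E} (hx0 : x0 ∈ K) {F : E → ℂ}
    (hF : ContinuousOn F K) (h0 : ∀ x ∈ K, F x ≠ 0) :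
    ∃ L : E → ℂ, ContinuousOn L K ∧ ∀ x ∈ K, Complex.exp (L x) = F x := by
  obtain ⟨xm, hxm, hmin⟩ := hK.exists_isMinOn ⟨x0, hx0⟩ hF.norm
  have hm : 0 < ‖F xm‖ := norm_pos_iff.mpr (h0 xm hxm)
  have hu := hK.uniformContinuousOn_of_continuous hF
  rw [Metric.uniformContinuousOn_iff] at hu
  obtain ⟨η, hη, hu⟩ := hu _ hm
  obtain ⟨C, hC⟩ := hK.isBounded.exists_norm_le
  obtain ⟨n, hn⟩ := exists_nat_gt ((C + ‖x0‖) / η)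
  have hC0 : 0 ≤ C + ‖x0‖ := by
    have := hC x0 hx0; linarith [norm_nonneg x0]
  have hn0 : 0 < (n : ℝ) := lt_of_le_of_lt (by positivity) hn
  have hnn : 0 < n := by exact_mod_cast hn0
  let p : ℕ → E → E := fun k x => x0 + ((k : ℝ) / n) • (x - x0)
  have hp : ∀ k ≤ n, ∀ x ∈ K, p k x ∈ K := by
    intro k hk x hx
    apply hc.add_smul_sub_mem hx0 hx
    refine ⟨by positivity, ?_⟩
    rw [div_le_one hn0]; exact_mod_cast hk
  have hpc : ∀ k, Continuous (p k) := by
    intro k; simp only [p]; fun_prop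
  have hdist : ∀ k, ∀ x ∈ K, dist (p (k+1) x) (p k x) < η := by
    intro k x hx
    have : p (k+1) x - p k x = (1 / n : ℝ) • (x - x0) := by
      simp only [p, add_sub_add_left_eq_sub, ← sub_smul]
      congr 1; push_cast; ring
    rw [dist_eq_norm, this, norm_smul, Real.norm_of_nonneg (by positivity)]
    have h1 : ‖x - x0‖ ≤ C + ‖x0‖ := (norm_sub_le _ _).trans (by linarith [hC x hx])
    rw [div_lt_iff₀ hη] at hn
    rw [div_mul_eq_mul_div, one_mul, div_lt_iff₀ hn0]
    linarith
  have hsl : ∀ k < n, ∀ x ∈ K, F (p (k+1) x) / F (p k x) ∈ Complex.slitPlane := by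
    intro k hk x hx
    have hk0 := h0 _ (hp k hk.le x hx)
    have h1 : F (p (k+1) x) / F (p k x) = 1 + (F (p (k+1) x) - F (p k x)) / F (p k x) := by
      field_simp; ring
    rw [h1]
    apply Complex.mem_slitPlane_of_norm_lt_one
    rw [norm_div, div_lt_one (norm_pos_iff.mpr hk0)]
    have h2 := hu _ (hp (k+1) hk x hx) _ (hp k hk.le x hx) (hdist k x hx)
    rw [dist_eq_norm] at h2
    exact h2.trans_le (hmin (hp k hk.le x hx))
  refine ⟨fun x => Complex.log (F x0) + ∑ k ∈ Finset.range n,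
    Complex.log (F (p (k+1) x) / F (p k x)), ?_, ?_⟩
  · apply continuousOn_const.add
    apply continuousOn_finsetSum
    intro k hk
    rw [Finset.mem_range] at hk
    apply ContinuousOn.clog
    · apply ContinuousOn.div
      · exact hF.comp (hpc _).continuousOn (fun x hx => hp _ hk x hx)
      · exact hF.comp (hpc _).continuousOn (fun x hx => hp _ hk.le x hx)
      · intro x hx; exact h0 _ (hp k hk.le x hx)
    · exact hsl k hk
  · intro x hx
    have key : ∀ j ≤ n, Complex.exp (Complex.log (F x0) + ∑ k ∈ Finset.range j,
        Complex.log (F (p (k+1) x) / F (p k x))) = F (p j x) := by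
      intro j
      induction j with
      | zero => intro _; simp [p, Complex.exp_log (h0 x0 hx0)]
      | succ j ih =>
        intro hj
        rw [Finset.sum_range_succ, ← add_assoc, Complex.exp_add, ih (by omega),
          Complex.exp_log (Complex.slitPlane_ne_zero (hsl j (by omega) x hx))]
        have := h0 _ (hp j (by omega) x hx)
        field_simp
    rw [key n le_rfl]
    congr 1
    simp only [p]
    rw [div_self hn0.ne']; simp

lemma clog_diff_const {S : Set ℝ} (hS : IsPreconnected S) {L M : ℝ → ℂ}
    (hL : ContinuousOn L S) (hM : ContinuousOn M S)
    (h : ∀ x ∈ S, Complex.exp (L x) = Complex.exp (M x)) {a b : ℝ} (ha : a ∈ S) (hb : b ∈ S) :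
    L b - L a = M b - M a := by
  have hD : ContinuousOn (fun x => (L x - M x) / (2 * Real.pi * Complex.I)) S :=
    (hL.sub hM).div_const _
  have hne : (2 * Real.pi * Complex.I : ℂ) ≠ 0 := Complex.two_pi_I_ne_zero
  have hint : ∀ x ∈ S, ∃ n : ℤ, (L x - M x) / (2 * Real.pi * Complex.I) = n := by
    intro x hx
    have : Complex.exp (L x - M x) = 1 := by
      rw [Complex.exp_sub, h x hx, div_self (Complex.exp_ne_zero _)]
    obtain ⟨n, hn⟩ := Complex.exp_eq_one_iff.mp this
    exact ⟨n, by rw [hn, mul_div_cancel_right₀ _ hne]⟩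
  have hre : ContinuousOn (fun x => ((L x - M x) / (2 * Real.pi * Complex.I)).re) S :=
    Complex.continuous_re.comp_continuousOn hD
  have himg := hS.image _ hre
  have hcount : ((fun x => ((L x - M x) / (2 * Real.pi * Complex.I)).re) '' S).Countable := by
    apply (Set.countable_range (fun n : ℤ => (n : ℝ))).mono
    rintro _ ⟨x, hx, rfl⟩
    obtain ⟨n, hn⟩ := hint x hx
    exact ⟨n, by simp only [hn]; simp⟩
  have hsub : ((fun x => ((L x - M x) / (2 * Real.pi * Complex.I)).re) '' S).Subsingleton := by
    by_contra hns
    have hnt := Set.not_subsingleton_iff.mp hns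
    obtain ⟨u, hu, v, hv, huv⟩ := hnt.exists_lt
    have : Icc u v ⊆ _ := himg.Icc_subset hu hv
    exact (Cardinal.Real.Icc_countable_iff.mp (hcount.mono this)).not_gt huv
  have hab := hsub ⟨a, ha, rfl⟩ ⟨b, hb, rfl⟩
  obtain ⟨n, hn⟩ := hint a ha
  obtain ⟨m, hm⟩ := hint b hb
  simp only [hn, hm, Complex.intCast_re] at hab
  have hnm : n = m := by exact_mod_cast hab
  subst hnm
  have h3 : L a - M a = L b - M b := by
    rw [div_eq_iff hne] at hn hm
    rw [hn, hm]
  linear_combination -h3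


def V (g : ℝ → ℂ) (a b : ℝ) : ℂ := by
  classical
  exact if h : ∃ L : ℝ → ℂ, ContinuousOn L (Icc a b) ∧ ∀ x ∈ Icc a b, Complex.exp (L x) = g x then
    h.choose b - h.choose a else 0

lemma V_eq {g L : ℝ → ℂ} {a b : ℝ} (hab : a ≤ b) (hL : ContinuousOn L (Icc a b))
    (h : ∀ x ∈ Icc a b, Complex.exp (L x) = g x) : V g a b = L b - L a := by
  have hex : ∃ L : ℝ → ℂ, ContinuousOn L (Icc a b) ∧ ∀ x ∈ Icc a b, Complex.exp (L x) = g x :=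
    ⟨L, hL, h⟩
  unfold V
  rw [dif_pos hex]
  exact clog_diff_const isPreconnected_Icc hex.choose_spec.1 hL
    (fun x hx => (hex.choose_spec.2 x hx).trans (h x hx).symm)
    (left_mem_Icc.mpr hab) (right_mem_Icc.mpr hab)

lemma V_exists {g : ℝ → ℂ} {a b : ℝ} (hab : a ≤ b) (hg : ContinuousOn g (Icc a b))
    (h0 : ∀ x ∈ Icc a b, g x ≠ 0) :
    ∃ L : ℝ → ℂ, ContinuousOn L (Icc a b) ∧ ∀ x ∈ Icc a b, Complex.exp (L x) = g x :=
  exists_clog isCompact_Icc (convex_Icc a b) (left_mem_Icc.mpr hab) hg h0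

lemma V_add {g : ℝ → ℂ} {a b m : ℝ} (ham : a ≤ m) (hmb : m ≤ b) (hg : ContinuousOn g (Icc a b))
    (h0 : ∀ x ∈ Icc a b, g x ≠ 0) : V g a b = V g a m + V g m b := by
  obtain ⟨L, hL, h⟩ := V_exists (ham.trans hmb) hg h0
  rw [V_eq (ham.trans hmb) hL h, V_eq ham (hL.mono (Icc_subset_Icc_right hmb))
    (fun x hx => h x (Icc_subset_Icc_right hmb hx)), V_eq hmb (hL.mono (Icc_subset_Icc_left ham))
    (fun x hx => h x (Icc_subset_Icc_left ham hx))]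
  ring

lemma V_rouche {f g : ℝ → ℂ} {a b : ℝ} (hab : a ≤ b) (hf : ContinuousOn f (Icc a b))
    (hg : ContinuousOn g (Icc a b)) (h : ∀ x ∈ Icc a b, g x ≠ 0 ∧ f x / g x ∈ Complex.slitPlane) :
    V f a b = V g a b + (Complex.log (f b / g b) - Complex.log (f a / g a)) := by
  obtain ⟨L, hL, hLe⟩ := V_exists hab hg (fun x hx => (h x hx).1)
  rw [V_eq hab hL hLe, V_eq hab (L := fun x => L x + Complex.log (f x / g x)) ?_ ?_]
  · ring
  · exact hL.add ((hf.div hg (fun x hx => (h x hx).1)).clog (fun x hx => (h x hx).2))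
  · intro x hx
    rw [Complex.exp_add, hLe x hx, Complex.exp_log (Complex.slitPlane_ne_zero (h x hx).2)]
    have := (h x hx).1
    field_simp

lemma V_slit {f : ℝ → ℂ} {a b : ℝ} {k : ℂ} (hk : k ≠ 0) (hab : a ≤ b) (hf : ContinuousOn f (Icc a b))
    (h : ∀ x ∈ Icc a b, f x / k ∈ Complex.slitPlane) :
    V f a b = Complex.log (f b / k) - Complex.log (f a / k) := by
  rw [V_rouche (g := fun _ => k) hab hf continuousOn_const (fun x hx => ⟨hk, h x hx⟩),
    V_eq (L := fun _ => Complex.log k) hab continuousOn_const (fun x _ => Complex.exp_log hk)]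
  ring

lemma V_congr {f g : ℝ → ℂ} {a b : ℝ} (hab : a ≤ b) (hg : ContinuousOn g (Icc a b))
    (h0 : ∀ x ∈ Icc a b, g x ≠ 0) (h : ∀ x ∈ Icc a b, f x = g x) : V f a b = V g a b := by
  obtain ⟨L, hL, hLe⟩ := V_exists hab hg h0
  rw [V_eq hab hL hLe, V_eq hab hL (fun x hx => (hLe x hx).trans (h x hx).symm)]

/-- log variation along the boundary of a rectangle -/
def bdry (F : ℝ → ℝ → ℂ) (a b c d : ℝ) : ℂ :=
  V (fun x => F x c) a b + V (F b) c d - V (fun x => F x d) a b - V (F a) c d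

lemma contOn_h {F : ℝ → ℝ → ℂ} {a b c d : ℝ}
    (hF : ContinuousOn (fun q : ℝ × ℝ => F q.1 q.2) (Icc a b ×ˢ Icc c d)) {y : ℝ} (hy : y ∈ Icc c d) :
    ContinuousOn (fun x => F x y) (Icc a b) :=
  hF.comp (f := fun x : ℝ => (x, y)) (by fun_prop) (fun x hx => ⟨hx, hy⟩)

lemma contOn_v {F : ℝ → ℝ → ℂ} {a b c d : ℝ}
    (hF : ContinuousOn (fun q : ℝ × ℝ => F q.1 q.2) (Icc a b ×ˢ Icc c d)) {x : ℝ} (hx : x ∈ Icc a b) :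
    ContinuousOn (F x) (Icc c d) :=
  hF.comp (f := fun y : ℝ => (x, y)) (by fun_prop) (fun y hy => ⟨hx, hy⟩)

lemma bdry_zero {F : ℝ → ℝ → ℂ} {a b c d : ℝ} (hab : a ≤ b) (hcd : c ≤ d)
    (hF : ContinuousOn (fun q : ℝ × ℝ => F q.1 q.2) (Icc a b ×ˢ Icc c d))
    (h0 : ∀ x ∈ Icc a b, ∀ y ∈ Icc c d, F x y ≠ 0) : bdry F a b c d = 0 := by
  obtain ⟨L, hL, hLe⟩ := exists_clog (isCompact_Icc.prod isCompact_Icc)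
    ((convex_Icc a b).prod (convex_Icc c d)) (x0 := (a, c))
    ⟨left_mem_Icc.mpr hab, left_mem_Icc.mpr hcd⟩ hF (fun q hq => h0 _ hq.1 _ hq.2)
  have hh : ∀ y ∈ Icc c d, V (fun x => F x y) a b = L (b, y) - L (a, y) := fun y hy =>
    V_eq (L := fun x => L (x, y)) hab (contOn_h (F := fun x y => L (x, y)) hL hy)
      (fun x hx => hLe (x, y) ⟨hx, hy⟩)
  have hv : ∀ x ∈ Icc a b, V (F x) c d = L (x, d) - L (x, c) := fun x hx =>
    V_eq (L := fun y => L (x, y)) hcd (contOn_v (F := fun x y => L (x, y)) hL hx)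
      (fun y hy => hLe (x, y) ⟨hx, hy⟩)
  unfold bdry
  rw [hh _ (left_mem_Icc.mpr hcd), hh _ (right_mem_Icc.mpr hcd), hv _ (left_mem_Icc.mpr hab),
    hv _ (right_mem_Icc.mpr hab)]
  ring

lemma bdry_rouche {F G : ℝ → ℝ → ℂ} {a b c d : ℝ} (hab : a ≤ b) (hcd : c ≤ d)
    (hF : ContinuousOn (fun q : ℝ × ℝ => F q.1 q.2) (Icc a b ×ˢ Icc c d))
    (hG : ContinuousOn (fun q : ℝ × ℝ => G q.1 q.2) (Icc a b ×ˢ Icc c d))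
    (h : ∀ x ∈ Icc a b, ∀ y ∈ Icc c d, (x = a ∨ x = b ∨ y = c ∨ y = d) →
      ‖F x y - G x y‖ < ‖G x y‖) : bdry F a b c d = bdry G a b c d := by
  have key : ∀ u v : ℂ, ‖u - v‖ < ‖v‖ → v ≠ 0 ∧ u / v ∈ Complex.slitPlane := by
    intro u v huv
    have hv : v ≠ 0 := norm_pos_iff.mp (lt_of_le_of_lt (norm_nonneg _) huv)
    refine ⟨hv, ?_⟩
    have : u / v = 1 + (u - v) / v := by field_simp; ring
    rw [this]
    apply Complex.mem_slitPlane_of_norm_lt_one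
    rwa [norm_div, div_lt_one (norm_pos_iff.mpr hv)]
  have ha := left_mem_Icc.mpr hab
  have hb := right_mem_Icc.mpr hab
  have hc := left_mem_Icc.mpr hcd
  have hd := right_mem_Icc.mpr hcd
  unfold bdry
  rw [V_rouche hab (contOn_h hF hc) (contOn_h hG hc) (fun x hx => key _ _ (h x hx c hc (by simp))),
    V_rouche hab (contOn_h hF hd) (contOn_h hG hd) (fun x hx => key _ _ (h x hx d hd (by simp))),
    V_rouche hcd (contOn_v hF ha) (contOn_v hG ha) (fun y hy => key _ _ (h a ha y hy (by simp))),
    V_rouche hcd (contOn_v hF hb) (contOn_v hG hb) (fun y hy => key _ _ (h b hb y hy (by simp)))]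
  ring

lemma bdry_split_x {F : ℝ → ℝ → ℂ} {a b c d m : ℝ} (ham : a ≤ m) (hmb : m ≤ b) (hcd : c ≤ d)
    (hF : ContinuousOn (fun q : ℝ × ℝ => F q.1 q.2) (Icc a b ×ˢ Icc c d))
    (h : ∀ x ∈ Icc a b, F x c ≠ 0 ∧ F x d ≠ 0) :
    bdry F a b c d = bdry F a m c d + bdry F m b c d := by
  unfold bdry
  rw [V_add (g := fun x => F x c) ham hmb (contOn_h hF (left_mem_Icc.mpr hcd)) (fun x hx => (h x hx).1),
    V_add (g := fun x => F x d) ham hmb (contOn_h hF (right_mem_Icc.mpr hcd)) (fun x hx => (h x hx).2)]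
  ring

lemma bdry_split_y {F : ℝ → ℝ → ℂ} {a b c d m : ℝ} (hcm : c ≤ m) (hmd : m ≤ d) (hab : a ≤ b)
    (hF : ContinuousOn (fun q : ℝ × ℝ => F q.1 q.2) (Icc a b ×ˢ Icc c d))
    (h : ∀ y ∈ Icc c d, F a y ≠ 0 ∧ F b y ≠ 0) :
    bdry F a b c d = bdry F a b c m + bdry F a b m d := by
  unfold bdry
  rw [V_add (g := F a) hcm hmd (contOn_v hF (left_mem_Icc.mpr hab)) (fun x hx => (h x hx).1),
    V_add (g := F b) hcm hmd (contOn_v hF (right_mem_Icc.mpr hab)) (fun x hx => (h x hx).2)]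
  ring


lemma log_pair {z : ℂ} (h : z.im ≠ 0) :
    Complex.log z + Complex.log (-z⁻¹) = (SignType.sign z.im : ℂ) * (Real.pi * Complex.I) := by
  have harg : z.arg ≠ Real.pi := by
    intro h'; rw [Complex.arg_eq_pi_iff] at h'; exact h h'.2
  have him : (z⁻¹).im = -z.im / Complex.normSq z := Complex.inv_im z
  have hz : z ≠ 0 := by rintro rfl; simp at h
  have hns : 0 < Complex.normSq z := Complex.normSq_pos.mpr hz
  have hl := Complex.log_inv z harg
  have key : ∀ s : ℝ, Complex.arg (-z⁻¹) = Complex.arg z⁻¹ + s →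
      Complex.log (-z⁻¹) = Complex.log z⁻¹ + s * Complex.I := by
    intro s hs
    simp only [Complex.log, hs, norm_neg]
    push_cast; ring
  rcases lt_or_gt_of_ne h with h' | h'
  · have : 0 < (z⁻¹).im := by rw [him]; apply div_pos _ hns; linarith
    rw [key (-Real.pi) (by rw [Complex.arg_neg_eq_arg_sub_pi_of_im_pos this]; ring), hl, sign_neg h']
    simp
  · have : (z⁻¹).im < 0 := by rw [him]; apply div_neg_of_neg_of_pos _ hns; linarith
    rw [key (Real.pi) (by rw [Complex.arg_neg_eq_arg_add_pi_of_im_neg this]), hl, sign_pos h']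
    simp

lemma det2_smul (a b : ℝ) (p q : ℂ) : det2 (a • p) (b • q) = a * b * det2 p q := by
  simp [det2]; ring

lemma im_div_det2 (p q : ℂ) : (q / p).im = det2 p q / Complex.normSq p := by
  simp [Complex.div_im, det2]; ring

lemma seg_slit {p q : ℂ} (h : det2 p q ≠ 0) {α β : ℝ} (hb : 0 ≤ β) (hab : 0 < α + β) :
    (α • p + β • q) / p ∈ Complex.slitPlane := by
  have hp : p ≠ 0 := by rintro rfl; simp [det2] at h
  have : (α • p + β • q) / p = α + β * (q / p) := by
    simp only [Complex.real_smul]; field_simp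
  rw [this, Complex.mem_slitPlane_iff]
  rcases hb.eq_or_lt with hb | hb
  · left; subst hb; simpa using hab
  · right
    have h1 := im_div_det2 p q
    simp only [Complex.add_im, Complex.ofReal_im, Complex.mul_im, Complex.ofReal_re, zero_mul, add_zero, zero_add, h1]
    have := Complex.normSq_pos.mpr hp
    positivity

/-- Log variation along a segment. -/
lemma V_seg {f : ℝ → ℂ} {a b : ℝ} (hab : a < b) {p q : ℂ} (h : det2 p q ≠ 0)
    (hf : ∀ x, f x = ((b - x) / (b - a)) • p + ((x - a) / (b - a)) • q) :
    V f a b = Complex.log (q / p) := by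
  have hp : p ≠ 0 := by rintro rfl; simp [det2] at h
  have hne : b - a ≠ 0 := (sub_pos.mpr hab).ne'
  have h0 : 0 < b - a := sub_pos.mpr hab
  rw [V_slit hp hab.le]
  · simp [hf, hne, hp]
  · rw [show f = _ from funext hf]; fun_prop
  · intro x hx
    rw [hf]
    apply seg_slit h
    · exact div_nonneg (by linarith [hx.1]) h0.le
    · rw [← add_div]; apply div_pos _ h0; linarith

lemma bdry_lin (u w : ℂ) (h : det2 u w ≠ 0) (x0 y0 ρ : ℝ) (hρ : 0 < ρ) :
    bdry (fun x y => (x - x0) • u + (y - y0) • w) (x0 - ρ) (x0 + ρ) (y0 - ρ) (y0 + ρ) =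
      2 * Real.pi * Complex.I * (SignType.sign (det2 u w) : ℂ) := by
  set P := ρ • (u + w) with hP
  set Q := ρ • (w - u) with hQ
  have hPQ : det2 P Q = 2 * ρ ^ 2 * det2 u w := by simp [det2, P, Q]; ring
  have hPQ0 : det2 P Q ≠ 0 := by rw [hPQ]; positivity
  have e1 : det2 (-P) (-Q) = det2 P Q := by simp [det2]
  have e2 : det2 (-Q) P = det2 P Q := by simp [det2]; ring
  have e4 : det2 (-P) Q = -det2 P Q := by simp [det2]; ring
  have hPz : P ≠ 0 := by intro h; rw [h] at hPQ0; simp [det2] at hPQ0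
  have hQz : Q ≠ 0 := by intro h; rw [h] at hPQ0; simp [det2] at hPQ0
  have hρ' : ρ ≠ 0 := hρ.ne'
  have hlt : ∀ t : ℝ, t - ρ < t + ρ := fun t => by linarith
  have him := im_div_det2 P Q
  have hnP := Complex.normSq_pos.mpr hPz
  have him0 : (Q / P).im ≠ 0 := by rw [him]; positivity
  have hargne : ∀ z : ℂ, z.im ≠ 0 → z.arg ≠ Real.pi := by
    intro z h h'; rw [Complex.arg_eq_pi_iff] at h'; exact h h'.2
  have hsg : SignType.sign (Q / P).im = SignType.sign (det2 u w) := by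
    rw [him, hPQ, mul_comm, mul_div_assoc, sign_mul, sign_pos (a := 2 * ρ^2 / Complex.normSq P) (by positivity), mul_one]
  have hb : ∀ t x : ℝ, (t + ρ - x) / (t + ρ - (t - ρ)) = (ρ - (x - t)) / (2 * ρ) := by
    intro t x; congr 1 <;> ring
  have ha : ∀ t x : ℝ, (x - (t - ρ)) / (t + ρ - (t - ρ)) = (ρ + (x - t)) / (2 * ρ) := by
    intro t x; congr 1 <;> ring
  have hρc : (ρ : ℂ) ≠ 0 := by exact_mod_cast hρ'
  have B1 := V_seg (f := fun x => (x - x0) • u + (y0 - ρ - y0) • w) (hlt x0) (p := -P) (q := -Q) (by rw [e1]; exact hPQ0)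
    (by intro x; rw [ha, hb]; simp only [P, Q, Complex.real_smul]; push_cast; field_simp; ring)
  have B2 := V_seg (f := fun y => (x0 + ρ - x0) • u + (y - y0) • w) (hlt y0) (p := -Q) (q := P) (by rw [e2]; exact hPQ0)
    (by intro x; rw [ha, hb]; simp only [P, Q, Complex.real_smul]; push_cast; field_simp; ring)
  have B3 := V_seg (f := fun x => (x - x0) • u + (y0 + ρ - y0) • w) (hlt x0) (p := Q) (q := P) (by
      rw [show det2 Q P = - det2 P Q by simp [det2]; ring]; exact neg_ne_zero.mpr hPQ0)
    (by intro x; rw [ha, hb]; simp only [P, Q, Complex.real_smul]; push_cast; field_simp; ring)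
  have B4 := V_seg (f := fun y => (x0 - ρ - x0) • u + (y - y0) • w) (hlt y0) (p := -P) (q := Q) (by rw [e4]; exact neg_ne_zero.mpr hPQ0)
    (by intro x; rw [ha, hb]; simp only [P, Q, Complex.real_smul]; push_cast; field_simp; ring)
  unfold bdry
  rw [B1, B2, B3, B4]
  have z1 : -Q / -P = Q / P := by field_simp
  have z2 : P / -Q = -(Q / P)⁻¹ := by field_simp
  have z3 : P / Q = (Q / P)⁻¹ := by field_simp
  have z4 : Q / -P = (-(Q / P)⁻¹)⁻¹ := by field_simp
  rw [z1, z2, z3, z4, Complex.log_inv _ (hargne _ him0), Complex.log_inv _ (hargne _ ?_)]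
  · have := log_pair him0
    rw [hsg] at this
    linear_combination 2 * this
  · rw [Complex.neg_im, Complex.inv_im]
    have : 0 < Complex.normSq (Q / P) := Complex.normSq_pos.mpr (div_ne_zero hQz hPz)
    simp only [neg_div, neg_neg]
    positivity

/-- First order approximation at a zero. -/
def LinAt (F : ℝ → ℝ → ℂ) (z : ℝ × ℝ) (u w : ℂ) : Prop :=
  ∀ ε > 0, ∃ r > 0, ∀ x y : ℝ, |x - z.1| ≤ r → |y - z.2| ≤ r →
    ‖F x y - ((x - z.1) • u + (y - z.2) • w)‖ ≤ ε * (|x - z.1| + |y - z.2|)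

lemma lin_lower {u w : ℂ} (h : det2 u w ≠ 0) : ∃ c > 0, ∀ x y : ℝ,
    c * (|x| + |y|) ≤ ‖x • u + y • w‖ := by
  have hd : ∀ p q : ℂ, |det2 p q| ≤ ‖p‖ * ‖q‖ := by
    intro p q
    have : det2 p q = ((starRingEnd ℂ) p * q).im := by simp [det2]; ring
    rw [this]
    refine (Complex.abs_im_le_norm _).trans ?_
    simp
  have hu : 0 < ‖u‖ := by rw [norm_pos_iff]; rintro rfl; simp [det2] at h
  have hw : 0 < ‖w‖ := by rw [norm_pos_iff]; rintro rfl; simp [det2] at h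
  have h' : 0 < |det2 u w| := abs_pos.mpr h
  refine ⟨|det2 u w| / (‖u‖ + ‖w‖), by positivity, ?_⟩
  intro x y
  have h1 := hd (x • u + y • w) w
  have h2 := hd u (x • u + y • w)
  rw [show det2 (x • u + y • w) w = x * det2 u w by simp [det2]; ring, abs_mul] at h1
  rw [show det2 u (x • u + y • w) = y * det2 u w by simp [det2]; ring, abs_mul] at h2
  rw [div_mul_eq_mul_div, div_le_iff₀ (by positivity)]
  nlinarith

lemma DL_one {F : ℝ → ℝ → ℂ} {a b c d : ℝ} {z : ℝ × ℝ} {u w : ℂ}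
    (hF : ContinuousOn (fun q : ℝ × ℝ => F q.1 q.2) (Icc a b ×ˢ Icc c d))
    (h1 : z.1 ∈ Ioo a b) (h2 : z.2 ∈ Ioo c d)
    (h0 : ∀ x ∈ Icc a b, ∀ y ∈ Icc c d, F x y = 0 → (x, y) = z)
    (hl : LinAt F z u w) (hd : det2 u w ≠ 0) :
    bdry F a b c d = 2 * Real.pi * Complex.I * (SignType.sign (det2 u w) : ℂ) := by
  obtain ⟨k, hk, hlow⟩ := lin_lower hd
  obtain ⟨r, hr, hl⟩ := hl (k / 2) (by positivity)
  obtain ⟨ρ, hρ, hρ1⟩ : ∃ ρ > 0, ρ < r ∧ ρ < z.1 - a ∧ ρ < b - z.1 ∧ ρ < z.2 - c ∧ ρ < d - z.2 := by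
    have : 0 < min r (min (z.1 - a) (min (b - z.1) (min (z.2 - c) (d - z.2)))) := by
      simp only [lt_min_iff]
      exact ⟨hr, by linarith [h1.1], by linarith [h1.2], by linarith [h2.1], by linarith [h2.2]⟩
    obtain ⟨ρ, hρ, hρ'⟩ := exists_between this
    simp only [lt_min_iff] at hρ'
    exact ⟨ρ, hρ, hρ'⟩
  obtain ⟨g1, g2, g3, g4, g5⟩ := hρ1
  have nz : ∀ x ∈ Icc a b, ∀ y ∈ Icc c d, (x ≠ z.1 ∨ y ≠ z.2) → F x y ≠ 0 := by
    intro x hx y hy hne h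
    have := h0 x hx y hy h
    rw [← this] at hne; simp at hne
  have sub : ∀ {a' b' c' d' : ℝ}, a ≤ a' → b' ≤ b → c ≤ c' → d' ≤ d →
      ContinuousOn (fun q : ℝ × ℝ => F q.1 q.2) (Icc a' b' ×ˢ Icc c' d') := by
    intro a' b' c' d' h1 h2 h3 h4
    exact hF.mono (prod_mono (Icc_subset_Icc h1 h2) (Icc_subset_Icc h3 h4))
  rw [bdry_split_x (m := z.1 - ρ) (by linarith) (by linarith) (by linarith) hF
      (fun x hx => ⟨nz x hx c (by constructor <;> linarith) (Or.inr (by linarith)),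
        nz x hx d (by constructor <;> linarith) (Or.inr (by linarith))⟩),
    bdry_split_x (a := z.1 - ρ) (m := z.1 + ρ) (by linarith) (by linarith) (by linarith) (sub (by linarith) le_rfl le_rfl le_rfl)
      (fun x hx => ⟨nz x ⟨by linarith [hx.1], hx.2⟩ c (by constructor <;> linarith) (Or.inr (by linarith)),
        nz x ⟨by linarith [hx.1], hx.2⟩ d (by constructor <;> linarith) (Or.inr (by linarith))⟩),
    bdry_split_y (a := z.1 - ρ) (b := z.1 + ρ) (m := z.2 - ρ) (by linarith) (by linarith) (by linarith)
      (sub (by linarith) (by linarith) le_rfl le_rfl)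
      (fun y hy => ⟨nz _ (by constructor <;> linarith) y hy (Or.inl (by linarith)),
        nz _ (by constructor <;> linarith) y hy (Or.inl (by linarith))⟩),
    bdry_split_y (a := z.1 - ρ) (b := z.1 + ρ) (c := z.2 - ρ) (m := z.2 + ρ) (by linarith) (by linarith) (by linarith)
      (sub (by linarith) (by linarith) (by linarith) le_rfl)
      (fun y hy => ⟨nz _ (by constructor <;> linarith) y ⟨by linarith [hy.1], hy.2⟩ (Or.inl (by linarith)),
        nz _ (by constructor <;> linarith) y ⟨by linarith [hy.1], hy.2⟩ (Or.inl (by linarith))⟩),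
    bdry_zero (a := a) (b := z.1 - ρ) (by linarith) (by linarith) (sub (by linarith) (by linarith) (by linarith) (by linarith))
      (fun x hx y hy => nz x ⟨by linarith [hx.1], by linarith [hx.2]⟩ y ⟨by linarith [hy.1], by linarith [hy.2]⟩ (Or.inl (by linarith [hx.2]))),
    bdry_zero (a := z.1 + ρ) (b := b) (by linarith) (by linarith) (sub (by linarith) (by linarith) (by linarith) (by linarith))
      (fun x hx y hy => nz x ⟨by linarith [hx.1], by linarith [hx.2]⟩ y ⟨by linarith [hy.1], by linarith [hy.2]⟩ (Or.inl (by linarith [hx.1]))),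
    bdry_zero (d := z.2 - ρ) (by linarith) (by linarith) (sub (by linarith) (by linarith) (by linarith) (by linarith))
      (fun x hx y hy => nz x ⟨by linarith [hx.1], by linarith [hx.2]⟩ y ⟨by linarith [hy.1], by linarith [hy.2]⟩ (Or.inr (by linarith [hy.2]))),
    bdry_zero (c := z.2 + ρ) (by linarith) (by linarith) (sub (by linarith) (by linarith) (by linarith) (by linarith))
      (fun x hx y hy => nz x ⟨by linarith [hx.1], by linarith [hx.2]⟩ y ⟨by linarith [hy.1], by linarith [hy.2]⟩ (Or.inr (by linarith [hy.1]))),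
    bdry_rouche (G := fun x y => (x - z.1) • u + (y - z.2) • w) (by linarith) (by linarith)
      (sub (by linarith) (by linarith) (by linarith) (by linarith)) (by fun_prop) ?_, bdry_lin u w hd _ _ _ hρ]
  · ring
  · intro x hx y hy hbd
    have hx' : |x - z.1| ≤ ρ := abs_le.mpr ⟨by linarith [hx.1], by linarith [hx.2]⟩
    have hy' : |y - z.2| ≤ ρ := abs_le.mpr ⟨by linarith [hy.1], by linarith [hy.2]⟩
    have hpos : 0 < |x - z.1| + |y - z.2| := by
      have := abs_nonneg (x - z.1)
      have := abs_nonneg (y - z.2)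
      rcases hbd with h | h | h | h
      · have := abs_pos.mpr (show x - z.1 ≠ 0 by rw [h]; linarith); linarith
      · have := abs_pos.mpr (show x - z.1 ≠ 0 by rw [h]; linarith); linarith
      · have := abs_pos.mpr (show y - z.2 ≠ 0 by rw [h]; linarith); linarith
      · have := abs_pos.mpr (show y - z.2 ≠ 0 by rw [h]; linarith); linarith
    have := hl x y (by linarith) (by linarith)
    have := hlow (x - z.1) (y - z.2)
    nlinarith

lemma DL {F : ℝ → ℝ → ℂ} {a b c d : ℝ} (hab : a ≤ b) (hcd : c ≤ d) (Z : Finset (ℝ × ℝ)) (u w : ℝ × ℝ → ℂ)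
    (hF : ContinuousOn (fun q : ℝ × ℝ => F q.1 q.2) (Icc a b ×ˢ Icc c d))
    (hZ : ∀ z ∈ Z, z.1 ∈ Ioo a b ∧ z.2 ∈ Ioo c d)
    (h0 : ∀ x ∈ Icc a b, ∀ y ∈ Icc c d, F x y = 0 → (x, y) ∈ Z)
    (hl : ∀ z ∈ Z, LinAt F z (u z) (w z) ∧ det2 (u z) (w z) ≠ 0) :
    bdry F a b c d = 2 * Real.pi * Complex.I * ((∑ z ∈ Z, (SignType.sign (det2 (u z) (w z)) : ℤ) : ℤ) : ℂ) := by
  classical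
  induction hn : Z.card using Nat.strong_induction_on generalizing Z a b c d with
  | _ n ih =>
  rcases Z.eq_empty_or_nonempty with rfl | hne
  · rw [bdry_zero hab hcd hF (fun x hx y hy h => by simpa using h0 x hx y hy h)]; simp
  obtain ⟨z, hz⟩ := hne
  by_cases hone : ∀ z' ∈ Z, z' = z
  · have hZe : Z = {z} := Finset.eq_singleton_iff_unique_mem.mpr ⟨hz, hone⟩
    rw [DL_one hF (hZ z hz).1 (hZ z hz).2 (fun x hx y hy h => hone _ (h0 x hx y hy h)) (hl z hz).1 (hl z hz).2, hZe,
      Finset.sum_singleton]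
    simp
  push Not at hone
  obtain ⟨z', hz', hzz⟩ := hone
  have hsum : ∀ (p : ℝ × ℝ → Prop) [DecidablePred p], ∑ z ∈ Z, (SignType.sign (det2 (u z) (w z)) : ℤ) =
      ∑ z ∈ Z with p z, (SignType.sign (det2 (u z) (w z)) : ℤ) + ∑ z ∈ Z with ¬ p z, (SignType.sign (det2 (u z) (w z)) : ℤ) :=
    fun p _ => (Finset.sum_filter_add_sum_filter_not Z p _).symm
  have hcard : ∀ (p : ℝ × ℝ → Prop) [DecidablePred p], (∃ y ∈ Z, ¬ p y) → (Z.filter p).card < n := by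
    intro p _ ⟨y, hy, hp⟩
    rw [← hn]
    exact Finset.card_lt_card (Finset.filter_ssubset.mpr ⟨y, hy, hp⟩)
  by_cases h1 : z.1 = z'.1
  · have h2 : z.2 ≠ z'.2 := fun h => hzz (Prod.ext h1.symm h.symm)
    obtain ⟨m, hm, hmZ⟩ : ∃ m, m ∈ Ioo (min z.2 z'.2) (max z.2 z'.2) ∧ m ∉ Z.image Prod.snd :=
      (Set.Ioo_infinite (min_lt_max.mpr h2)).exists_notMem_finset _
    have hmZ' : ∀ y ∈ Z, y.2 ≠ m := fun y hy h => hmZ (Finset.mem_image.mpr ⟨y, hy, h⟩)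
    have := hZ z hz
    have := hZ z' hz'
    simp only [mem_Ioo] at *
    have hcm : c < m := lt_of_le_of_lt (le_min (by linarith) (by linarith)) hm.1
    have hmd : m < d := lt_of_lt_of_le hm.2 (max_le (by linarith) (by linarith))
    rw [bdry_split_y hcm.le hmd.le hab hF, hsum (fun y => y.2 < m),
      ih _ (hcard (fun y => y.2 < m) ?_) hab hcm.le (Z.filter (fun y => y.2 < m))
        (hF.mono (prod_mono le_rfl (Icc_subset_Icc_right hmd.le))) ?_ ?_ ?_ rfl,
      ih _ (hcard (fun y => ¬ y.2 < m) ?_) hab hmd.le (Z.filter (fun y => ¬ y.2 < m))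
        (hF.mono (prod_mono le_rfl (Icc_subset_Icc_left hcm.le))) ?_ ?_ ?_ rfl]
    · push_cast; ring
    · rcases min_lt_iff.mp hm.1 with h | h
      · exact ⟨z, hz, not_not.mpr h⟩
      · exact ⟨z', hz', not_not.mpr h⟩
    · intro y hy; rw [Finset.mem_filter] at hy
      have := hZ y hy.1; have := lt_of_le_of_ne (not_lt.mp hy.2) (hmZ' y hy.1).symm; tauto
    · intro x hx y hy h
      have := h0 x hx y ⟨by linarith [hy.1], hy.2⟩ h
      rw [Finset.mem_filter]; exact ⟨this, not_lt.mpr hy.1⟩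
    · intro y hy; exact hl y (Finset.mem_filter.mp hy).1
    · rcases lt_max_iff.mp hm.2 with h | h
      · exact ⟨z, hz, not_lt.mpr h.le⟩
      · exact ⟨z', hz', not_lt.mpr h.le⟩
    · intro y hy; rw [Finset.mem_filter] at hy
      have := hZ y hy.1; tauto
    · intro x hx y hy h
      have := h0 x hx y ⟨hy.1, by linarith [hy.2]⟩ h
      rw [Finset.mem_filter]; exact ⟨this, lt_of_le_of_ne hy.2 (hmZ' _ this)⟩
    · intro y hy; exact hl y (Finset.mem_filter.mp hy).1
    · intro y hy
      constructor <;> intro h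
      · have := hZ _ (h0 a (left_mem_Icc.mpr hab) y hy h); linarith [this.1.1]
      · have := hZ _ (h0 b (right_mem_Icc.mpr hab) y hy h); linarith [this.1.2]
  · obtain ⟨m, hm, hmZ⟩ : ∃ m, m ∈ Ioo (min z.1 z'.1) (max z.1 z'.1) ∧ m ∉ Z.image Prod.fst :=
      (Set.Ioo_infinite (min_lt_max.mpr h1)).exists_notMem_finset _
    have hmZ' : ∀ y ∈ Z, y.1 ≠ m := fun y hy h => hmZ (Finset.mem_image.mpr ⟨y, hy, h⟩)
    have := hZ z hz
    have := hZ z' hz'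
    simp only [mem_Ioo] at *
    have hcm : a < m := lt_of_le_of_lt (le_min (by linarith) (by linarith)) hm.1
    have hmd : m < b := lt_of_lt_of_le hm.2 (max_le (by linarith) (by linarith))
    rw [bdry_split_x hcm.le hmd.le hcd hF, hsum (fun y => y.1 < m),
      ih _ (hcard (fun y => y.1 < m) ?_) hcm.le hcd (Z.filter (fun y => y.1 < m))
        (hF.mono (prod_mono (Icc_subset_Icc_right hmd.le) le_rfl)) ?_ ?_ ?_ rfl,
      ih _ (hcard (fun y => ¬ y.1 < m) ?_) hmd.le hcd (Z.filter (fun y => ¬ y.1 < m))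
        (hF.mono (prod_mono (Icc_subset_Icc_left hcm.le) le_rfl)) ?_ ?_ ?_ rfl]
    · push_cast; ring
    · rcases min_lt_iff.mp hm.1 with h | h
      · exact ⟨z, hz, not_not.mpr h⟩
      · exact ⟨z', hz', not_not.mpr h⟩
    · intro y hy; rw [Finset.mem_filter] at hy
      have := hZ y hy.1; have := lt_of_le_of_ne (not_lt.mp hy.2) (hmZ' y hy.1).symm; tauto
    · intro x hx y hy h
      have := h0 x ⟨by linarith [hx.1], hx.2⟩ y hy h
      rw [Finset.mem_filter]; exact ⟨this, not_lt.mpr hx.1⟩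
    · intro y hy; exact hl y (Finset.mem_filter.mp hy).1
    · rcases lt_max_iff.mp hm.2 with h | h
      · exact ⟨z, hz, not_lt.mpr h.le⟩
      · exact ⟨z', hz', not_lt.mpr h.le⟩
    · intro y hy; rw [Finset.mem_filter] at hy
      have := hZ y hy.1; tauto
    · intro x hx y hy h
      have := h0 x ⟨hx.1, by linarith [hx.2]⟩ y hy h
      rw [Finset.mem_filter]; exact ⟨this, lt_of_le_of_ne hx.2 (hmZ' _ this)⟩
    · intro y hy; exact hl y (Finset.mem_filter.mp hy).1
    · intro x hx
      constructor <;> intro h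
      · have := hZ _ (h0 x hx c (left_mem_Icc.mpr hcd) h); linarith [this.2.1]
      · have := hZ _ (h0 x hx d (right_mem_Icc.mpr hcd) h); linarith [this.2.2]


/-- Closed immersed plane curves (C^1). -/
structure Imm (f : ℝ → ℂ) : Prop where
  per : Function.Periodic f 1
  sm : ContDiff ℝ 1 f
  imm : ∀ t, deriv f t ≠ 0

def Ch (f : ℝ → ℂ) (x : ℝ) : Set (ℝ × ℝ) := {q | x < q.1 ∧ q.1 < q.2 ∧ q.2 < x + 1 ∧ f q.1 = f q.2}

/-- Working form of stability. -/
structure Stb (f : ℝ → ℂ) : Prop extends Imm f where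
  fin : ∀ x, (Ch f x).Finite
  tr : ∀ s t, s < t → t < s + 1 → f s = f t → det2 (deriv f s) (deriv f t) ≠ 0
  tri : ∀ s t u, s < t → t < u → u < s + 1 → f s = f t → f t = f u → False

lemma deriv_per {E : Type*} [NormedAddCommGroup E] [NormedSpace ℝ E] {f : ℝ → E}
    (h : Function.Periodic f 1) : Function.Periodic (deriv f) 1 := by
  intro t
  have := deriv_comp_add_const (f := f) (a := 1) (x := t)
  rw [← this]
  congr 1
  exact funext h

lemma Imm.diff {f : ℝ → ℂ} (h : Imm f) : Differentiable ℝ f := h.sm.differentiable (by norm_num)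

lemma Imm.cont {f : ℝ → ℂ} (h : Imm f) : Continuous f := h.diff.continuous

lemma Imm.dcont {f : ℝ → ℂ} (h : Imm f) : Continuous (deriv f) := h.sm.continuous_deriv (by norm_num)

lemma fiber_finite_gen {E : Type*} [NormedAddCommGroup E] [NormedSpace ℝ E] {f : ℝ → E}
    (hd : Differentiable ℝ f) (hi : ∀ t, deriv f t ≠ 0) (p : E) (a b : ℝ) :
    {t ∈ Icc a b | f t = p}.Finite := by
  by_contra hinf
  obtain ⟨x, -, hx⟩ := Set.Infinite.exists_accPt_of_subset_isCompact hinf isCompact_Icc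
    (fun t ht => ht.1)
  have h1 := (hd x).hasDerivAt.eventually_ne (c := p) (hi x)
  rw [accPt_iff_frequently_nhdsNE] at hx
  exact hx (h1.mono fun y hy hy' => hy hy'.2)

lemma ncard_shift {E : Type*} {f : ℝ → E} (h : Function.Periodic f 1) (p : E) (x : ℝ) :
    Set.ncard {t ∈ Ico (0:ℝ) 1 | f t = p} = Set.ncard {t ∈ Ico x (x + 1) | f t = p} := by
  have him : {t ∈ Ico (0:ℝ) 1 | f t = p} = Int.fract '' {t ∈ Ico x (x + 1) | f t = p} := by
    ext t
    constructor
    · rintro ⟨ht, hp⟩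
      refine ⟨toIcoMod one_pos x t, ⟨toIcoMod_mem_Ico one_pos x t, ?_⟩, ?_⟩
      · rw [toIcoMod, h.sub_zsmul_eq, hp]
      · rw [toIcoMod]
        have : (toIcoDiv one_pos x t) • (1:ℝ) = ((toIcoDiv one_pos x t : ℤ) : ℝ) := by simp
        rw [this, Int.fract_sub_intCast]
        exact Int.fract_eq_self.mpr ht
    · rintro ⟨y, ⟨hy, hp⟩, rfl⟩
      refine ⟨⟨Int.fract_nonneg _, Int.fract_lt_one _⟩, ?_⟩
      rw [Int.fract]
      have := h.sub_zsmul_eq ⌊y⌋ (x := y)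
      rw [zsmul_eq_mul, mul_one] at this
      rw [this, hp]
  rw [him, Set.InjOn.ncard_image]
  rintro s ⟨hs, -⟩ t ⟨ht, -⟩ hst
  obtain ⟨n, hn⟩ := Int.fract_eq_fract.mp hst
  have h1 : (n : ℝ) < 1 := by rw [← hn]; linarith [hs.2, ht.1]
  have h2 : (-1 : ℝ) < n := by rw [← hn]; linarith [hs.1, ht.2]
  have : n = 0 := by
    have h1 : n < 1 := by exact_mod_cast h1
    have h2 : -1 < n := by exact_mod_cast h2
    omega
  rw [this] at hn; simp at hn; linarith

lemma fract_ne {s t : ℝ} (h1 : s < t) (h2 : t < s + 1) : Int.fract s ≠ Int.fract t := by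
  intro h
  obtain ⟨n, hn⟩ := Int.fract_eq_fract.mp h
  have h1 : (n : ℝ) < 0 := by rw [← hn]; linarith
  have h2 : (-1 : ℝ) < n := by rw [← hn]; linarith
  have h1 : n < 0 := by exact_mod_cast h1
  have h2 : -1 < n := by exact_mod_cast h2
  omega

lemma per_fract {E : Type*} {f : ℝ → E} (h : Function.Periodic f 1) (t : ℝ) : f (Int.fract t) = f t := by
  have := h.sub_zsmul_eq ⌊t⌋ (x := t)
  rw [zsmul_eq_mul, mul_one] at this
  exact this


lemma mult_fin {E : Type*} [NormedAddCommGroup E] [NormedSpace ℝ E] {f : ℝ → E}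
    (hd : Differentiable ℝ f) (hi : ∀ t, deriv f t ≠ 0)
    (p : E) (x : ℝ) : {t ∈ Ico x (x + 1) | f t = p}.Finite :=
  (fiber_finite_gen hd hi p x (x + 1)).subset (fun _ ht => ⟨Ico_subset_Icc_self ht.1, ht.2⟩)

lemma two_le_mult {E : Type*} [NormedAddCommGroup E] [NormedSpace ℝ E] {f : ℝ → E}
    (hper : Function.Periodic f 1) (hd : Differentiable ℝ f) (hi : ∀ t, deriv f t ≠ 0)
    {s t : ℝ} (h1 : s < t) (h2 : t < s + 1) (h : f s = f t) :
    2 ≤ Set.ncard {r ∈ Ico (0:ℝ) 1 | f r = f s} := by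
  rw [ncard_shift hper _ s, ← Set.ncard_pair h1.ne]
  apply Set.ncard_le_ncard _ (mult_fin hd hi _ _)
  rintro r (rfl | rfl)
  · exact ⟨⟨le_rfl, by linarith⟩, rfl⟩
  · exact ⟨⟨h1.le, h2⟩, h.symm⟩

lemma three_le_mult {E : Type*} [NormedAddCommGroup E] [NormedSpace ℝ E] {f : ℝ → E}
    (hper : Function.Periodic f 1) (hd : Differentiable ℝ f) (hi : ∀ t, deriv f t ≠ 0)
    {s t u : ℝ} (h1 : s < t) (h2 : t < u) (h3 : u < s + 1) (h : f s = f t) (h' : f t = f u) :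
    3 ≤ Set.ncard {r ∈ Ico (0:ℝ) 1 | f r = f s} := by
  rw [ncard_shift hper _ s]
  have : ({s, t, u} : Set ℝ).ncard = 3 := by
    rw [Set.ncard_eq_three]; exact ⟨s, t, u, h1.ne, (h1.trans h2).ne, h2.ne, rfl⟩
  rw [← this]
  apply Set.ncard_le_ncard _ (mult_fin hd hi _ _)
  rintro r (rfl | rfl | rfl)
  · exact ⟨⟨le_rfl, by linarith⟩, rfl⟩
  · exact ⟨⟨h1.le, by linarith⟩, h.symm⟩
  · exact ⟨⟨by linarith, h3⟩, (h.trans h').symm⟩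

lemma ch_fin {E : Type*} [NormedAddCommGroup E] [NormedSpace ℝ E] {f : ℝ → E}
    (hper : Function.Periodic f 1) (hd : Differentiable ℝ f) (hi : ∀ t, deriv f t ≠ 0)
    (hc : {p : E | 2 ≤ Set.ncard {r ∈ Ico (0:ℝ) 1 | f r = p}}.Finite) (x : ℝ) :
    {q : ℝ × ℝ | x < q.1 ∧ q.1 < q.2 ∧ q.2 < x + 1 ∧ f q.1 = f q.2}.Finite := by
  apply Set.Finite.subset (hc.biUnion (t := fun p => {t ∈ Ico x (x + 1) | f t = p} ×ˢ {t ∈ Ico x (x + 1) | f t = p})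
    (fun p _ => (mult_fin hd hi p x).prod (mult_fin hd hi p x)))
  rintro ⟨s, t⟩ ⟨h1, h2, h3, h4⟩
  simp only at h1 h2 h3 h4
  simp only [mem_iUnion]
  exact ⟨f s, two_le_mult hper hd hi h2 (by linarith) h4, ⟨⟨h1.le, by linarith⟩, rfl⟩,
    ⟨⟨by linarith, h3⟩, h4.symm⟩⟩

lemma tr_of_transverse {f : ℝ → ℂ} (hf : Imm f) {s t : ℝ} (h1 : s < t) (h2 : t < s + 1) (h : f s = f t)
    (hT : PlanarCurve.TransverseF f (f s)) : det2 (deriv f s) (deriv f t) ≠ 0 := by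
  have := hT (Int.fract s) ⟨Int.fract_nonneg _, Int.fract_lt_one _⟩ (Int.fract t)
    ⟨Int.fract_nonneg _, Int.fract_lt_one _⟩ (fract_ne h1 h2) (per_fract hf.per s) ((per_fract hf.per t).trans h.symm)
  rwa [per_fract (deriv_per hf.per), per_fract (deriv_per hf.per)] at this

lemma Stb.of_stableF {f : ℝ → ℂ} (hf : Imm f) (h : PlanarCurve.StableF f) : Stb f where
  toImm := hf
  fin := ch_fin hf.per hf.diff hf.imm h.1
  tr := fun s t h1 h2 h3 => by
    have h4 := two_le_mult hf.per hf.diff hf.imm h1 h2 h3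
    exact tr_of_transverse hf h1 h2 h3 ((h.2 _).2 (le_antisymm (h.2 _).1 h4))
  tri := fun s t u h1 h2 h3 h4 h5 => by
    have h6 := three_le_mult hf.per hf.diff hf.imm h1 h2 h3 h4 h5
    have h7 := (h.2 (f s)).1
    unfold PlanarCurve.multF at h7; omega

def eps (f : ℝ → ℂ) (q : ℝ × ℝ) : ℤ := SignType.sign (det2 (deriv f q.1) (deriv f q.2))

def Dsum (e : ℝ × ℝ → ℤ) (S T : Finset (ℝ × ℝ)) : ℤ :=
  ∑ q ∈ S, ∑ r ∈ T, if q.2 < r.1 then e q * e r else 0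

def JF (e : ℝ × ℝ → ℤ) (S : Finset (ℝ × ℝ)) : ℤ := (∑ q ∈ S, e q) ^ 2 - 4 * Dsum e S S

open Classical in
def toFs (S : Set (ℝ × ℝ)) : Finset (ℝ × ℝ) := if h : S.Finite then h.toFinset else ∅

lemma mem_toFs {S : Set (ℝ × ℝ)} (h : S.Finite) (q : ℝ × ℝ) : q ∈ toFs S ↔ q ∈ S := by
  simp [toFs, h]

def Jv (f : ℝ → ℂ) (x : ℝ) : ℤ := JF (eps f) (toFs (Ch f x))

def BaseOK (f : ℝ → ℂ) (x : ℝ) : Prop := ∀ t, x < t → t < x + 1 → f t ≠ f x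

lemma linAt_diff {f : ℝ → ℂ} {z : ℝ × ℝ} (h1 : DifferentiableAt ℝ f z.1) (h2 : DifferentiableAt ℝ f z.2)
    (h : f z.1 = f z.2) : LinAt (fun s t => f t - f s) z (-deriv f z.1) (deriv f z.2) := by
  intro ε hε
  have key : ∀ y : ℝ, DifferentiableAt ℝ f y → ∃ r > 0, ∀ x, |x - y| ≤ r →
      ‖f x - f y - (x - y) • deriv f y‖ ≤ ε * |x - y| := by
    intro y hy
    have := (hasDerivAt_iff_isLittleO.mp hy.hasDerivAt).def hε
    obtain ⟨r, hr, hr'⟩ := Metric.eventually_nhds_iff.mp this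
    refine ⟨r / 2, by positivity, fun x hx => ?_⟩
    have := hr' (y := x) (by rw [Real.dist_eq]; linarith)
    simpa using this
  obtain ⟨r1, hr1, k1⟩ := key _ h1
  obtain ⟨r2, hr2, k2⟩ := key _ h2
  refine ⟨min r1 r2, lt_min hr1 hr2, fun x y hx hy => ?_⟩
  have a1 := k1 x (hx.trans (min_le_left _ _))
  have a2 := k2 y (hy.trans (min_le_right _ _))
  have : f y - f x - ((x - z.1) • -deriv f z.1 + (y - z.2) • deriv f z.2) =
      (f y - f z.2 - (y - z.2) • deriv f z.2) - (f x - f z.1 - (x - z.1) • deriv f z.1) := by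
    rw [h]; simp only [smul_neg]; ring
  rw [this]
  refine (norm_sub_le _ _).trans ?_
  linarith

lemma det2_neg_left (u v : ℂ) : det2 (-u) v = -det2 u v := by simp [det2]; ring
lemma det2_swap (u v : ℂ) : det2 u v = -det2 v u := by simp [det2]; ring


lemma lin1 {f : ℝ → ℂ} {y : ℝ} (hy : DifferentiableAt ℝ f y) {ε : ℝ} (hε : 0 < ε) :
    ∃ r > 0, ∀ x, |x - y| ≤ r → ‖f x - f y - (x - y) • deriv f y‖ ≤ ε * |x - y| := by
  have := (hasDerivAt_iff_isLittleO.mp hy.hasDerivAt).def hε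
  obtain ⟨r, hr, hr'⟩ := Metric.eventually_nhds_iff.mp this
  refine ⟨r / 2, by positivity, fun x hx => ?_⟩
  have := hr' (y := x) (by rw [Real.dist_eq]; linarith)
  simpa using this

lemma seg_avoid {f : ℝ → ℂ} (hf : Stb f) {x0 t1 : ℝ} (h1 : x0 < t1) (h2 : t1 < x0 + 1) (h : f x0 = f t1) :
    ∃ η0 > 0, ∀ η, 0 < η → η < η0 → ∀ l ∈ Icc (0:ℝ) 1, ∀ t ∈ Icc t1 (x0 + 1),
      f t - ((1 - l) • f (x0 + η) + l • f (t1 - η)) ≠ 0 := by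
  obtain ⟨c, hc, hlow⟩ := lin_lower (hf.tr _ _ h1 h2 h)
  obtain ⟨r1, hr1, k1⟩ := lin1 (hf.diff x0) (ε := c / 2) (by positivity)
  obtain ⟨r2, hr2, k2⟩ := lin1 (hf.diff t1) (ε := c / 2) (by positivity)
  set u := deriv f x0
  set w := deriv f t1
  set r := min r1 r2
  have hr : 0 < r := lt_min hr1 hr2
  obtain ⟨m, hm, hmm⟩ : ∃ m > 0, ∀ t ∈ Icc (t1 + r) (x0 + 1 - r), m ≤ ‖f t - f x0‖ := by
    rcases (Icc (t1 + r) (x0 + 1 - r)).eq_empty_or_nonempty with he | hne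
    · exact ⟨1, one_pos, by rw [he]; simp⟩
    · obtain ⟨y, hy, hmin⟩ := isCompact_Icc.exists_isMinOn hne
        (f := fun t => ‖f t - f x0‖) (by have := hf.cont; fun_prop)
      refine ⟨‖f y - f x0‖, ?_, fun t ht => hmin ht⟩
      rw [gt_iff_lt, norm_pos_iff, sub_ne_zero]
      intro h'
      exact hf.tri x0 t1 y h1 (by linarith [hy.1]) (by linarith [hy.2]) h (h.symm.trans h'.symm)
  refine ⟨min r (m / (‖u‖ + ‖w‖ + c + 1)), by positivity, ?_⟩
  intro η hη hη' l hl t ht h0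
  have hηr : η < r := hη'.trans_le (min_le_left _ _)
  have hηm : η < m / (‖u‖ + ‖w‖ + c + 1) := hη'.trans_le (min_le_right _ _)
  rw [lt_div_iff₀ (by positivity)] at hηm
  have e1 := k1 (x0 + η) (by rw [add_sub_cancel_left, abs_of_pos hη]; exact hηr.le.trans (min_le_left _ _))
  have e2 := k2 (t1 - η) (by rw [sub_sub_cancel_left, abs_neg, abs_of_pos hη]; exact hηr.le.trans (min_le_right _ _))
  rw [add_sub_cancel_left, abs_of_pos hη] at e1
  rw [sub_sub_cancel_left, abs_neg, abs_of_pos hη, ← h] at e2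
  have hg : ‖((1 - l) • f (x0 + η) + l • f (t1 - η)) - f x0 - (((1 - l) * η) • u - (l * η) • w)‖ ≤ c / 2 * η := by
    have : ((1 - l) • f (x0 + η) + l • f (t1 - η)) - f x0 - (((1 - l) * η) • u - (l * η) • w) =
      (1 - l) • (f (x0 + η) - f x0 - η • u) + l • (f (t1 - η) - f x0 - (-η) • w) := by
      simp only [Complex.real_smul]; push_cast; ring
    rw [this]
    refine (norm_add_le _ _).trans ?_
    rw [norm_smul, norm_smul, Real.norm_of_nonneg (by linarith [hl.2] : 0 ≤ 1 - l), Real.norm_of_nonneg hl.1]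
    nlinarith [hl.1, hl.2]
  rw [sub_eq_zero] at h0
  rw [← h0] at hg
  have hl0 := hl.1
  have hl1 := hl.2
  by_cases c1 : t ≤ t1 + r
  · have e3 := k2 t (by rw [abs_of_nonneg (by linarith [ht.1])]; have := min_le_right r1 r2; linarith)
    rw [abs_of_nonneg (by linarith [ht.1]), ← h] at e3
    have e4 := hlow (-((1 - l) * η)) (t - t1 + l * η)
    rw [abs_neg, abs_of_nonneg (by nlinarith), abs_of_nonneg (by nlinarith [ht.1])] at e4
    have : (-((1 - l) * η)) • u + (t - t1 + l * η) • w =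
      (f t - f x0 - (((1 - l) * η) • u - (l * η) • w)) - (f t - f x0 - (t - t1) • w) := by
      simp only [Complex.real_smul]; push_cast; ring
    rw [this] at e4
    have := norm_sub_le (f t - f x0 - (((1 - l) * η) • u - (l * η) • w)) (f t - f x0 - (t - t1) • w)
    nlinarith [ht.1]
  by_cases c2 : x0 + 1 - r ≤ t
  · have e3 := k1 (t - 1) (by rw [abs_of_nonpos (by linarith [ht.2])]; have := min_le_left r1 r2; linarith)
    rw [abs_of_nonpos (by linarith [ht.2]), hf.per.sub_eq] at e3
    have e4 := hlow (t - 1 - x0 - (1 - l) * η) (l * η)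
    rw [abs_of_nonneg (a := l * η) (by nlinarith), abs_of_nonpos (by nlinarith [ht.2])] at e4
    have : (t - 1 - x0 - (1 - l) * η) • u + (l * η) • w =
      (f t - f x0 - (((1 - l) * η) • u - (l * η) • w)) - (f t - f x0 - (t - 1 - x0) • u) := by
      simp only [Complex.real_smul]; push_cast; ring
    rw [this] at e4
    have := norm_sub_le (f t - f x0 - (((1 - l) * η) • u - (l * η) • w)) (f t - f x0 - (t - 1 - x0) • u)
    nlinarith [ht.2]
  · have e3 := hmm t ⟨by linarith, by linarith⟩
    have e4 : f t - f x0 = (f t - f x0 - (((1 - l) * η) • u - (l * η) • w)) + (((1 - l) * η) • u - (l * η) • w) := by ring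
    have e5 : ‖((1 - l) * η) • u - (l * η) • w‖ ≤ η * (‖u‖ + ‖w‖) := by
      refine (norm_sub_le _ _).trans ?_
      rw [norm_smul, norm_smul, Real.norm_of_nonneg (by nlinarith), Real.norm_of_nonneg (by nlinarith)]
      have := mul_nonneg hη.le (norm_nonneg u)
      have := mul_nonneg hη.le (norm_nonneg w)
      nlinarith
    have e6 := norm_add_le (f t - f x0 - (((1 - l) * η) • u - (l * η) • w)) (((1 - l) * η) • u - (l * η) • w)
    rw [← e4] at e6
    nlinarith

lemma INT {f : ℝ → ℂ} (hf : Stb f) {x0 t1 : ℝ} (h1 : x0 < t1) (h2 : t1 < x0 + 1) (h : f x0 = f t1)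
    (Z : Finset (ℝ × ℝ))
    (hZ : ∀ q, q ∈ Z ↔ x0 < q.1 ∧ q.1 < t1 ∧ t1 < q.2 ∧ q.2 < x0 + 1 ∧ f q.1 = f q.2) :
    ∑ q ∈ Z, eps f q = 0 := by
  obtain ⟨η0, hη0, hav⟩ := seg_avoid hf h1 h2 h
  have hev : ∀ᶠ η in nhdsWithin (0:ℝ) (Ioi 0), η < η0 ∧ η < (t1 - x0) / 2 ∧ ∀ q ∈ Z, x0 + η < q.1 ∧ q.1 < t1 - η := by
    have hlt : ∀ y : ℝ, 0 < y → ∀ᶠ η in nhdsWithin (0:ℝ) (Ioi 0), η < y := fun y hy =>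
      nhdsWithin_le_nhds (gt_mem_nhds hy)
    refine (hlt _ hη0).and ((hlt _ (by linarith)).and ((Finset.eventually_all Z).mpr fun q hq => ?_))
    have := (hZ q).mp hq
    filter_upwards [hlt (q.1 - x0) (by linarith), hlt (t1 - q.1) (by linarith)] with η a b
    constructor <;> linarith
  obtain ⟨η, ⟨g1, g2, g3⟩, g0 : 0 < η⟩ := (hev.and self_mem_nhdsWithin).exists
  have hfc := hf.cont
  have hP : f (x0 + 1) = f t1 := by rw [hf.per, h]
  have hnz : ∀ s ∈ Icc (x0 + η) (t1 - η), f t1 - f s ≠ 0 := by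
    intro s hs h'
    exact hf.tri x0 s t1 (by linarith [hs.1]) (by linarith [hs.2]) h2 (by rw [h]; exact sub_eq_zero.mp h') (sub_eq_zero.mp h').symm
  have hdl := DL (F := fun s t => f t - f s) (a := x0 + η) (b := t1 - η) (c := t1) (d := x0 + 1)
    (by linarith) h2.le Z (fun q => -deriv f q.1) (fun q => deriv f q.2) (by fun_prop)
    (fun q hq => ⟨g3 q hq, ((hZ q).mp hq).2.2.1, ((hZ q).mp hq).2.2.2.1⟩) ?_ ?_
  · have hb : bdry (fun s t => f t - f s) (x0 + η) (t1 - η) t1 (x0 + 1) = 0 := by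
      have h0 := bdry_zero (F := fun l t => f t - ((1 - l) • f (x0 + η) + l • f (t1 - η))) (a := 0) (b := 1)
        (c := t1) (d := x0 + 1) zero_le_one h2.le (by fun_prop) (fun l hl t ht => hav η g0 g1 l hl t ht)
      unfold bdry at h0 ⊢
      simp only [hP, sub_self, zero_smul, one_smul, zero_add, sub_zero, add_zero] at h0 ⊢
      linear_combination h0
    rw [hb] at hdl
    have h3 := (mul_eq_zero.mp hdl.symm).resolve_left Complex.two_pi_I_ne_zero
    have h4 : ∑ z ∈ Z, (SignType.sign (det2 (-deriv f z.1) (deriv f z.2)) : ℤ) = 0 := by exact_mod_cast h3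
    rw [← neg_eq_zero, ← Finset.sum_neg_distrib, ← h4]
    apply Finset.sum_congr rfl
    intro q _
    rw [det2_neg_left, Left.sign_neg, eps]; simp
  · intro s hs t ht h0
    have h0' := sub_eq_zero.mp h0
    rw [hZ]
    refine ⟨by linarith [hs.1], by linarith [hs.2], lt_of_le_of_ne ht.1 ?_, lt_of_le_of_ne ht.2 ?_, h0'.symm⟩
    · rintro rfl; exact hnz s hs h0
    · rintro rfl; simp only [hP] at h0; exact hnz s hs h0
  · intro q hq
    have := (hZ q).mp hq
    refine ⟨linAt_diff (hf.diff _) (hf.diff _) this.2.2.2.2, ?_⟩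
    rw [det2_neg_left]
    exact neg_ne_zero.mpr (hf.tr _ _ (by linarith) (by linarith) this.2.2.2.2)

/-! base change -/

lemma notOK_per {f : ℝ → ℂ} (hf : Imm f) {t : ℝ} (h : ¬ BaseOK f t) (n : ℤ) : ¬ BaseOK f (t + n) := by
  intro h'
  apply h
  intro s hs1 hs2 hs3
  have hn : ∀ y, f (y + n) = f y := by
    intro y
    have := hf.per.zsmul n y
    simpa using this
  exact h' (s + n) (by linarith) (by linarith) (by rw [hn, hn, hs3])

lemma notOK_fst {f : ℝ → ℂ} {q : ℝ × ℝ} {x : ℝ} (h : q ∈ Ch f x) : ¬ BaseOK f q.1 := by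
  intro h'
  exact h' q.2 h.2.1 (by linarith [h.1, h.2.2.1]) h.2.2.2.symm

lemma notOK_snd {f : ℝ → ℂ} (hf : Imm f) {q : ℝ × ℝ} {x : ℝ} (h : q ∈ Ch f x) : ¬ BaseOK f q.2 := by
  intro h'
  refine h' (q.1 + 1) (by linarith [h.1, h.2.2.1]) (by linarith [h.2.1]) ?_
  rw [hf.per, h.2.2.2]

lemma baseA {f : ℝ → ℂ} (hf : Imm f) {x y : ℝ} (hxy : x ≤ y) (h : ∀ t ∈ Icc x y, BaseOK f t) :
    Ch f x = Ch f y := by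
  ext q
  constructor
  · intro hq
    refine ⟨?_, hq.2.1, by linarith [hq.2.2.1], hq.2.2.2⟩
    by_contra hc
    exact notOK_fst hq (h _ ⟨hq.1.le, not_lt.mp hc⟩)
  · intro hq
    refine ⟨by linarith [hq.1], hq.2.1, ?_, hq.2.2.2⟩
    by_contra hc
    have := notOK_per hf (notOK_snd hf hq) (-1)
    push_cast at this
    exact this (h _ ⟨by linarith, by linarith [hq.2.2.1]⟩)

lemma JF_insert {e : ℝ × ℝ → ℤ} {C : Finset (ℝ × ℝ)} {q : ℝ × ℝ} (hq : q ∉ C) (hqq : ¬ q.2 < q.1) :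
    JF e (insert q C) = (e q + ∑ r ∈ C, e r) ^ 2 - 4 * (Dsum e C C + e q * (∑ r ∈ C, if q.2 < r.1 then e r else 0)
      + e q * ∑ r ∈ C, if r.2 < q.1 then e r else 0) := by
  unfold JF Dsum
  rw [Finset.sum_insert hq, Finset.sum_insert hq, Finset.sum_insert hq, if_neg hqq, Finset.mul_sum, Finset.mul_sum]
  have : ∑ r ∈ C, (∑ r' ∈ insert q C, if r.2 < r'.1 then e r * e r' else 0) =
      ∑ r ∈ C, (e q * if r.2 < q.1 then e r else 0) + ∑ r ∈ C, ∑ r' ∈ C, if r.2 < r'.1 then e r * e r' else 0 := by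
    rw [← Finset.sum_add_distrib]
    apply Finset.sum_congr rfl
    intro r _
    rw [Finset.sum_insert hq]
    split_ifs <;> ring
  rw [this]
  have : ∑ r ∈ C, (if q.2 < r.1 then e q * e r else 0) = ∑ r ∈ C, (e q * if q.2 < r.1 then e r else 0) := by
    apply Finset.sum_congr rfl
    intro r _
    split_ifs <;> ring
  rw [this]; ring

lemma baseB {f : ℝ → ℂ} (hf : Stb f) {x y x0 : ℝ} (hx : x < x0) (hy : x0 < y) (h0 : ¬ BaseOK f x0)
    (h : ∀ t ∈ Icc x y, t ≠ x0 → BaseOK f t) : Jv f x = Jv f y := by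
  classical
  have h0' := h0
  unfold BaseOK at h0'
  push Not at h0'
  obtain ⟨t1, h1, h2, h3⟩ := h0'
  have hy1 : y < x0 + 1 := by
    by_contra hc
    have := notOK_per hf.toImm h0 1
    push_cast at this
    exact this (h _ ⟨by linarith, by linarith⟩ (by linarith))
  have ht1 : ¬ BaseOK f t1 := by
    intro h'
    exact h' (x0 + 1) h2 (by linarith) (by rw [hf.per, h3])
  have ht1x : t1 < x + 1 := by
    by_contra hc
    have := notOK_per hf.toImm ht1 (-1)
    push_cast at this
    exact this (h _ ⟨by linarith, by linarith⟩ (by linarith))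
  have hyt : y < t1 := by
    by_contra hc
    exact ht1 (h _ ⟨by linarith, by linarith⟩ (by linarith))
  have hC := mem_toFs (hf.fin x0)
  set C := toFs (Ch f x0) with hCdef
  have hne1 : ∀ q ∈ Ch f x0, q.1 ≠ t1 ∧ q.2 ≠ t1 := by
    intro q hq
    constructor
    · intro hh
      exact hf.tri x0 q.1 q.2 hq.1 hq.2.1 hq.2.2.1 (by rw [hh, h3]) hq.2.2.2
    · intro hh
      exact hf.tri x0 q.1 q.2 hq.1 hq.2.1 hq.2.2.1 (by rw [hq.2.2.2, hh, h3]) hq.2.2.2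
  have hX : toFs (Ch f x) = insert (x0, t1) C := by
    ext q
    rw [mem_toFs (hf.fin x), Finset.mem_insert, hC]
    constructor
    · intro hq
      by_cases hq1 : q.1 = x0
      · left
        refine Prod.ext hq1 ?_
        by_contra hne
        rcases lt_or_gt_of_ne hne with hl | hl
        · exact hf.tri x0 q.2 t1 (by linarith [hq.2.1]) hl h2 (by rw [← hq.2.2.2, hq1]) (by rw [← hq.2.2.2, hq1, h3])
        · exact hf.tri x0 t1 q.2 h1 hl (by linarith [hq.2.2.1]) h3.symm (by rw [← hq.2.2.2, hq1, h3])
      · right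
        refine ⟨?_, hq.2.1, by linarith [hq.2.2.1], hq.2.2.2⟩
        by_contra hc
        exact notOK_fst hq (h _ ⟨hq.1.le, by linarith⟩ hq1)
    · rintro (rfl | hq)
      · exact ⟨hx, h1, ht1x, h3.symm⟩
      · refine ⟨by linarith [hq.1], hq.2.1, ?_, hq.2.2.2⟩
        by_contra hc
        have := notOK_per hf.toImm (notOK_snd hf.toImm hq) (-1)
        push_cast at this
        exact this (h _ ⟨by linarith, by linarith [hq.2.2.1]⟩ (by linarith [hq.2.2.1]))
  have hY : toFs (Ch f y) = insert (t1, x0 + 1) C := by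
    ext q
    rw [mem_toFs (hf.fin y), Finset.mem_insert, hC]
    constructor
    · intro hq
      by_cases hq1 : q.2 = x0 + 1
      · left
        have e : f q.1 = f x0 := by rw [hq.2.2.2, hq1, hf.per]
        refine Prod.ext ?_ hq1
        by_contra hne
        rcases lt_or_gt_of_ne hne with hl | hl
        · exact hf.tri x0 q.1 t1 (by linarith [hq.1]) hl h2 e.symm (by rw [e, h3])
        · exact hf.tri x0 t1 q.1 h1 hl (by linarith [hq.2.1]) h3.symm (by rw [e, h3])
      · right
        refine ⟨by linarith [hq.1], hq.2.1, ?_, hq.2.2.2⟩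
        by_contra hc
        have := notOK_per hf.toImm (notOK_snd hf.toImm hq) (-1)
        push_cast at this
        exact this (h _ ⟨by linarith, by linarith [hq.2.2.1]⟩ (fun hh => hq1 (by linarith)))
    · rintro (rfl | hq)
      · exact ⟨hyt, h2, by simp only; linarith, by simp only; rw [hf.per, h3]⟩
      · refine ⟨?_, hq.2.1, by linarith [hq.2.2.1], hq.2.2.2⟩
        by_contra hc
        exact notOK_fst hq (h _ ⟨by linarith [hq.1], by linarith⟩ (by linarith [hq.1]))
  have hn1 : (x0, t1) ∉ C := by rw [hC]; intro hh; exact lt_irrefl _ hh.1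
  have hn2 : (t1, x0 + 1) ∉ C := by rw [hC]; intro hh; exact lt_irrefl _ hh.2.2.1
  unfold Jv
  rw [hX, hY, JF_insert hn1 (by simp only; linarith), JF_insert hn2 (by simp only; linarith)]
  have he : eps f (t1, x0 + 1) = - eps f (x0, t1) := by
    unfold eps
    simp only
    rw [deriv_per hf.per, det2_swap, Left.sign_neg]; simp
  have s1 : ∑ r ∈ C, (if r.2 < (x0, t1).1 then eps f r else 0) = 0 := by
    apply Finset.sum_eq_zero
    intro r hr
    rw [hC] at hr
    exact if_neg (by simp only; linarith [hr.1, hr.2.1])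
  have s2 : ∑ r ∈ C, (if (t1, x0 + 1).2 < r.1 then eps f r else 0) = 0 := by
    apply Finset.sum_eq_zero
    intro r hr
    rw [hC] at hr
    exact if_neg (by simp only; linarith [hr.2.2.1, hr.2.1])
  have hint := INT hf h1 h2 h3.symm (C.filter (fun q => q.1 < t1 ∧ t1 < q.2)) (by
    intro q; rw [Finset.mem_filter, hC]
    constructor
    · rintro ⟨⟨a, b, c, d⟩, e, g⟩; exact ⟨a, e, g, c, d⟩
    · rintro ⟨a, e, g, c, d⟩; exact ⟨⟨a, by linarith, c, d⟩, e, g⟩)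
  rw [Finset.sum_filter] at hint
  have htot : ∑ r ∈ C, eps f r = ∑ r ∈ C, (if (x0, t1).2 < r.1 then eps f r else 0) +
      ∑ r ∈ C, (if r.2 < (t1, x0 + 1).1 then eps f r else 0) +
      ∑ r ∈ C, (if r.1 < t1 ∧ t1 < r.2 then eps f r else 0) := by
    rw [← Finset.sum_add_distrib, ← Finset.sum_add_distrib]
    apply Finset.sum_congr rfl
    intro r hr
    rw [hC] at hr
    obtain ⟨n1, n2⟩ := hne1 r hr
    have := hr.2.1
    simp only
    rcases lt_or_gt_of_ne n1 with a | a <;> rcases lt_or_gt_of_ne n2 with b | b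
    · rw [if_neg (by linarith), if_pos b, if_neg (by rintro ⟨_, _⟩; linarith)]; ring
    · rw [if_neg (by linarith), if_neg (by linarith), if_pos ⟨a, b⟩]; ring
    · linarith
    · rw [if_pos (by linarith), if_neg (by linarith), if_neg (by rintro ⟨_, _⟩; linarith)]; ring
  rw [hint] at htot
  rw [s1, s2, he, htot]
  ring

lemma notOK_fin {f : ℝ → ℂ} (hf : Imm f) (hff : (Ch f 0).Finite) (x y : ℝ) : {t ∈ Icc x y | ¬ BaseOK f t}.Finite := by
  have hfin : (Set.image2 (fun (a : ℝ) (n : ℤ) => a + n)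
      ({t ∈ Icc (0:ℝ) 1 | f t = f 0} ∪ Prod.fst '' Ch f 0 ∪ Prod.snd '' Ch f 0) (Icc ⌊x⌋ ⌊y⌋)).Finite :=
    Set.Finite.image2 _ (((fiber_finite_gen hf.diff hf.imm _ _ _).union (hff.image _)).union
      (hff.image _)) (Set.finite_Icc _ _)
  apply hfin.subset
  rintro t ⟨ht, hb⟩
  unfold BaseOK at hb
  push Not at hb
  obtain ⟨t', h1, h2, h3⟩ := hb
  have hn : ∀ y, f (y - ⌊t⌋) = f y := by
    intro y
    have := hf.per.sub_zsmul_eq ⌊t⌋ (x := y)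
    simpa using this
  refine ⟨t - ⌊t⌋, ?_, ⌊t⌋, ⟨Int.floor_le_floor ht.1, Int.floor_le_floor ht.2⟩, by simp⟩
  have ha := Int.floor_le t
  have ha' := Int.lt_floor_add_one t
  rcases eq_or_lt_of_le ha with h0 | h0
  · left; left
    refine ⟨⟨by linarith, by linarith⟩, by rw [← h0]; simp⟩
  rcases lt_trichotomy (t' - ⌊t⌋) 1 with h4 | h4 | h4
  · left; right
    exact ⟨(t - ⌊t⌋, t' - ⌊t⌋), ⟨by simp only; linarith, by simp only; linarith, by simp only; linarith, by
      simp only [hn, h3]⟩, rfl⟩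
  · left; left
    refine ⟨⟨by linarith, by linarith⟩, ?_⟩
    rw [hn, ← h3, ← hn t', h4]
    have := hf.per 0
    simpa using this
  · right
    refine ⟨(t' - ⌊t⌋ - 1, t - ⌊t⌋), ⟨by simp only; linarith, by simp only; linarith, by simp only; linarith, ?_⟩, rfl⟩
    simp only
    rw [hf.per.sub_eq, hn, hn, h3]

lemma Jv_indep_lt {f : ℝ → ℂ} (hf : Stb f) {y : ℝ} (hy : BaseOK f y) : ∀ (k : ℕ) (x : ℝ), x < y → BaseOK f x →
    {t ∈ Icc x y | ¬ BaseOK f t}.ncard = k → Jv f x = Jv f y := by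
  intro k
  induction k using Nat.strong_induction_on with
  | _ k ih =>
  intro x hxy hx hk
  have hfin := notOK_fin hf.toImm (hf.fin 0) x y
  rcases {t ∈ Icc x y | ¬ BaseOK f t}.eq_empty_or_nonempty with he | hne
  · have : Ch f x = Ch f y := by
      apply baseA hf.toImm hxy.le
      intro t ht
      by_contra hc
      have : t ∈ {t ∈ Icc x y | ¬ BaseOK f t} := ⟨ht, hc⟩
      rw [he] at this; exact this
    unfold Jv; rw [this]
  · obtain ⟨x0, hx0, hmin⟩ := Set.exists_min_image _ id hfin hne
    simp only [id] at hmin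
    have hxx0 : x < x0 := lt_of_le_of_ne hx0.1.1 (fun h => hx0.2 (h ▸ hx))
    have hx0y : x0 < y := lt_of_le_of_ne hx0.1.2 (fun h => hx0.2 (h ▸ hy))
    have hev : ∀ᶠ z in nhdsWithin x0 (Ioi x0), z < y ∧ ∀ t ∈ hfin.toFinset, t ≠ x0 → z < t := by
      have e1 : ∀ᶠ z in nhdsWithin x0 (Ioi x0), z < y := nhdsWithin_le_nhds (gt_mem_nhds hx0y)
      refine e1.and ((Finset.eventually_all _).mpr ?_)
      intro t ht
      rw [Set.Finite.mem_toFinset] at ht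
      by_cases h : t = x0
      · exact Filter.Eventually.of_forall fun z hz => absurd h hz
      · have : x0 < t := lt_of_le_of_ne (hmin t ht) (Ne.symm h)
        have e1 : ∀ᶠ z in nhdsWithin x0 (Ioi x0), z < t := nhdsWithin_le_nhds (gt_mem_nhds this)
        exact e1.mono fun z hz _ => hz
    obtain ⟨z, ⟨hzy, hz⟩, hz0 : x0 < z⟩ := (hev.and self_mem_nhdsWithin).exists
    have hOK : ∀ t ∈ Icc x z, t ≠ x0 → BaseOK f t := by
      intro t ht hne
      by_contra hc
      have := hz t (by rw [Set.Finite.mem_toFinset]; exact ⟨⟨ht.1, ht.2.trans hzy.le⟩, hc⟩) hne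
      linarith [ht.2]
    rw [baseB hf hxx0 hz0 hx0.2 hOK]
    refine ih _ ?_ z hzy (hOK z ⟨by linarith, le_rfl⟩ hz0.ne') rfl
    rw [← hk]
    apply Set.ncard_lt_ncard _ hfin
    refine ⟨fun t ht => ⟨⟨by linarith [ht.1.1], ht.1.2⟩, ht.2⟩, fun hh => ?_⟩
    have := (hh hx0).1.1
    linarith

lemma Jv_indep {f : ℝ → ℂ} (hf : Stb f) {x y : ℝ} (hx : BaseOK f x) (hy : BaseOK f y) : Jv f x = Jv f y := by
  rcases lt_trichotomy x y with h | h | h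
  · exact Jv_indep_lt hf hy _ x h hx rfl
  · rw [h]
  · exact (Jv_indep_lt hf hx _ y h hy rfl).symm

lemma exists_baseOK {f : ℝ → ℂ} (hf : Imm f) (hff : (Ch f 0).Finite) : ∃ x, BaseOK f x := by
  have h := notOK_fin hf hff 0 1
  obtain ⟨x, hx, hx'⟩ := ((Set.Icc_infinite (zero_lt_one' ℝ)).sdiff h).nonempty
  by_contra hc
  push Not at hc
  exact hx' ⟨hx, hc x⟩

open Classical in
def Jinv (f : ℝ → ℂ) : ℤ := if h : ∃ x, BaseOK f x then Jv f h.choose else 0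

lemma Jinv_eq {f : ℝ → ℂ} (hf : Stb f) {x : ℝ} (hx : BaseOK f x) : Jinv f = Jv f x := by
  have h : ∃ x, BaseOK f x := ⟨x, hx⟩
  unfold Jinv
  rw [dif_pos h]
  exact Jv_indep hf h.choose_spec hx


open Classical in
def bx (S : Finset (ℝ × ℝ)) (r : ℝ) (q : ℝ × ℝ) : Finset (ℝ × ℝ) := S.filter (fun z => z ∈ Metric.ball q r)

lemma mem_bx {S : Finset (ℝ × ℝ)} {r : ℝ} {q z : ℝ × ℝ} :
    z ∈ bx S r q ↔ z ∈ S ∧ |z.1 - q.1| < r ∧ |z.2 - q.2| < r := by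
  simp [bx, Metric.mem_ball, Prod.dist_eq, Real.dist_eq]

lemma sum_bx {Q S : Finset (ℝ × ℝ)} {r : ℝ} (hsep : ∀ q ∈ Q, ∀ q' ∈ Q, q ≠ q' → 2 * r < dist q q')
    (hS : ∀ z ∈ S, ∃ q ∈ Q, |z.1 - q.1| < r ∧ |z.2 - q.2| < r) (g : ℝ × ℝ → ℤ) :
    ∑ z ∈ S, g z = ∑ q ∈ Q, ∑ z ∈ bx S r q, g z := by
  classical
  have : S = Q.biUnion (bx S r) := by
    ext z
    simp only [Finset.mem_biUnion, mem_bx]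
    constructor
    · intro hz
      obtain ⟨q, hq, h⟩ := hS z hz
      exact ⟨q, hq, hz, h⟩
    · rintro ⟨q, hq, hz, h⟩; exact hz
  conv_lhs => rw [this]
  apply Finset.sum_biUnion
  intro q hq q' hq' hne
  rw [Function.onFun, Finset.disjoint_left]
  intro z h1 h2
  have a := (Finset.mem_filter.mp h1).2
  have b := (Finset.mem_filter.mp h2).2
  rw [Metric.mem_ball] at a b
  have := dist_triangle_left q q' z
  linarith [hsep q hq q' hq' hne]

lemma Dsum_bx {Q S : Finset (ℝ × ℝ)} {r : ℝ} (hsep : ∀ q ∈ Q, ∀ q' ∈ Q, q ≠ q' → 2 * r < dist q q')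
    (hS : ∀ z ∈ S, ∃ q ∈ Q, |z.1 - q.1| < r ∧ |z.2 - q.2| < r) (e : ℝ × ℝ → ℤ) :
    Dsum e S S = ∑ q ∈ Q, ∑ q' ∈ Q, Dsum e (bx S r q) (bx S r q') := by
  unfold Dsum
  rw [sum_bx hsep hS]
  apply Finset.sum_congr rfl
  intro q _
  rw [Finset.sum_comm]
  rw [sum_bx hsep hS]
  apply Finset.sum_congr rfl
  intro q' _
  rw [Finset.sum_comm]

lemma Dsum_far {S : Finset (ℝ × ℝ)} {r : ℝ} {q q' : ℝ × ℝ} (h : 2 * r < |q.2 - q'.1|) (e : ℝ × ℝ → ℤ) :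
    Dsum e (bx S r q) (bx S r q') =
      if q.2 < q'.1 then (∑ z ∈ bx S r q, e z) * ∑ z ∈ bx S r q', e z else 0 := by
  unfold Dsum
  rw [Finset.sum_mul_sum]
  split_ifs with hl
  · apply Finset.sum_congr rfl
    intro z hz
    apply Finset.sum_congr rfl
    intro z' hz'
    obtain ⟨-, -, h2⟩ := mem_bx.mp hz
    obtain ⟨-, h1, -⟩ := mem_bx.mp hz'
    rw [abs_of_neg (by linarith)] at h
    rw [abs_lt] at h1 h2
    rw [if_pos (by linarith)]
  · apply Finset.sum_eq_zero
    intro z hz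
    apply Finset.sum_eq_zero
    intro z' hz'
    obtain ⟨-, -, h2⟩ := mem_bx.mp hz
    obtain ⟨-, h1, -⟩ := mem_bx.mp hz'
    rw [abs_of_nonneg (by linarith)] at h
    rw [abs_lt] at h1 h2
    rw [if_neg (by linarith)]

lemma Dsum_near {A B : Finset (ℝ × ℝ)} (hA : A.card ≤ 1) (hB : B.card ≤ 1) (e : ℝ × ℝ → ℤ)
    (he : ∀ z, |e z| ≤ 1) :
    |∑ z ∈ A, e z| ≤ 1 ∧ (Dsum e A B = 0 ∨ Dsum e A B = (∑ z ∈ A, e z) * ∑ z ∈ B, e z) := by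
  unfold Dsum
  rcases Nat.le_one_iff_eq_zero_or_eq_one.mp hA with h | h
  · rw [Finset.card_eq_zero] at h; subst h; simp
  obtain ⟨a, rfl⟩ := Finset.card_eq_one.mp h
  rcases Nat.le_one_iff_eq_zero_or_eq_one.mp hB with h' | h'
  · rw [Finset.card_eq_zero] at h'; subst h'; simp [he a]
  obtain ⟨b, rfl⟩ := Finset.card_eq_one.mp h'
  simp only [Finset.sum_singleton]
  refine ⟨he a, ?_⟩
  split_ifs
  · right; rfl
  · left; rfl

lemma JF_comp {Q S S' : Finset (ℝ × ℝ)} {r : ℝ} (hsep : ∀ q ∈ Q, ∀ q' ∈ Q, q ≠ q' → 2 * r < dist q q')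
    (hsep2 : ∀ q ∈ Q, ∀ q' ∈ Q, q.2 ≠ q'.1 → 2 * r < |q.2 - q'.1|)
    (hS : ∀ z ∈ S, ∃ q ∈ Q, |z.1 - q.1| < r ∧ |z.2 - q.2| < r)
    (hS' : ∀ z ∈ S', ∃ q ∈ Q, |z.1 - q.1| < r ∧ |z.2 - q.2| < r) {e e' : ℝ × ℝ → ℤ}
    (he : ∀ z, |e z| ≤ 1) (he' : ∀ z, |e' z| ≤ 1)
    (hsum : ∀ q ∈ Q, ∑ z ∈ bx S r q, e z = ∑ z ∈ bx S' r q, e' z)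
    (hc : ∀ q ∈ Q, ∀ q' ∈ Q, q.2 = q'.1 → (bx S r q).card ≤ 1 ∧ (bx S r q').card ≤ 1 ∧ (bx S' r q).card ≤ 1 ∧
      (bx S' r q').card ≤ 1) :
    |JF e S - JF e' S'| ≤ 4 * ∑ q ∈ Q, ∑ q' ∈ Q, if q.2 = q'.1 then 1 else 0 := by
  have h1 : ∑ z ∈ S, e z = ∑ z ∈ S', e' z := by
    rw [sum_bx hsep hS, sum_bx hsep hS']
    exact Finset.sum_congr rfl hsum
  unfold JF
  rw [h1]
  have : ∀ a b c : ℤ, a - 4 * b - (a - 4 * c) = 4 * (c - b) := by intros; ring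
  rw [this, abs_mul, abs_of_pos (by norm_num : (0:ℤ) < 4)]
  apply mul_le_mul_of_nonneg_left _ (by norm_num)
  rw [Dsum_bx hsep hS, Dsum_bx hsep hS', ← Finset.sum_sub_distrib]
  refine (Finset.abs_sum_le_sum_abs _ _).trans (Finset.sum_le_sum fun q hq => ?_)
  rw [← Finset.sum_sub_distrib]
  refine (Finset.abs_sum_le_sum_abs _ _).trans (Finset.sum_le_sum fun q' hq' => ?_)
  split_ifs with h
  · obtain ⟨c1, c2, c3, c4⟩ := hc q hq q' hq' h
    obtain ⟨b1, d1⟩ := Dsum_near c1 c2 e he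
    obtain ⟨b2, d2⟩ := Dsum_near c3 c4 e' he'
    obtain ⟨b3, -⟩ := Dsum_near c4 c3 e' he'
    rw [hsum q hq, hsum q' hq'] at d1
    have hp : |(∑ z ∈ bx S' r q, e' z) * ∑ z ∈ bx S' r q', e' z| ≤ 1 := by
      rw [abs_mul]; exact mul_le_one₀ b2 (abs_nonneg _) b3
    rcases d1 with d1 | d1 <;> rcases d2 with d2 | d2 <;> rw [d1, d2]
    · simp
    · simpa using hp
    · simpa using hp
    · simp
  · rw [Dsum_far (hsep2 q hq q' hq' h), Dsum_far (hsep2 q hq q' hq' h), hsum q hq, hsum q' hq', sub_self, abs_zero]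

lemma eps_abs (f : ℝ → ℂ) (z : ℝ × ℝ) : |eps f z| ≤ 1 := by
  unfold eps
  rcases SignType.sign (det2 (deriv f z.1) (deriv f z.2)) with _ | _ | _ <;> simp

/-! homotopies -/

structure Hmt (H : ℝ → ℝ → ℂ) : Prop where
  c : Continuous fun q : ℝ × ℝ => H q.1 q.2
  d : Continuous fun q : ℝ × ℝ => deriv (H q.1) q.2
  imm : ∀ s, Imm (H s)

lemma C1est {H : ℝ → ℝ → ℂ} (hH : Hmt H) (s0 u0 : ℝ) {ε : ℝ} (hε : 0 < ε) :
    ∃ δ > 0, ∀ s, |s - s0| < δ → ∀ u v, |u - u0| < δ → |v - u0| < δ →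
      ‖H s v - H s u - (v - u) • deriv (H s0) u0‖ ≤ ε * |v - u| := by
  have h1 := Metric.continuousAt_iff.mp (hH.d.continuousAt (x := (s0, u0))) ε hε
  obtain ⟨δ, hδ, h⟩ := h1
  refine ⟨δ, hδ, fun s hs u v hu hv => ?_⟩
  have hd : ∀ y, HasDerivAt (fun t => H s t - t • deriv (H s0) u0) (deriv (H s) y - deriv (H s0) u0) y := by
    intro y
    have := ((hH.imm s).diff y).hasDerivAt.sub ((hasDerivAt_id y).smul_const (deriv (H s0) u0))
    rw [one_smul] at this
    exact this
  have := (convex_ball u0 δ).norm_image_sub_le_of_norm_hasDerivWithin_le (C := ε)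
    (f := fun t => H s t - t • deriv (H s0) u0) (fun y _ => (hd y).hasDerivWithinAt) ?_
    (x := u) (y := v) (by rwa [Metric.mem_ball, Real.dist_eq]) (by rwa [Metric.mem_ball, Real.dist_eq])
  · rw [Real.norm_eq_abs] at this
    have e : H s v - H s u - (v - u) • deriv (H s0) u0 = H s v - v • deriv (H s0) u0 - (H s u - u • deriv (H s0) u0) := by
      simp only [Complex.real_smul]; push_cast; ring
    rw [e]; exact this
  · intro y hy
    rw [Metric.mem_ball, Real.dist_eq] at hy
    have := h (x := (s, y)) (by rw [Prod.dist_eq, Real.dist_eq, Real.dist_eq]; exact max_lt hs hy)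
    rw [dist_eq_norm] at this
    exact this.le

lemma loc_inj {H : ℝ → ℝ → ℂ} (hH : Hmt H) (s0 u0 : ℝ) :
    ∃ δ > 0, ∀ s, |s - s0| < δ → ∀ u v, |u - u0| < δ → |v - u0| < δ → H s u = H s v → u = v := by
  have ha := norm_pos_iff.mpr ((hH.imm s0).imm u0)
  obtain ⟨δ, hδ, h⟩ := C1est hH s0 u0 (half_pos ha)
  refine ⟨δ, hδ, fun s hs u v hu hv he => ?_⟩
  have := h s hs u v hu hv
  rw [he, sub_self, zero_sub, norm_neg, norm_smul, Real.norm_eq_abs] at this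
  by_contra hne
  have hp : 0 < |v - u| := abs_pos.mpr (sub_ne_zero.mpr (Ne.symm hne))
  nlinarith

lemma box_uniq {H : ℝ → ℝ → ℂ} (hH : Hmt H) (s0 : ℝ) (q : ℝ × ℝ)
    (hq : det2 (deriv (H s0) q.1) (deriv (H s0) q.2) ≠ 0) :
    ∃ δ > 0, ∀ s, |s - s0| < δ → ∀ z z' : ℝ × ℝ, |z.1 - q.1| < δ → |z.2 - q.2| < δ →
      |z'.1 - q.1| < δ → |z'.2 - q.2| < δ → H s z.1 = H s z.2 → H s z'.1 = H s z'.2 → z = z' := by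
  obtain ⟨c, hc, hlow⟩ := lin_lower hq
  obtain ⟨δ1, hδ1, h1⟩ := C1est hH s0 q.1 (half_pos hc)
  obtain ⟨δ2, hδ2, h2⟩ := C1est hH s0 q.2 (half_pos hc)
  refine ⟨min δ1 δ2, lt_min hδ1 hδ2, fun s hs z z' a1 a2 a1' a2' e e' => ?_⟩
  rw [lt_min_iff] at hs a1 a2 a1' a2'
  have k1 := h1 s hs.1 z.1 z'.1 a1.1 a1'.1
  have k2 := h2 s hs.2 z.2 z'.2 a2.2 a2'.2
  have k3 := hlow (z'.1 - z.1) (-(z'.2 - z.2))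
  have : (z'.1 - z.1) • deriv (H s0) q.1 + -(z'.2 - z.2) • deriv (H s0) q.2 =
      (H s z'.2 - H s z.2 - (z'.2 - z.2) • deriv (H s0) q.2) - (H s z'.1 - H s z.1 - (z'.1 - z.1) • deriv (H s0) q.1) := by
    rw [e, e']; simp only [Complex.real_smul]; push_cast; ring
  rw [this, abs_neg] at k3
  have k4 := norm_sub_le (H s z'.2 - H s z.2 - (z'.2 - z.2) • deriv (H s0) q.2) (H s z'.1 - H s z.1 - (z'.1 - z.1) • deriv (H s0) q.1)
  have n1 := abs_nonneg (z'.1 - z.1)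
  have n2 := abs_nonneg (z'.2 - z.2)
  have m1 : |z'.1 - z.1| = 0 := by nlinarith
  have m2 : |z'.2 - z.2| = 0 := by nlinarith
  rw [abs_eq_zero] at m1 m2
  exact Prod.ext (by linarith) (by linarith)

lemma outside {H : ℝ → ℝ → ℂ} (hH : Hmt H) (s0 x : ℝ) (hx : BaseOK (H s0) x) (r : ℝ) (Q : Finset (ℝ × ℝ))
    (hQ : ∀ q, q ∈ Q ↔ q ∈ Ch (H s0) x) (hr : 0 < r) :
    ∀ᶠ s in nhds s0, ∀ z : ℝ × ℝ, x ≤ z.1 → z.1 < z.2 → z.2 < x + 1 → H s z.1 = H s z.2 →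
      ∃ q ∈ Q, |z.1 - q.1| < r ∧ |z.2 - q.2| < r := by
  set K : Set (ℝ × ℝ) := (Icc x (x + 1) ×ˢ Icc x (x + 1)) ∩ ({z | z.1 ≤ z.2} ∩ ⋂ q ∈ Q, (Metric.ball q r)ᶜ) with hK
  have hKc : IsCompact K := by
    apply (isCompact_Icc.prod isCompact_Icc).inter_right
    refine (isClosed_le continuous_fst continuous_snd).inter ?_
    exact isClosed_biInter fun q _ => Metric.isOpen_ball.isClosed_compl
  have hcont := hH.c
  have key := hKc.eventually_forall_of_forall_eventually (x₀ := s0)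
    (P := fun s z => H s z.1 = H s z.2 → z.1 = z.2 ∨ z.1 + 1 = z.2) ?_
  · filter_upwards [key] with s hs z h1 h2 h3 h4
    by_contra hc
    push Not at hc
    have hz : z ∈ K := by
      refine ⟨⟨⟨h1, by linarith⟩, ⟨by linarith, h3.le⟩⟩, h2.le, ?_⟩
      simp only [mem_iInter, mem_compl_iff, Metric.mem_ball, Prod.dist_eq, Real.dist_eq, max_lt_iff, not_and, not_lt]
      exact fun q hq h => hc q hq h
    rcases hs z hz h4 with h | h <;> linarith
  · rintro z ⟨⟨hz1, hz2⟩, hz3, hz4⟩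
    by_cases hne : H s0 z.1 = H s0 z.2
    · have hz3 : z.1 ≤ z.2 := hz3
      rcases eq_or_lt_of_le hz3 with heq | hlt
      · obtain ⟨δ, hδ, h⟩ := loc_inj hH s0 z.1
        rw [Metric.eventually_nhds_iff]
        refine ⟨δ, hδ, fun y hy he => Or.inl ?_⟩
        rw [Prod.dist_eq, Prod.dist_eq, max_lt_iff, max_lt_iff, Real.dist_eq, Real.dist_eq, Real.dist_eq] at hy
        exact h y.1 hy.1 _ _ hy.2.1 (by rw [heq]; exact hy.2.2) he
      · rcases eq_or_lt_of_le hz1.1 with e1 | e1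
        · rcases eq_or_lt_of_le hz2.2 with e2 | e2
          · obtain ⟨δ, hδ, h⟩ := loc_inj hH s0 z.1
            rw [Metric.eventually_nhds_iff]
            refine ⟨δ, hδ, fun y hy he => Or.inr ?_⟩
            rw [Prod.dist_eq, Prod.dist_eq, max_lt_iff, max_lt_iff, Real.dist_eq, Real.dist_eq, Real.dist_eq] at hy
            have := h y.1 hy.1 y.2.1 (y.2.2 - 1) hy.2.1 (by
              rw [show y.2.2 - 1 - z.1 = y.2.2 - z.2 by rw [e2, ← e1]; ring]; exact hy.2.2) (by rw [(hH.imm _).per.sub_eq]; exact he)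
            linarith
          · exfalso
            rw [← e1] at hne
            exact hx z.2 (by linarith) e2 hne.symm
        · rcases eq_or_lt_of_le hz2.2 with e2 | e2
          · exfalso
            rw [e2, (hH.imm _).per] at hne
            exact hx z.1 e1 (by linarith) hne
          · exfalso
            have hq := (hQ z).mpr ⟨e1, hlt, e2, hne⟩
            simp only [mem_iInter] at hz4
            exact hz4 z hq (Metric.mem_ball_self hr)
    · have : ∀ᶠ y : ℝ × (ℝ × ℝ) in nhds (s0, z), H y.1 y.2.1 ≠ H y.1 y.2.2 := by
        have c1 : Continuous fun y : ℝ × (ℝ × ℝ) => H y.1 y.2.1 :=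
          hcont.comp (continuous_fst.prodMk (continuous_fst.comp continuous_snd))
        have c2 : Continuous fun y : ℝ × (ℝ × ℝ) => H y.1 y.2.2 :=
          hcont.comp (continuous_fst.prodMk (continuous_snd.comp continuous_snd))
        exact (isOpen_ne_fun c1 c2).mem_nhds hne
      exact this.mono fun y hy h => absurd h hy


lemma box_sum {H : ℝ → ℝ → ℂ} (hH : Hmt H) (s0 : ℝ) (q : ℝ × ℝ) {r : ℝ} (hr : 0 < r)
    (h1 : q.1 + r < q.2 - r) (h2 : q.2 + r < q.1 - r + 1)
    (hb : ∀ u v, |u - q.1| ≤ r → |v - q.2| ≤ r → H s0 u = H s0 v → (u, v) = q) :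
    ∀ᶠ s in nhds s0, Stb (H s) → ∀ Z : Finset (ℝ × ℝ),
      (∀ z, z ∈ Z ↔ |z.1 - q.1| < r ∧ |z.2 - q.2| < r ∧ H s z.1 = H s z.2) →
      2 * Real.pi * Complex.I * ((∑ z ∈ Z, eps (H s) z : ℤ) : ℂ) =
        - bdry (fun u v => H s0 v - H s0 u) (q.1 - r) (q.1 + r) (q.2 - r) (q.2 + r) := by
  set K : Set (ℝ × ℝ) := (Icc (q.1 - r) (q.1 + r) ×ˢ Icc (q.2 - r) (q.2 + r)) ∩
    {z | z.1 = q.1 - r ∨ z.1 = q.1 + r ∨ z.2 = q.2 - r ∨ z.2 = q.2 + r} with hK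
  have hKc : IsCompact K := by
    apply (isCompact_Icc.prod isCompact_Icc).inter_right
    have e1 := isClosed_eq (f := fun z : ℝ × ℝ => z.1) (g := fun _ => q.1 - r) (by fun_prop) (by fun_prop)
    have e2 := isClosed_eq (f := fun z : ℝ × ℝ => z.1) (g := fun _ => q.1 + r) (by fun_prop) (by fun_prop)
    have e3 := isClosed_eq (f := fun z : ℝ × ℝ => z.2) (g := fun _ => q.2 - r) (by fun_prop) (by fun_prop)
    have e4 := isClosed_eq (f := fun z : ℝ × ℝ => z.2) (g := fun _ => q.2 + r) (by fun_prop) (by fun_prop)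
    exact e1.union (e2.union (e3.union e4))
  have hcont := hH.c
  have c1 : Continuous fun y : ℝ × (ℝ × ℝ) => H y.1 y.2.1 :=
    hcont.comp (continuous_fst.prodMk (continuous_fst.comp continuous_snd))
  have c2 : Continuous fun y : ℝ × (ℝ × ℝ) => H y.1 y.2.2 :=
    hcont.comp (continuous_fst.prodMk (continuous_snd.comp continuous_snd))
  have c10 : Continuous fun y : ℝ × (ℝ × ℝ) => H s0 y.2.1 :=
    (hH.imm s0).cont.comp (continuous_fst.comp continuous_snd)
  have c20 : Continuous fun y : ℝ × (ℝ × ℝ) => H s0 y.2.2 :=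
    (hH.imm s0).cont.comp (continuous_snd.comp continuous_snd)
  have habs : ∀ a b : ℝ, a ∈ Icc (b - r) (b + r) → |a - b| ≤ r := fun a b h => by
    rw [abs_le]; constructor <;> linarith [h.1, h.2]
  have key := hKc.eventually_forall_of_forall_eventually (x₀ := s0)
    (P := fun s z => ‖(H s z.2 - H s z.1) - (H s0 z.2 - H s0 z.1)‖ < ‖H s0 z.2 - H s0 z.1‖) ?_
  · filter_upwards [key] with s hs hst Z hZ
    have hro := bdry_rouche (F := fun u v => H s v - H s u) (G := fun u v => H s0 v - H s0 u)
      (a := q.1 - r) (b := q.1 + r) (c := q.2 - r) (d := q.2 + r) (by linarith) (by linarith)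
      (by have := (hH.imm s).cont; fun_prop) (by have := (hH.imm s0).cont; fun_prop)
      (fun u hu v hv h => hs (u, v) ⟨⟨hu, hv⟩, h⟩)
    have hdl := DL (F := fun u v => H s v - H s u)
      (a := q.1 - r) (b := q.1 + r) (c := q.2 - r) (d := q.2 + r) (by linarith) (by linarith) Z
      (fun z => -deriv (H s) z.1) (fun z => deriv (H s) z.2) (by have := (hH.imm s).cont; fun_prop) ?_ ?_ ?_
    · rw [← hro, hdl, ← mul_neg]
      congr 1
      rw [← Int.cast_neg, ← Finset.sum_neg_distrib]
      congr 1
      apply Finset.sum_congr rfl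
      intro z _
      rw [det2_neg_left, Left.sign_neg, eps]; simp
    · intro z hz
      obtain ⟨a, b, -⟩ := (hZ z).mp hz
      rw [abs_lt] at a b
      constructor <;> constructor <;> linarith
    · intro u hu v hv h0
      have hn : ¬ (u = q.1 - r ∨ u = q.1 + r ∨ v = q.2 - r ∨ v = q.2 + r) := by
        intro h
        have := hs (u, v) ⟨⟨hu, hv⟩, h⟩
        simp only at this h0
        rw [h0, zero_sub, norm_neg] at this
        exact lt_irrefl _ this
      push Not at hn
      rw [hZ]
      obtain ⟨n1, n2, n3, n4⟩ := hn
      have a1 := lt_of_le_of_ne hu.1 n1.symm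
      have a2 := lt_of_le_of_ne hu.2 n2
      have a3 := lt_of_le_of_ne hv.1 n3.symm
      have a4 := lt_of_le_of_ne hv.2 n4
      refine ⟨by rw [abs_lt]; constructor <;> linarith, by rw [abs_lt]; constructor <;> linarith, (sub_eq_zero.mp h0).symm⟩
    · intro z hz
      obtain ⟨a, b, h⟩ := (hZ z).mp hz
      rw [abs_lt] at a b
      refine ⟨linAt_diff (hst.diff _) (hst.diff _) h, ?_⟩
      rw [det2_neg_left]
      exact neg_ne_zero.mpr (hst.tr _ _ (by linarith) (by linarith) h)
  · rintro z ⟨⟨hz1, hz2⟩, hz3⟩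
    refine (isOpen_lt (((c2.sub c1).sub (c20.sub c10)).norm) ((c20.sub c10).norm)).mem_nhds ?_
    simp only [mem_ofPred_eq, Pi.sub_apply, sub_self, norm_zero, norm_pos_iff]
    intro h0
    have := hb z.1 z.2 (habs _ _ hz1) (habs _ _ hz2) (sub_eq_zero.mp h0).symm
    have e1 : z.1 = q.1 := congrArg Prod.fst this
    have e2 : z.2 = q.2 := congrArg Prod.snd this
    simp only [mem_ofPred_eq, e1, e2] at hz3
    rcases hz3 with h | h | h | h <;> linarith

lemma local_thm {H : ℝ → ℝ → ℂ} (hH : Hmt H) (s0 x : ℝ) (hx : BaseOK (H s0) x) (Q : Finset (ℝ × ℝ))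
    (hQ : ∀ q, q ∈ Q ↔ q ∈ Ch (H s0) x)
    (hP : ∀ q ∈ Q, ∀ q' ∈ Q, q.2 = q'.1 → det2 (deriv (H s0) q.1) (deriv (H s0) q.2) ≠ 0 ∧
      det2 (deriv (H s0) q'.1) (deriv (H s0) q'.2) ≠ 0) :
    ∃ U ∈ nhds s0, ∀ s1 ∈ U, ∀ s2 ∈ U, Stb (H s1) → Stb (H s2) →
      |Jinv (H s1) - Jinv (H s2)| ≤ 4 * ∑ q ∈ Q, ∑ q' ∈ Q, if q.2 = q'.1 then 1 else 0 := by
  have hlt : ∀ y : ℝ, 0 < y → ∀ᶠ η in nhdsWithin (0:ℝ) (Ioi 0), η < y := fun y hy =>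
      nhdsWithin_le_nhds (gt_mem_nhds hy)
  have hu : ∀ q : ℝ × ℝ, ∃ δ > 0, det2 (deriv (H s0) q.1) (deriv (H s0) q.2) ≠ 0 → ∀ s, |s - s0| < δ → ∀ z z' : ℝ × ℝ, |z.1 - q.1| < δ → |z.2 - q.2| < δ →
      |z'.1 - q.1| < δ → |z'.2 - q.2| < δ → H s z.1 = H s z.2 → H s z'.1 = H s z'.2 → z = z' := by
    intro q
    by_cases h : det2 (deriv (H s0) q.1) (deriv (H s0) q.2) ≠ 0
    · obtain ⟨δ, hδ, h'⟩ := box_uniq hH s0 q h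
      exact ⟨δ, hδ, fun _ => h'⟩
    · exact ⟨1, one_pos, fun h' => absurd h' h⟩
  choose δ hδ hδ' using hu
  have ev : ∀ᶠ r in nhdsWithin (0:ℝ) (Ioi 0),
      (∀ q ∈ Q, ((r < q.1 - x ∧ r < x + 1 - q.2) ∧ (r < (q.2 - q.1) / 2 ∧ r < (q.1 + 1 - q.2) / 2)) ∧ r < δ q) ∧
      ((∀ q ∈ Q, ∀ q' ∈ Q, q ≠ q' → r < dist q q' / 2) ∧ (∀ q ∈ Q, ∀ q' ∈ Q, q.2 ≠ q'.1 → r < |q.2 - q'.1| / 2)) := by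
    refine ((Finset.eventually_all _).mpr fun q hq => ?_).and
      (((Finset.eventually_all _).mpr fun q hq => (Finset.eventually_all _).mpr fun q' hq' => ?_).and
      ((Finset.eventually_all _).mpr fun q hq => (Finset.eventually_all _).mpr fun q' hq' => ?_))
    · obtain ⟨a, b, c, -⟩ := (hQ q).mp hq
      exact (((hlt _ (by linarith)).and (hlt _ (by linarith))).and ((hlt _ (by linarith)).and (hlt _ (by linarith)))).and
        (hlt _ (hδ q))
    · by_cases h : q = q'
      · exact Filter.Eventually.of_forall fun z hz => absurd h hz
      · exact (hlt _ (half_pos (dist_pos.mpr h))).mono fun z hz _ => hz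
    · by_cases h : q.2 = q'.1
      · exact Filter.Eventually.of_forall fun z hz => absurd h hz
      · exact (hlt _ (half_pos (abs_pos.mpr (sub_ne_zero.mpr h)))).mono fun z hz _ => hz
  obtain ⟨r, ⟨g1, g2, g3⟩, hr : 0 < r⟩ := (ev.and self_mem_nhdsWithin).exists
  have hd : ∀ q ∈ Q, ∀ᶠ s in nhds s0, |s - s0| < δ q := by
    intro q _
    rw [Metric.eventually_nhds_iff]
    exact ⟨δ q, hδ q, fun y hy => by rwa [Real.dist_eq] at hy⟩
  have good := ((outside hH s0 x hx r Q hQ hr).and ((Finset.eventually_all Q).mpr fun q hq => box_sum hH s0 q hr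
      (by linarith [(g1 q hq).1.2.1]) (by linarith [(g1 q hq).1.2.2]) ?_)).and ((Finset.eventually_all Q).mpr hd)
  · refine ⟨_, good, ?_⟩
    have base : ∀ s, Stb (H s) → (∀ z : ℝ × ℝ, x ≤ z.1 → z.1 < z.2 → z.2 < x + 1 → H s z.1 = H s z.2 →
        ∃ q ∈ Q, |z.1 - q.1| < r ∧ |z.2 - q.2| < r) → BaseOK (H s) x := by
      intro s hs h t ht1 ht2 he
      obtain ⟨q, hq, hq1, -⟩ := h (x, t) le_rfl ht1 ht2 he.symm
      have := (g1 q hq).1.1.1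
      simp only at hq1
      rw [abs_lt] at hq1
      linarith [hq1.1]
    have bmem : ∀ s, Stb (H s) → ∀ q ∈ Q, ∀ z, z ∈ bx (toFs (Ch (H s) x)) r q ↔
        |z.1 - q.1| < r ∧ |z.2 - q.2| < r ∧ H s z.1 = H s z.2 := by
      intro s hs q hq z
      rw [mem_bx, mem_toFs (hs.fin x)]
      constructor
      · rintro ⟨a, b, c⟩; exact ⟨b, c, a.2.2.2⟩
      · rintro ⟨b, c, d⟩
        refine ⟨?_, b, c⟩
        obtain ⟨⟨⟨i1, i2⟩, i3, i4⟩, -⟩ := g1 q hq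
        rw [abs_lt] at b c
        exact ⟨by linarith, by linarith, by linarith, d⟩
    rintro s1 ⟨⟨o1, b1⟩, n1⟩ s2 ⟨⟨o2, b2⟩, n2⟩ hs1 hs2
    rw [Jinv_eq hs1 (base s1 hs1 o1), Jinv_eq hs2 (base s2 hs2 o2)]
    unfold Jv
    have inbox : ∀ s, Stb (H s) → (∀ z : ℝ × ℝ, x ≤ z.1 → z.1 < z.2 → z.2 < x + 1 → H s z.1 = H s z.2 →
        ∃ q ∈ Q, |z.1 - q.1| < r ∧ |z.2 - q.2| < r) → ∀ z ∈ toFs (Ch (H s) x), ∃ q ∈ Q, |z.1 - q.1| < r ∧ |z.2 - q.2| < r := by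
      intro s hs h z hz
      rw [mem_toFs (hs.fin x)] at hz
      exact h z hz.1.le hz.2.1 hz.2.2.1 hz.2.2.2
    have card1 : ∀ s, Stb (H s) → (∀ q ∈ Q, |s - s0| < δ q) → ∀ q ∈ Q,
        det2 (deriv (H s0) q.1) (deriv (H s0) q.2) ≠ 0 → (bx (toFs (Ch (H s) x)) r q).card ≤ 1 := by
      intro s hs hn q hq hq'
      rw [Finset.card_le_one]
      intro z hz z' hz'
      rw [bmem s hs q hq] at hz hz'
      have hl := (g1 q hq).2
      exact hδ' q hq' s (hn q hq) z z' (by linarith [hz.1]) (by linarith [hz.2.1]) (by linarith [hz'.1])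
        (by linarith [hz'.2.1]) hz.2.2 hz'.2.2
    apply JF_comp (r := r) (fun q hq q' hq' h => by linarith [g2 q hq q' hq' h])
      (fun q hq q' hq' h => by linarith [g3 q hq q' hq' h]) (inbox s1 hs1 o1) (inbox s2 hs2 o2) (eps_abs _) (eps_abs _)
    · intro q hq
      have e1 := b1 q hq hs1 _ (bmem s1 hs1 q hq)
      have e2 := b2 q hq hs2 _ (bmem s2 hs2 q hq)
      have := mul_left_cancel₀ Complex.two_pi_I_ne_zero (e1.trans e2.symm)
      exact_mod_cast this
    · intro q hq q' hq' h
      obtain ⟨p1, p2⟩ := hP q hq q' hq' h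
      exact ⟨card1 s1 hs1 n1 q hq p1, card1 s1 hs1 n1 q' hq' p2, card1 s2 hs2 n2 q hq p1, card1 s2 hs2 n2 q' hq' p2⟩
  · intro u v hu' hv' he
    obtain ⟨⟨⟨i1, i2⟩, i3, i4⟩, -⟩ := g1 q hq
    have m : (u, v) ∈ Q := by
      rw [hQ]
      rw [abs_le] at hu' hv'
      exact ⟨by simp only; linarith, by simp only; linarith, by simp only; linarith, he⟩
    by_contra hne
    have := g2 _ m q hq hne
    rw [Prod.dist_eq, Real.dist_eq, Real.dist_eq] at this
    have := max_le hu' hv'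
    simp only at *
    linarith


def Cond (f : ℝ → ℂ) (k : ℤ) : Prop := ∃ (x : ℝ) (Q : Finset (ℝ × ℝ)), BaseOK f x ∧ (∀ q, q ∈ Q ↔ q ∈ Ch f x) ∧
  (∀ q ∈ Q, ∀ q' ∈ Q, q.2 = q'.1 → det2 (deriv f q.1) (deriv f q.2) ≠ 0 ∧
      det2 (deriv f q'.1) (deriv f q'.2) ≠ 0) ∧ (∑ q ∈ Q, ∑ q' ∈ Q, if q.2 = q'.1 then (1:ℤ) else 0) ≤ k

lemma local_cond {H : ℝ → ℝ → ℂ} (hH : Hmt H) {s0 : ℝ} {k : ℤ} (h : Cond (H s0) k) :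
    ∃ U ∈ nhds s0, ∀ s1 ∈ U, ∀ s2 ∈ U, Stb (H s1) → Stb (H s2) → |Jinv (H s1) - Jinv (H s2)| ≤ 4 * k := by
  obtain ⟨x, Q, hx, hQ, hP, hk⟩ := h
  obtain ⟨U, hU, h⟩ := local_thm hH s0 x hx Q hQ hP
  exact ⟨U, hU, fun s1 h1 s2 h2 e1 e2 => (h s1 h1 s2 h2 e1 e2).trans (by linarith)⟩

lemma cond_zero {f : ℝ → ℂ} (hf : Imm f) (hfin : ∀ x, (Ch f x).Finite)
    (tri : ∀ s t u, s < t → t < u → u < s + 1 → f s = f t → f t = f u → False) : Cond f 0 := by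
  obtain ⟨x, hx⟩ := exists_baseOK hf (hfin 0)
  have hQ := mem_toFs (hfin x)
  have hno : ∀ q ∈ toFs (Ch f x), ∀ q' ∈ toFs (Ch f x), q.2 ≠ q'.1 := by
    intro q hq q' hq' h
    rw [hQ] at hq hq'
    exact tri q.1 q.2 q'.2 hq.2.1 (h ▸ hq'.2.1) (by linarith [hq.1, hq'.2.2.1]) hq.2.2.2 (h ▸ hq'.2.2.2)
  refine ⟨x, toFs (Ch f x), hx, hQ, fun q hq q' hq' h => absurd h (hno q hq q' hq'), le_of_eq ?_⟩
  exact Finset.sum_eq_zero fun q hq => Finset.sum_eq_zero fun q' hq' => if_neg (hno q hq q' hq')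

lemma triple_uniq {F : Set ℝ} (hF : F.ncard = 3) {a b c a' b' c' : ℝ} (h1 : a < b) (h2 : b < c)
    (h1' : a' < b') (h2' : b' < c') (ha : a ∈ F) (hb : b ∈ F) (hc : c ∈ F) (ha' : a' ∈ F) (hb' : b' ∈ F)
    (hc' : c' ∈ F) : a = a' ∧ b = b' ∧ c = c' := by
  have hfin : F.Finite := Set.finite_of_ncard_ne_zero (by omega)
  have key : ∀ a b c : ℝ, a < b → b < c → a ∈ F → b ∈ F → c ∈ F → F = {a, b, c} := by
    intro a b c h1 h2 ha hb hc
    symm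
    apply Set.eq_of_subset_of_ncard_le _ _ hfin
    · rintro x (rfl | rfl | rfl) <;> assumption
    · rw [hF, Set.ncard_eq_three.mpr ⟨a, b, c, h1.ne, (h1.trans h2).ne, h2.ne, rfl⟩]
  have e := key a b c h1 h2 ha hb hc
  have e' := key a' b' c' h1' h2' ha' hb' hc'
  rw [e'] at ha hb hc
  rw [e] at ha' hb' hc'
  simp only [mem_insert_iff, mem_singleton_iff] at ha hb hc ha' hb' hc'
  have g1 : a = a' := by
    apply le_antisymm
    · rcases ha' with h | h | h <;> linarith
    · rcases ha with h | h | h <;> linarith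
  have g3 : c = c' := by
    apply le_antisymm
    · rcases hc with h | h | h <;> linarith
    · rcases hc' with h | h | h <;> linarith
  refine ⟨g1, ?_, g3⟩
  rcases hb with h | h | h <;> linarith

lemma cond_one {f : ℝ → ℂ} (hf : Imm f) (hfin : ∀ x, (Ch f x).Finite) (y : ℝ)
    (h3 : Set.ncard {t ∈ Ico (0:ℝ) 1 | f t = f y} = 3)
    (htr : ∀ s t, s < t → t < s + 1 → f s = f t → f s = f y → det2 (deriv f s) (deriv f t) ≠ 0)
    (hother : ∀ z, f z ≠ f y → Set.ncard {t ∈ Ico (0:ℝ) 1 | f t = f z} ≤ 2) : Cond f 1 := by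
  obtain ⟨x, hx⟩ := exists_baseOK hf (hfin 0)
  have hQ := mem_toFs (hfin x)
  rw [ncard_shift hf.per _ x] at h3
  have hp : ∀ q ∈ toFs (Ch f x), ∀ q' ∈ toFs (Ch f x), q.2 = q'.1 → f q.1 = f y := by
    intro q hq q' hq' h
    rw [hQ] at hq hq'
    by_contra hne
    have := three_le_mult hf.per hf.diff hf.imm hq.2.1 (h ▸ hq'.2.1) (by linarith [hq.1, hq'.2.2.1]) hq.2.2.2 (h ▸ hq'.2.2.2)
    have := hother _ hne
    omega
  refine ⟨x, toFs (Ch f x), hx, hQ, fun q hq q' hq' h => ?_, ?_⟩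
  · have := hp q hq q' hq' h
    rw [hQ] at hq hq'
    refine ⟨htr _ _ hq.2.1 (by linarith [hq.1, hq.2.2.1]) hq.2.2.2 this,
      htr _ _ hq'.2.1 (by linarith [hq'.1, hq'.2.2.1]) hq'.2.2.2 ?_⟩
    rw [← h, ← hq.2.2.2, this]
  · rw [← Finset.sum_product', ← Finset.sum_filter, Finset.sum_const, nsmul_eq_mul, mul_one]
    have : (Finset.filter (fun p : (ℝ × ℝ) × ℝ × ℝ => p.1.2 = p.2.1) (toFs (Ch f x) ×ˢ toFs (Ch f x))).card ≤ 1 := by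
      rw [Finset.card_le_one]
      rintro ⟨q, q'⟩ h ⟨p, p'⟩ h'
      simp only [Finset.mem_filter, Finset.mem_product] at h h'
      have e1 := hp q h.1.1 q' h.1.2 h.2
      have e2 := hp p h'.1.1 p' h'.1.2 h'.2
      obtain ⟨⟨a1, a2⟩, a3⟩ := h
      obtain ⟨⟨b1, b2⟩, b3⟩ := h'
      rw [hQ] at a1 a2 b1 b2
      obtain ⟨i1, i2, i3, i4⟩ := a1
      obtain ⟨j1, j2, j3, j4⟩ := a2
      obtain ⟨k1, k2, k3, k4⟩ := b1
      obtain ⟨l1, l2, l3, l4⟩ := b2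
      obtain ⟨u1, u2, u3⟩ := triple_uniq h3 i2 (a3 ▸ j2 : q.2 < q'.2) k2 (b3 ▸ l2 : p.2 < p'.2)
        ⟨⟨i1.le, by linarith⟩, e1⟩ ⟨⟨by linarith, by linarith⟩, by rw [← i4, e1]⟩
        ⟨⟨by linarith, by linarith⟩, by rw [← j4, ← a3, ← i4, e1]⟩
        ⟨⟨k1.le, by linarith⟩, e2⟩ ⟨⟨by linarith, by linarith⟩, by rw [← k4, e2]⟩
        ⟨⟨by linarith, by linarith⟩, by rw [← l4, ← b3, ← k4, e2]⟩
      exact Prod.ext (Prod.ext u1 u2) (Prod.ext (by rw [← a3, ← b3, u2]) u3)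
    exact_mod_cast this

/-! abstract path arguments -/

def LocBd (J : ℝ → ℤ) (St : ℝ → Prop) (k : ℤ) (s0 : ℝ) : Prop :=
  ∃ U ∈ nhds s0, ∀ s1 ∈ U, ∀ s2 ∈ U, St s1 → St s2 → |J s1 - J s2| ≤ 4 * k

lemma path_const {J : ℝ → ℤ} {St : ℝ → Prop} {a b : ℝ} (hab : a ≤ b) (h : ∀ s ∈ Icc a b, St s ∧ LocBd J St 0 s) :
    J a = J b := by
  have hc : ContinuousOn J (Icc a b) := by
    intro s hs
    obtain ⟨U, hU, hU'⟩ := (h s hs).2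
    have : ∀ᶠ s' in nhdsWithin s (Icc a b), J s' = J s := by
      filter_upwards [nhdsWithin_le_nhds hU, self_mem_nhdsWithin] with s' h1 h2
      have := hU' s' h1 s (mem_of_mem_nhds hU) (h s' h2).1 (h s hs).1
      rw [mul_zero] at this
      have := abs_nonpos_iff.mp this
      omega
    exact continuousWithinAt_const.congr_of_eventuallyEq this rfl
  exact isPreconnected_Icc.constant hc (left_mem_Icc.mpr hab) (right_mem_Icc.mpr hab)

lemma path_jump {J : ℝ → ℤ} {St : ℝ → Prop} {s0 : ℝ} {k : ℤ} (hs0 : s0 ∈ Ioo (0:ℝ) 1)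
    (h : ∀ s ∈ Icc (0:ℝ) 1, s ≠ s0 → St s ∧ LocBd J St 0 s) (hk : LocBd J St k s0) : |J 0 - J 1| ≤ 4 * k := by
  obtain ⟨U, hU, hU'⟩ := hk
  obtain ⟨δ, hδ, hb⟩ := Metric.mem_nhds_iff.mp hU
  obtain ⟨η, hη, hη'⟩ := exists_between (lt_min hδ (lt_min hs0.1 (sub_pos.mpr hs0.2)))
  rw [lt_min_iff, lt_min_iff] at hη'
  have e1 : J 0 = J (s0 - η) := path_const (St := St) (by linarith) fun s hs => h s ⟨hs.1, by linarith [hs.2]⟩ (by linarith [hs.2])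
  have e2 : J (s0 + η) = J 1 := path_const (St := St) (by linarith) fun s hs => h s ⟨by linarith [hs.1, hs0.1], hs.2⟩ (by linarith [hs.1])
  rw [e1, ← e2]
  apply hU' _ (hb _) _ (hb _) (h _ ⟨by linarith, by linarith⟩ (by linarith)).1 (h _ ⟨by linarith, by linarith⟩ (by linarith)).1
  · rw [Metric.mem_ball, Real.dist_eq, sub_sub_cancel_left, abs_neg, abs_of_pos hη]; exact hη'.1
  · rw [Metric.mem_ball, Real.dist_eq, add_sub_cancel_left, abs_of_pos hη]; exact hη'.1

/-! planar moves -/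

lemma Imm.of_curve {f : ℝ → ℂ} (h1 : Function.Periodic f 1) (h2 : ContDiff ℝ (⊤ : ℕ∞) f) (h3 : ∀ t, deriv f t ≠ 0) :
    Imm f := ⟨h1, h2.of_le (by exact_mod_cast le_top), h3⟩

lemma Hmt.of_reg {f g : ℝ → ℂ} {H : ℝ → ℝ → ℂ} (h : PlanarCurve.IsRegHomotopy f g H) : Hmt H :=
  ⟨h.1, h.2.1, fun s => Imm.of_curve (h.2.2.1 s) (h.2.2.2.1 s) (h.2.2.2.2.1 s)⟩

lemma Stb.cond {f : ℝ → ℂ} (h : Stb f) : Cond f 0 := cond_zero h.toImm h.fin h.tri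

lemma cond_of_JSing {f : ℝ → ℂ} (hf : Imm f) (h : PlanarCurve.JSingF f) : Cond f 0 := by
  obtain ⟨p, hp, -, hq, hfin⟩ := h
  refine cond_zero hf (ch_fin hf.per hf.diff hf.imm hfin) fun s t u h1 h2 h3 e1 e2 => ?_
  have h4 := three_le_mult hf.per hf.diff hf.imm h1 h2 h3 e1 e2
  change 3 ≤ PlanarCurve.multF f (f s) at h4
  by_cases h : f s = p
  · rw [h] at h4; omega
  · rcases hq _ h with h5 | ⟨h5, -⟩ <;> omega

lemma cond_of_SSing {f : ℝ → ℂ} (hf : Imm f) (h : PlanarCurve.SSingF f) : Cond f 1 := by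
  obtain ⟨p, hp, htr, hq, hfin⟩ := h
  have hne : {t ∈ Ico (0:ℝ) 1 | f t = p}.Nonempty := by
    apply Set.nonempty_of_ncard_ne_zero
    unfold PlanarCurve.multF at hp; omega
  obtain ⟨y, hy, hyp⟩ := hne
  subst hyp
  refine cond_one hf (ch_fin hf.per hf.diff hf.imm hfin) y hp (fun s t h1 h2 e1 e2 => ?_) fun z hz => ?_
  · exact tr_of_transverse hf h1 h2 e1 (by rwa [e2])
  · rcases hq _ hz with h5 | ⟨h5, -⟩ <;> unfold PlanarCurve.multF at h5 <;> omega

lemma planar_stab {c c' : PlanarCurve} (h : PlanarCurve.StablyHomotopic c c') : Jinv c.toFun = Jinv c'.toFun := by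
  obtain ⟨H, hH, hs⟩ := h
  have := path_const (J := fun s => Jinv (H s)) (St := fun s => Stb (H s)) zero_le_one (fun s hs' => by
    have hst := Stb.of_stableF ((Hmt.of_reg hH).imm s) (hs s hs')
    exact ⟨hst, local_cond (Hmt.of_reg hH) hst.cond⟩)
  rwa [hH.2.2.2.2.2.1, hH.2.2.2.2.2.2] at this

lemma planar_move {c c' : PlanarCurve} (h : PlanarCurve.BasicMove c c') : |Jinv c.toFun - Jinv c'.toFun| ≤ 4 := by
  have main : ∀ H, PlanarCurve.IsRegHomotopy c.toFun c'.toFun H → ∀ s0 ∈ Ioo (0:ℝ) 1,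
    (∀ s ∈ Set.Icc (0:ℝ) 1, s ≠ s0 → PlanarCurve.StableF (H s)) → Cond (H s0) 1 →
      |Jinv c.toFun - Jinv c'.toFun| ≤ 4 := by
    intro H hH s0 hs0 hs hc
    have := path_jump (J := fun s => Jinv (H s)) (St := fun s => Stb (H s)) hs0 (fun s hs' hne => by
      have hst := Stb.of_stableF ((Hmt.of_reg hH).imm s) (hs s hs' hne)
      exact ⟨hst, local_cond (Hmt.of_reg hH) hst.cond⟩) (local_cond (Hmt.of_reg hH) hc)
    rwa [hH.2.2.2.2.2.1, hH.2.2.2.2.2.2] at this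
  rcases h with ⟨-, -, H, hH, s0, hs0, hs, hsing⟩ | ⟨-, -, H, hH, s0, hs0, hs, hsing⟩
  · refine main H hH s0 hs0 hs ?_
    obtain ⟨x, Q, a, b, c, d⟩ := cond_of_JSing ((Hmt.of_reg hH).imm s0) hsing
    exact ⟨x, Q, a, b, c, d.trans zero_le_one⟩
  · exact main H hH s0 hs0 hs (cond_of_SSing ((Hmt.of_reg hH).imm s0) hsing)

lemma planar_dist {c c' : PlanarCurve} {k : ℕ} {seq : ℕ → PlanarCurve} (h : PlanarCurve.ChainFromTo c c' seq k) :
    |Jinv c.toFun - Jinv c'.toFun| ≤ 4 * k := by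
  obtain ⟨h0, hk, hm⟩ := h
  rw [planar_stab h0, ← hk]
  clear hk h0
  induction k with
  | zero => simp
  | succ k ih =>
    have h1 := ih (fun i hi => hm i (by omega))
    have h2 := planar_move (hm k (by omega))
    have := abs_sub_le (Jinv (seq 0).toFun) (Jinv (seq k).toFun) (Jinv (seq (k+1)).toFun)
    push_cast
    linarith


abbrev E3 := EuclideanSpace ℝ (Fin 3)

lemma inner3 (a b : E3) : inner ℝ a b = a 0 * b 0 + a 1 * b 1 + a 2 * b 2 := by
  rw [PiLp.inner_apply, Fin.sum_univ_three]
  simp; ring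

lemma norm3 (a : E3) (h : ‖a‖ = 1) : a 0 ^ 2 + a 1 ^ 2 + a 2 ^ 2 = 1 := by
  have := real_inner_self_eq_norm_sq a
  rw [h, inner3] at this; linarith

lemma T_det (T : E3 →L[ℝ] ℂ) (v : E3) (hv : v 0 ^ 2 + v 1 ^ 2 + v 2 ^ 2 = 1) (hTv : T v = 0) :
    ∃ κ : ℝ, ∀ a b, det2 (T a) (T b) = κ * det3 v a b := by
  have hT : ∀ a : E3, T a = (a 0 : ℂ) * T (EuclideanSpace.single 0 1) + (a 1 : ℂ) * T (EuclideanSpace.single 1 1) +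
      (a 2 : ℂ) * T (EuclideanSpace.single 2 1) := by
    intro a
    have : a = a 0 • EuclideanSpace.single 0 1 + a 1 • EuclideanSpace.single 1 1 + a 2 • EuclideanSpace.single 2 1 := by
      ext i; fin_cases i <;> simp
    conv_lhs => rw [this]
    simp [map_add, map_smul]
  generalize T (EuclideanSpace.single 0 1) = p at hT
  generalize T (EuclideanSpace.single 1 1) = q at hT
  generalize T (EuclideanSpace.single 2 1) = r at hT
  rw [hT] at hTv
  have h1 := congrArg Complex.re hTv
  have h2 := congrArg Complex.im hTv
  simp at h1 h2
  refine ⟨v 0 * det2 q r + v 1 * det2 r p + v 2 * det2 p q, fun a b => ?_⟩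
  have m1 : v 1 * det2 p q = v 2 * det2 r p := by
    unfold det2; linear_combination p.re * h2 - p.im * h1
  have m2 : v 2 * det2 q r = v 0 * det2 p q := by
    unfold det2; linear_combination q.re * h2 - q.im * h1
  have m3 : v 0 * det2 r p = v 1 * det2 q r := by
    unfold det2; linear_combination r.re * h2 - r.im * h1
  have e : det2 (T a) (T b) = (a 1 * b 2 - a 2 * b 1) * det2 q r + (a 2 * b 0 - a 0 * b 2) * det2 r p +
      (a 0 * b 1 - a 1 * b 0) * det2 p q := by
    rw [hT a, hT b]; simp [det2]; ring
  rw [e]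
  generalize det2 q r = m0 at *
  generalize det2 r p = m1' at *
  generalize det2 p q = m2' at *
  have k0 : m0 = (v 0 * m0 + v 1 * m1' + v 2 * m2') * v 0 := by
    linear_combination -m0 * hv - v 1 * m3 + v 2 * m2
  have k1 : m1' = (v 0 * m0 + v 1 * m1' + v 2 * m2') * v 1 := by
    linear_combination -m1' * hv + v 0 * m3 - v 2 * m1
  have k2 : m2' = (v 0 * m0 + v 1 * m1' + v 2 * m2') * v 2 := by
    linear_combination -m2' * hv - v 0 * m2 + v 1 * m1
  unfold det3
  linear_combination (a 1 * b 2 - a 2 * b 1) * k0 + (a 2 * b 0 - a 0 * b 2) * k1 + (a 0 * b 1 - a 1 * b 0) * k2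

lemma cross_par (p u w : E3) (hp : p 0 ^ 2 + p 1 ^ 2 + p 2 ^ 2 = 1) (hu : p 0 * u 0 + p 1 * u 1 + p 2 * u 2 = 0)
    (hw : p 0 * w 0 + p 1 * w 1 + p 2 * w 2 = 0) :
    u 1 * w 2 - u 2 * w 1 = det3 p u w * p 0 ∧ u 2 * w 0 - u 0 * w 2 = det3 p u w * p 1 ∧
      u 0 * w 1 - u 1 * w 0 = det3 p u w * p 2 := by
  unfold det3
  refine ⟨?_, ?_, ?_⟩
  · linear_combination (-(u 1 * w 2 - u 2 * w 1)) * hp + (p 1 * w 2 - p 2 * w 1) * hu - (p 1 * u 2 - p 2 * u 1) * hw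
  · linear_combination (-(u 2 * w 0 - u 0 * w 2)) * hp + (p 2 * w 0 - p 0 * w 2) * hu - (p 2 * u 0 - p 0 * u 2) * hw
  · linear_combination (-(u 0 * w 1 - u 1 * w 0)) * hp + (p 0 * w 1 - p 1 * w 0) * hu - (p 0 * u 1 - p 1 * u 0) * hw

lemma det_proj (T : E3 →L[ℝ] ℂ) (v : E3) (hv : v 0 ^ 2 + v 1 ^ 2 + v 2 ^ 2 = 1) (κ : ℝ)
    (hκ : ∀ a b, det2 (T a) (T b) = κ * det3 v a b) (p u w : E3)
    (hp : p 0 ^ 2 + p 1 ^ 2 + p 2 ^ 2 = 1) (hu : p 0 * u 0 + p 1 * u 1 + p 2 * u 2 = 0)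
    (hw : p 0 * w 0 + p 1 * w 1 + p 2 * w 2 = 0) (A : ℝ) (hA : A * (1 - inner ℝ v p) = 2) :
    det2 (A • T u + (A ^ 2 / 2 * inner ℝ v u) • T p) (A • T w + (A ^ 2 / 2 * inner ℝ v w) • T p) =
      - κ * A ^ 2 * det3 p u w := by
  have e : ∀ x y z w' : ℝ, det2 (x • T u + y • T p) (z • T w + w' • T p) =
      x * z * det2 (T u) (T w) + x * w' * det2 (T u) (T p) + y * z * det2 (T p) (T w) := by
    intro x y z w'; simp [det2]; ring
  obtain ⟨c0, c1, c2⟩ := cross_par p u w hp hu hw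
  rw [e, hκ, hκ, hκ]
  simp only [inner3] at *
  set δ := det3 p u w
  set c := v 0 * p 0 + v 1 * p 1 + v 2 * p 2 with hc
  have a1 : det3 v u w = δ * c := by
    unfold det3; rw [hc]; linear_combination v 0 * c0 + v 1 * c1 + v 2 * c2
  have a2 : (v 0 * w 0 + v 1 * w 1 + v 2 * w 2) * det3 v u p + (v 0 * u 0 + v 1 * u 1 + v 2 * u 2) * det3 v p w
      = δ * (c ^ 2 - 1) := by
    have a3 : (v 0 * w 0 + v 1 * w 1 + v 2 * w 2) * det3 v u p + (v 0 * u 0 + v 1 * u 1 + v 2 * u 2) * det3 v p w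
      = c * ((u 1 * w 2 - u 2 * w 1) * v 0 + (u 2 * w 0 - u 0 * w 2) * v 1 + (u 0 * w 1 - u 1 * w 0) * v 2)
      - (v 0 ^ 2 + v 1 ^ 2 + v 2 ^ 2) * ((u 1 * w 2 - u 2 * w 1) * p 0 + (u 2 * w 0 - u 0 * w 2) * p 1 + (u 0 * w 1 - u 1 * w 0) * p 2) := by
      rw [hc]; unfold det3; ring
    rw [a3, c0, c1, c2, hv, hc]
    linear_combination (-δ) * hp
  linear_combination κ * A ^ 2 * a1 + κ * A ^ 3 / 2 * a2 + (-(κ * A ^ 2 * δ * (1 + c) / 2)) * hA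

abbrev S2 := Metric.sphere (0 : E3) 1

instance fact3 : Fact (Module.finrank ℝ E3 = 2 + 1) := ⟨by simp⟩

def SB (v : S2) := (OrthonormalBasis.fromOrthogonalSpanSingleton (𝕜 := ℝ) 2 (ne_zero_of_mem_unit_sphere v))

def Tv (v : S2) : E3 →L[ℝ] ℂ :=
  (Complex.orthonormalBasisOneI.repr.symm.toContinuousLinearEquiv : EuclideanSpace ℝ (Fin 2) →L[ℝ] ℂ) ∘L
    ((SB v).repr.toContinuousLinearEquiv : _ →L[ℝ] EuclideanSpace ℝ (Fin 2)) ∘L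
    (Submodule.span ℝ {(v : E3)})ᗮ.orthogonalProjectionOnto

def PV (v : S2) (p : E3) : ℂ := (2 / (1 - inner ℝ (v : E3) p)) • Tv v p

lemma Tv_self (v : S2) : Tv v v = 0 := by
  simp [Tv, Submodule.orthogonalProjectionOnto_orthogonal_apply_eq_zero, Submodule.mem_span_singleton_self]

lemma Tv_surj (v : S2) (z : ℂ) : ∃ a, Tv v a = z := by
  refine ⟨(((SB v).repr.symm (Complex.orthonormalBasisOneI.repr z) : (Submodule.span ℝ {(v : E3)})ᗮ) : E3), ?_⟩
  simp [Tv]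

lemma Tv_det (v : S2) : ∃ κ : ℝ, κ ≠ 0 ∧ ∀ a b, det2 (Tv v a) (Tv v b) = κ * det3 v a b := by
  obtain ⟨κ, hκ⟩ := T_det (Tv v) v (norm3 _ (norm_eq_of_mem_sphere v)) (Tv_self v)
  refine ⟨κ, ?_, hκ⟩
  rintro rfl
  obtain ⟨a, ha⟩ := Tv_surj v 1
  obtain ⟨b, hb⟩ := Tv_surj v Complex.I
  have := hκ a b
  rw [ha, hb] at this
  simp [det2] at this

lemma PV_eq (v : S2) (p : S2) :
    PV v p = Complex.orthonormalBasisOneI.repr.symm (stereographic' 2 v p) := by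
  simp [PV, stereographic', Tv, stereographic_apply, SB]

lemma PV_inj (v : S2) {p q : E3} (hp : ‖p‖ = 1) (hq : ‖q‖ = 1) (hpv : p ≠ v) (hqv : q ≠ v) (h : PV v p = PV v q) : p = q := by
  have h1 := PV_eq v ⟨p, mem_sphere_zero_iff_norm.mpr hp⟩
  have h2 := PV_eq v ⟨q, mem_sphere_zero_iff_norm.mpr hq⟩
  simp only at h1 h2
  rw [h1, h2] at h
  have h := Complex.orthonormalBasisOneI.repr.symm.injective h
  have := (stereographic' 2 v).injOn (x₁ := ⟨p, mem_sphere_zero_iff_norm.mpr hp⟩) (by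
    rw [stereographic'_source]; intro h; exact hpv (congrArg Subtype.val h)) (x₂ := ⟨q, mem_sphere_zero_iff_norm.mpr hq⟩) (by
    rw [stereographic'_source]; intro h; exact hqv (congrArg Subtype.val h)) h
  exact congrArg Subtype.val this

lemma inner_ne (v : S2) {p : E3} (hp : ‖p‖ = 1) (hpv : p ≠ v) : 1 - inner ℝ (v : E3) p ≠ 0 := by
  intro h
  have h2 : inner ℝ (v : E3) p = 1 := by linarith
  exact hpv ((inner_eq_one_iff_of_norm_eq_one (norm_eq_of_mem_sphere v) hp).mp h2).symm

lemma PV_deriv (v : S2) {f : ℝ → E3} {t : ℝ} (hd : DifferentiableAt ℝ f t) (hp : ‖f t‖ = 1) (hpv : f t ≠ v) :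
    HasDerivAt (fun t => PV v (f t)) ((2 / (1 - inner ℝ (v : E3) (f t))) • Tv v (deriv f t) +
      ((2 / (1 - inner ℝ (v : E3) (f t))) ^ 2 / 2 * inner ℝ (v : E3) (deriv f t)) • Tv v (f t)) t := by
  have h0 := inner_ne v hp hpv
  have h1 : HasDerivAt (fun t => inner ℝ (v : E3) (f t)) (inner ℝ (v : E3) (deriv f t)) t := by
    have := (hasDerivAt_const t (v : E3)).inner ℝ hd.hasDerivAt
    simpa using this
  have h2 := ((Tv v).hasFDerivAt (x := f t)).comp_hasDerivAt t hd.hasDerivAt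
  have h3 : HasDerivAt (fun t => 2 / (1 - inner ℝ (v : E3) (f t))) (2 * inner ℝ (v : E3) (deriv f t) / (1 - inner ℝ (v : E3) (f t)) ^ 2) t := by
    refine ((hasDerivAt_const t (2:ℝ)).div ((hasDerivAt_const t (1:ℝ)).sub h1) h0).congr_deriv ?_
    simp
  refine (h3.smul h2).congr_deriv ?_
  simp only [Function.comp]
  congr 2
  field_simp
  try ring

structure Sph (f : ℝ → E3) : Prop where
  nrm : ∀ t, ‖f t‖ = 1
  per : Function.Periodic f 1
  sm : ContDiff ℝ (⊤ : ℕ∞) f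
  imm : ∀ t, deriv f t ≠ 0

lemma Sph.diff {f : ℝ → E3} (h : Sph f) : Differentiable ℝ f := h.sm.differentiable (by simp)

lemma Sph.perp {f : ℝ → E3} (h : Sph f) (t : ℝ) : f t 0 * deriv f t 0 + f t 1 * deriv f t 1 + f t 2 * deriv f t 2 = 0 := by
  have h1 := (h.diff t).hasDerivAt.inner ℝ (h.diff t).hasDerivAt
  have h2 : (fun t => inner ℝ (f t) (f t)) = fun _ => (1:ℝ) := by
    funext t; rw [real_inner_self_eq_norm_sq, h.nrm]; norm_num
  rw [h2] at h1
  have := h1.unique (hasDerivAt_const t 1)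
  rw [inner3, inner3] at this
  linarith

lemma PV_det (v : S2) : ∃ κ : ℝ, κ ≠ 0 ∧ ∀ (f : ℝ → E3), Sph f → (∀ t, f t ≠ v) → ∀ s t, f s = f t →
    ∃ A > 0, det2 (deriv (fun t => PV v (f t)) s) (deriv (fun t => PV v (f t)) t) =
      κ * A * det3 (f s) (deriv f s) (deriv f t) := by
  obtain ⟨κ, h0, hκ⟩ := Tv_det v
  refine ⟨-κ, neg_ne_zero.mpr h0, fun f hf hv s t hst => ?_⟩
  have hi := inner_ne v (hf.nrm s) (hv s)
  refine ⟨(2 / (1 - inner ℝ (v : E3) (f s))) ^ 2, by positivity, ?_⟩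
  rw [(PV_deriv v (hf.diff s) (hf.nrm s) (hv s)).deriv, (PV_deriv v (hf.diff t) (hf.nrm t) (hv t)).deriv, ← hst]
  rw [det_proj (Tv v) v (norm3 _ (norm_eq_of_mem_sphere v)) κ hκ (f s) (deriv f s) (deriv f t) (norm3 _ (hf.nrm s))
    (hf.perp s) (by rw [hst]; exact hf.perp t)]
  field_simp

lemma PV_imm (v : S2) {f : ℝ → E3} (hf : Sph f) (hv : ∀ t, f t ≠ v) (t : ℝ) : deriv (fun t => PV v (f t)) t ≠ 0 := by
  obtain ⟨κ, h0, hκ⟩ := Tv_det v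
  have hi := inner_ne v (hf.nrm t) (hv t)
  set p := f t with hp
  set u := deriv f t with hu
  let w : E3 := !₂[p 1 * u 2 - p 2 * u 1, p 2 * u 0 - p 0 * u 2, p 0 * u 1 - p 1 * u 0]
  have hpn := norm3 _ (hf.nrm t)
  rw [← hp] at hpn
  have hpu := hf.perp t
  rw [← hp, ← hu] at hpu
  have hd := det_proj (Tv v) v (norm3 _ (norm_eq_of_mem_sphere v)) κ hκ p u w hpn hpu (by simp [w]; ring)
    (2 / (1 - inner ℝ (v : E3) p)) (by field_simp)
  rw [(PV_deriv v (hf.diff t) (hf.nrm t) (hv t)).deriv, ← hp, ← hu]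
  intro h
  rw [h] at hd
  have hw : det3 p u w = u 0 ^ 2 + u 1 ^ 2 + u 2 ^ 2 := by
    simp [det3, w]
    linear_combination (u 0 ^ 2 + u 1 ^ 2 + u 2 ^ 2) * hpn - (p 0 * u 0 + p 1 * u 1 + p 2 * u 2) * hpu
  rw [hw] at hd
  have hA : (2 / (1 - inner ℝ (v : E3) p)) ≠ 0 := by positivity
  have : u 0 ^ 2 + u 1 ^ 2 + u 2 ^ 2 = 0 := by
    simp [det2] at hd
    rcases hd with (h | h) | h
    · exact absurd h h0
    · exact absurd h hi
    · exact h
  apply hf.imm t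
  ext i
  fin_cases i <;> simp <;> nlinarith [sq_nonneg (u 0), sq_nonneg (u 1), sq_nonneg (u 2)]

lemma PV_Imm (v : S2) {f : ℝ → E3} (hf : Sph f) (hv : ∀ t, f t ≠ v) : Imm (fun t => PV v (f t)) := by
  refine Imm.of_curve (fun t => congrArg (PV v) (hf.per t)) ?_ (PV_imm v hf hv)
  unfold PV
  exact (contDiff_const.div (contDiff_const.sub (contDiff_const.inner ℝ hf.sm)) (fun t => inner_ne v (hf.nrm t) (hv t))).smul
    ((Tv v).contDiff.comp hf.sm)

lemma PV_iff (v : S2) {f : ℝ → E3} (hf : Sph f) (hv : ∀ t, f t ≠ v) {s t : ℝ} : PV v (f s) = PV v (f t) ↔ f s = f t :=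
  ⟨fun h => PV_inj v (hf.nrm s) (hf.nrm t) (hv s) (hv t) h, fun h => by rw [h]⟩


lemma crossings_eq {E : Type*} [NormedAddCommGroup E] [NormedSpace ℝ E] {f : ℝ → E}
    (hper : Function.Periodic f 1) (hd : Differentiable ℝ f) (hi : ∀ t, deriv f t ≠ 0)
    (tri : ∀ s t u, s < t → t < u → u < s + 1 → f s = f t → f t = f u → False) {x : ℝ}
    (hx : ∀ t, x < t → t < x + 1 → f t ≠ f x) :
    {p : E | 2 ≤ Set.ncard {r ∈ Ico (0:ℝ) 1 | f r = p}}.ncard =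
      {q : ℝ × ℝ | x < q.1 ∧ q.1 < q.2 ∧ q.2 < x + 1 ∧ f q.1 = f q.2}.ncard := by
  have him : {p : E | 2 ≤ Set.ncard {r ∈ Ico (0:ℝ) 1 | f r = p}} =
      (fun q : ℝ × ℝ => f q.1) '' {q : ℝ × ℝ | x < q.1 ∧ q.1 < q.2 ∧ q.2 < x + 1 ∧ f q.1 = f q.2} := by
    ext p
    constructor
    · intro hp
      rw [mem_ofPred_eq, ncard_shift hper _ x] at hp
      obtain ⟨a, ha, b, hb, hab⟩ := (Set.one_lt_ncard (mult_fin hd hi p x)).mp hp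
      have main : ∀ a b : ℝ, a ∈ {t ∈ Ico x (x + 1) | f t = p} → b ∈ {t ∈ Ico x (x + 1) | f t = p} → a < b →
          ∃ q ∈ {q : ℝ × ℝ | x < q.1 ∧ q.1 < q.2 ∧ q.2 < x + 1 ∧ f q.1 = f q.2}, f q.1 = p := by
        rintro a b ⟨ha, ha'⟩ ⟨hb, hb'⟩ hab
        refine ⟨(a, b), ⟨lt_of_le_of_ne ha.1 ?_, hab, hb.2, ha'.trans hb'.symm⟩, ha'⟩
        rintro rfl
        exact hx b hab hb.2 (hb'.trans ha'.symm)
      rcases lt_or_gt_of_ne hab with h | h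
      · exact main a b ha hb h
      · exact main b a hb ha h
    · rintro ⟨q, ⟨h1, h2, h3, h4⟩, rfl⟩
      exact two_le_mult hper hd hi h2 (by linarith) h4
  rw [him, Set.InjOn.ncard_image]
  rintro ⟨a, b⟩ ⟨h1, h2, h3, h4⟩ ⟨c, d⟩ ⟨k1, k2, k3, k4⟩ h
  simp only at *
  have hac : a = c := by
    rcases lt_trichotomy a c with h' | h' | h'
    · exact (tri a c d h' k2 (by linarith) h k4).elim
    · exact h'
    · exact (tri c a b h' h2 (by linarith) h.symm h4).elim
  subst hac
  rcases lt_trichotomy b d with h' | h' | h'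
  · exact (tri a b d h2 h' (by linarith) h4 (h4.symm.trans k4)).elim
  · rw [h']
  · exact (tri a d b k2 h' (by linarith) k4 (k4.symm.trans h4)).elim

def ChS (f : ℝ → E3) (x : ℝ) : Set (ℝ × ℝ) := {q | x < q.1 ∧ q.1 < q.2 ∧ q.2 < x + 1 ∧ f q.1 = f q.2}
def epsS (f : ℝ → E3) (q : ℝ × ℝ) : ℤ := SignType.sign (det3 (f q.1) (deriv f q.1) (deriv f q.2))
def JvS (f : ℝ → E3) (x : ℝ) : ℤ := JF (epsS f) (toFs (ChS f x))
def BaseS (f : ℝ → E3) (x : ℝ) : Prop := ∀ t, x < t → t < x + 1 → f t ≠ f x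
open Classical in
def JS (f : ℝ → E3) : ℤ := if h : ∃ x, BaseS f x then JvS f h.choose else 0

lemma JF_sgn {e e' : ℝ × ℝ → ℤ} {S : Finset (ℝ × ℝ)} {σ : ℤ} (hσ : σ ^ 2 = 1) (h : ∀ q ∈ S, e q = σ * e' q) :
    JF e S = JF e' S := by
  have h1 : ∑ q ∈ S, e q = σ * ∑ q ∈ S, e' q := by
    rw [Finset.mul_sum]; exact Finset.sum_congr rfl h
  have h2 : Dsum e S S = Dsum e' S S := by
    unfold Dsum
    refine Finset.sum_congr rfl fun q hq => Finset.sum_congr rfl fun r hr => ?_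
    rw [h q hq, h r hr]
    split_ifs
    · linear_combination (e' q * e' r) * hσ
    · rfl
  unfold JF
  rw [h1, h2, mul_pow, hσ, one_mul]

lemma Ch_PV (v : S2) {f : ℝ → E3} (hf : Sph f) (hv : ∀ t, f t ≠ v) (x : ℝ) : Ch (fun t => PV v (f t)) x = ChS f x := by
  ext q
  simp only [Ch, ChS, mem_ofPred_eq, PV_iff v hf hv]

lemma Base_PV (v : S2) {f : ℝ → E3} (hf : Sph f) (hv : ∀ t, f t ≠ v) (x : ℝ) :
    BaseOK (fun t => PV v (f t)) x ↔ BaseS f x := by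
  simp only [BaseOK, BaseS, ne_eq, PV_iff v hf hv]

lemma Jv_PV (v : S2) {f : ℝ → E3} (hf : Sph f) (hv : ∀ t, f t ≠ v) (hfin : ∀ x, (ChS f x).Finite) (x : ℝ) :
    Jv (fun t => PV v (f t)) x = JvS f x := by
  unfold Jv JvS
  rw [Ch_PV v hf hv]
  obtain ⟨κ, h0, hκ⟩ := PV_det v
  apply JF_sgn (σ := SignType.sign κ)
  · rcases lt_or_gt_of_ne h0 with h | h
    · rw [sign_neg h]; rfl
    · rw [sign_pos h]; rfl
  · intro q hq
    rw [mem_toFs (hfin x)] at hq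
    obtain ⟨A, hA, h⟩ := hκ f hf hv q.1 q.2 hq.2.2.2
    unfold eps epsS
    rw [h, sign_mul, sign_mul, sign_pos hA, mul_one]
    simp

lemma JS_eq (v : S2) {f : ℝ → E3} (hf : Sph f) (hv : ∀ t, f t ≠ v) (hs : Stb (fun t => PV v (f t))) :
    JS f = Jinv (fun t => PV v (f t)) := by
  obtain ⟨x, hx⟩ := exists_baseOK hs.toImm (hs.fin 0)
  have h : ∃ x, BaseS f x := ⟨x, (Base_PV v hf hv x).mp hx⟩
  unfold JS
  rw [dif_pos h, ← Jv_PV v hf hv (fun x => by rw [← Ch_PV v hf hv]; exact hs.fin x), Jinv_eq hs]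
  exact (Base_PV v hf hv _).mpr h.choose_spec

lemma JS_eq' (v : S2) {f : ℝ → E3} (hf : Sph f) (hv : ∀ t, f t ≠ v) (hs : Stb (fun t => PV v (f t))) {x : ℝ}
    (hx : BaseS f x) : JS f = JvS f x := by
  rw [JS_eq v hf hv hs, Jinv_eq hs ((Base_PV v hf hv x).mpr hx), Jv_PV v hf hv]
  exact fun x => by rw [← Ch_PV v hf hv]; exact hs.fin x

/-- Working form of spherical stability -/
structure StS (f : ℝ → E3) : Prop extends Sph f where
  fin : ∀ x, (ChS f x).Finite
  tr : ∀ s t, s < t → t < s + 1 → f s = f t → det3 (f s) (deriv f s) (deriv f t) ≠ 0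
  tri : ∀ s t u, s < t → t < u → u < s + 1 → f s = f t → f t = f u → False

lemma trS_of_transverse {f : ℝ → E3} (hf : Sph f) {s t : ℝ} (h1 : s < t) (h2 : t < s + 1) (h : f s = f t)
    (hT : SphericalCurve.TransverseF f (f s)) : det3 (f s) (deriv f s) (deriv f t) ≠ 0 := by
  have := hT (Int.fract s) ⟨Int.fract_nonneg _, Int.fract_lt_one _⟩ (Int.fract t)
    ⟨Int.fract_nonneg _, Int.fract_lt_one _⟩ (fract_ne h1 h2) (per_fract hf.per s) ((per_fract hf.per t).trans h.symm)
  rwa [per_fract (deriv_per hf.per), per_fract (deriv_per hf.per)] at this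

lemma StS.of_stableF {f : ℝ → E3} (hf : Sph f) (h : SphericalCurve.StableF f) : StS f where
  toSph := hf
  fin := ch_fin hf.per hf.diff hf.imm h.1
  tr := fun s t h1 h2 h3 => by
    have h4 := two_le_mult hf.per hf.diff hf.imm h1 h2 h3
    exact trS_of_transverse hf h1 h2 h3 ((h.2 _).2 (le_antisymm (h.2 _).1 h4))
  tri := fun s t u h1 h2 h3 h4 h5 => by
    have h6 := three_le_mult hf.per hf.diff hf.imm h1 h2 h3 h4 h5
    have h7 := (h.2 (f s)).1
    unfold SphericalCurve.multF at h7; omega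

lemma tr_PV (v : S2) {f : ℝ → E3} (hf : Sph f) (hv : ∀ t, f t ≠ v) {s t : ℝ} (h : f s = f t)
    (hd : det3 (f s) (deriv f s) (deriv f t) ≠ 0) :
    det2 (deriv (fun t => PV v (f t)) s) (deriv (fun t => PV v (f t)) t) ≠ 0 := by
  obtain ⟨κ, h0, hκ⟩ := PV_det v
  obtain ⟨A, hA, e⟩ := hκ f hf hv s t h
  rw [e]
  exact mul_ne_zero (mul_ne_zero h0 hA.ne') hd

lemma StS.stb (v : S2) {f : ℝ → E3} (h : StS f) (hv : ∀ t, f t ≠ v) : Stb (fun t => PV v (f t)) where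
  toImm := PV_Imm v h.toSph hv
  fin := fun x => by rw [Ch_PV v h.toSph hv]; exact h.fin x
  tr := fun s t h1 h2 h3 => by
    rw [PV_iff v h.toSph hv] at h3
    exact tr_PV v h.toSph hv h3 (h.tr s t h1 h2 h3)
  tri := fun s t u h1 h2 h3 h4 h5 => by
    rw [PV_iff v h.toSph hv] at h4 h5
    exact h.tri s t u h1 h2 h3 h4 h5

lemma condS_J (v : S2) {f : ℝ → E3} (hf : Sph f) (hv : ∀ t, f t ≠ v) (h : SphericalCurve.JSingF f) :
    Cond (fun t => PV v (f t)) 0 := by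
  obtain ⟨p, hp, -, hq, hfin⟩ := h
  refine cond_zero (PV_Imm v hf hv) (fun x => by rw [Ch_PV v hf hv]; exact ch_fin hf.per hf.diff hf.imm hfin x)
    fun s t u h1 h2 h3 e1 e2 => ?_
  rw [PV_iff v hf hv] at e1 e2
  have h4 := three_le_mult hf.per hf.diff hf.imm h1 h2 h3 e1 e2
  change 3 ≤ SphericalCurve.multF f (f s) at h4
  by_cases h : f s = p
  · rw [h] at h4; omega
  · rcases hq _ h with h5 | ⟨h5, -⟩ <;> omega

lemma condS_S (v : S2) {f : ℝ → E3} (hf : Sph f) (hv : ∀ t, f t ≠ v) (h : SphericalCurve.SSingF f) :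
    Cond (fun t => PV v (f t)) 1 := by
  obtain ⟨p, hp, htr, hq, hfin⟩ := h
  have hne : {t ∈ Ico (0:ℝ) 1 | f t = p}.Nonempty := by
    apply Set.nonempty_of_ncard_ne_zero
    unfold SphericalCurve.multF at hp; omega
  obtain ⟨y, hy, hyp⟩ := hne
  subst hyp
  refine cond_one (PV_Imm v hf hv) (fun x => by rw [Ch_PV v hf hv]; exact ch_fin hf.per hf.diff hf.imm hfin x) y ?_
    (fun s t h1 h2 e1 e2 => ?_) fun z hz => ?_
  · simp only [PV_iff v hf hv]; exact hp
  · rw [PV_iff v hf hv] at e1 e2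
    exact tr_PV v hf hv e1 (trS_of_transverse hf h1 h2 e1 (by rwa [e2]))
  · simp only [ne_eq, PV_iff v hf hv] at hz ⊢
    rcases hq _ hz with h5 | ⟨h5, -⟩ <;> unfold SphericalCurve.multF at h5 <;> omega

lemma exists_off {f : ℝ → E3} (hf : Sph f) : ∃ v : S2, ∀ t, f t ≠ v := by
  have hd : ContDiff ℝ 1 (fun q : ℝ × ℝ => q.1 • f q.2) :=
    contDiff_fst.smul ((hf.sm.of_le (by exact_mod_cast le_top)).comp contDiff_snd)
  have := hd.dense_compl_range_of_finrank_lt_finrank (by simp)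
  obtain ⟨w, hw⟩ := this.nonempty
  have hw0 : w ≠ 0 := by
    rintro rfl
    exact hw ⟨(0, 0), by simp⟩
  refine ⟨⟨‖w‖⁻¹ • w, by simp [norm_smul, hw0]⟩, fun t ht => hw ⟨(‖w‖, t), ?_⟩⟩
  simp only [ht, smul_smul]
  rw [mul_inv_cancel₀ (norm_ne_zero_iff.mpr hw0), one_smul]


lemma sph_local {f g : ℝ → E3} {H : ℝ → ℝ → E3} (hH : SphericalCurve.IsRegHomotopy f g H) (hS : ∀ s, Sph (H s)) {s0 : ℝ}
    {k : ℤ} (hc : ∀ v : S2, (∀ t, H s0 t ≠ v) → Cond (fun t => PV v (H s0 t)) k) :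
    LocBd (fun s => JS (H s)) (fun s => StS (H s)) k s0 := by
  obtain ⟨v, hv⟩ := exists_off (hS s0)
  have h1 : ∀ᶠ s in nhds s0, ∀ t ∈ Icc (0:ℝ) 1, H s t ≠ v := by
    apply isCompact_Icc.eventually_forall_of_forall_eventually
    intro t _
    exact hH.1.continuousAt.eventually_ne (hv t)
  obtain ⟨δ0, hδ0, hb⟩ := Metric.eventually_nhds_iff.mp h1
  set δ := δ0 / 2 with hδ
  have hδp : 0 < δ := by positivity
  let cl : ℝ → ℝ := fun s => max (s0 - δ) (min s (s0 + δ))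
  have hcl : Continuous cl := by fun_prop
  have hoff : ∀ s t, H (cl s) t ≠ v := by
    intro s t
    rw [← per_fract (hS (cl s)).per t]
    refine hb ?_ _ ⟨Int.fract_nonneg _, (Int.fract_lt_one _).le⟩
    rw [Real.dist_eq, abs_lt]
    have a1 : s0 - δ ≤ cl s := le_max_left _ _
    have a2 : cl s ≤ s0 + δ := max_le (by linarith) (min_le_right _ _)
    constructor <;> linarith
  have hid : ∀ s, |s - s0| ≤ δ → cl s = s := by
    intro s hs
    rw [abs_le] at hs
    simp only [cl]
    rw [min_eq_left (by linarith), max_eq_right (by linarith)]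
  have cH : Continuous fun q : ℝ × ℝ => H (cl q.1) q.2 := hH.1.comp ((hcl.comp continuous_fst).prodMk continuous_snd)
  have cD : Continuous fun q : ℝ × ℝ => deriv (H (cl q.1)) q.2 :=
    hH.2.1.comp ((hcl.comp continuous_fst).prodMk continuous_snd)
  have cA : Continuous fun q : ℝ × ℝ => 2 / (1 - inner ℝ (v : E3) (H (cl q.1) q.2)) :=
    continuous_const.div (continuous_const.sub (continuous_const.inner cH))
      fun q => inner_ne v ((hS _).nrm _) (hoff _ _)
  have hG : Hmt (fun s t => PV v (H (cl s) t)) := by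
    refine ⟨?_, ?_, fun s => PV_Imm v (hS _) (hoff s)⟩
    · exact cA.smul ((Tv v).continuous.comp cH)
    · have : (fun q : ℝ × ℝ => deriv (fun t => PV v (H (cl q.1) t)) q.2) = fun q : ℝ × ℝ =>
          (2 / (1 - inner ℝ (v : E3) (H (cl q.1) q.2))) • Tv v (deriv (H (cl q.1)) q.2) +
          ((2 / (1 - inner ℝ (v : E3) (H (cl q.1) q.2))) ^ 2 / 2 * inner ℝ (v : E3) (deriv (H (cl q.1)) q.2)) •
            Tv v (H (cl q.1) q.2) := by
        funext q
        exact (PV_deriv v ((hS _).diff _) ((hS _).nrm _) (hoff _ _)).deriv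
      rw [this]
      exact (cA.smul ((Tv v).continuous.comp cD)).add
        ((((cA.pow 2).div_const 2).mul (continuous_const.inner cD)).smul ((Tv v).continuous.comp cH))
  have e0 : cl s0 = s0 := hid s0 (by simpa using hδp.le)
  obtain ⟨U, hU, hU'⟩ := local_cond hG (s0 := s0) (k := k) (by
    simp only [e0]; exact hc v hv)
  refine ⟨U ∩ Metric.ball s0 δ, Filter.inter_mem hU (Metric.ball_mem_nhds _ hδp), fun s1 h1 s2 h2 k1 k2 => ?_⟩
  have i1 := hid s1 (by have := h1.2; rw [Metric.mem_ball, Real.dist_eq] at this; exact this.le)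
  have i2 := hid s2 (by have := h2.2; rw [Metric.mem_ball, Real.dist_eq] at this; exact this.le)
  have o1 := hoff s1
  have o2 := hoff s2
  have := hU' s1 h1.1 s2 h2.1
  simp only [i1, i2] at this o1 o2
  simp only [JS_eq v (hS s1) o1 (k1.stb v o1), JS_eq v (hS s2) o2 (k2.stb v o2)]
  exact this (k1.stb v o1) (k2.stb v o2)

lemma Sph.of_reg {f g : ℝ → E3} {H : ℝ → ℝ → E3} (h : SphericalCurve.IsRegHomotopy f g H) (s : ℝ) : Sph (H s) :=
  ⟨h.2.2.1 s, h.2.2.2.1 s, h.2.2.2.2.1 s, h.2.2.2.2.2.1 s⟩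

lemma sph_loc0 {f g : ℝ → E3} {H : ℝ → ℝ → E3} (hH : SphericalCurve.IsRegHomotopy f g H) (s : ℝ)
    (h : SphericalCurve.StableF (H s)) : StS (H s) ∧ LocBd (fun s => JS (H s)) (fun s => StS (H s)) 0 s := by
  have hst := StS.of_stableF (Sph.of_reg hH s) h
  exact ⟨hst, sph_local hH (Sph.of_reg hH) fun v hv => (hst.stb v hv).cond⟩

lemma sph_stab {c c' : SphericalCurve} (h : SphericalCurve.StablyHomotopic c c') : JS c.toFun = JS c'.toFun := by
  obtain ⟨H, hH, hs⟩ := h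
  have := path_const (J := fun s => JS (H s)) (St := fun s => StS (H s)) zero_le_one (fun s hs' =>
    sph_loc0 hH s (hs s hs'))
  rwa [hH.2.2.2.2.2.2.1, hH.2.2.2.2.2.2.2] at this

lemma sph_move {c c' : SphericalCurve} (h : SphericalCurve.BasicMove c c') : |JS c.toFun - JS c'.toFun| ≤ 4 := by
  have main : ∀ H, SphericalCurve.IsRegHomotopy c.toFun c'.toFun H → ∀ s0 ∈ Ioo (0:ℝ) 1,
    (∀ s ∈ Set.Icc (0:ℝ) 1, s ≠ s0 → SphericalCurve.StableF (H s)) →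
      (∀ v : S2, (∀ t, H s0 t ≠ v) → Cond (fun t => PV v (H s0 t)) 1) →
      |JS c.toFun - JS c'.toFun| ≤ 4 := by
    intro H hH s0 hs0 hs hc
    have := path_jump (J := fun s => JS (H s)) (St := fun s => StS (H s)) hs0 (fun s hs' hne =>
      sph_loc0 hH s (hs s hs' hne)) (sph_local hH (Sph.of_reg hH) hc)
    rwa [hH.2.2.2.2.2.2.1, hH.2.2.2.2.2.2.2] at this
  rcases h with ⟨-, -, H, hH, s0, hs0, hs, hsing⟩ | ⟨-, -, H, hH, s0, hs0, hs, hsing⟩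
  · refine main H hH s0 hs0 hs fun v hv => ?_
    obtain ⟨x, Q, a, b, c, d⟩ := condS_J v (Sph.of_reg hH s0) hv hsing
    exact ⟨x, Q, a, b, c, d.trans zero_le_one⟩
  · exact main H hH s0 hs0 hs fun v hv => condS_S v (Sph.of_reg hH s0) hv hsing

lemma sph_dist {c c' : SphericalCurve} {k : ℕ} {seq : ℕ → SphericalCurve} (h : SphericalCurve.ChainFromTo c c' seq k) :
    |JS c.toFun - JS c'.toFun| ≤ 4 * k := by
  obtain ⟨h0, hk, hm⟩ := h
  rw [sph_stab h0, ← hk]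
  clear hk h0
  induction k with
  | zero => simp
  | succ k ih =>
    have h1 := ih (fun i hi => hm i (by omega))
    have h2 := sph_move (hm k (by omega))
    have := abs_sub_le (JS (seq 0).toFun) (JS (seq k).toFun) (JS (seq (k+1)).toFun)
    push_cast
    linarith


def qi (f : ℝ → ℂ) (s t : ℝ) : ℂ := ∫ v in (0:ℝ)..1, deriv f (s + (t - s) * v)

def Kf (f : ℝ → ℂ) (s t : ℝ) : ℂ := qi f s t - qi f (s + 1) t

lemma qi_cont {f : ℝ → ℂ} (hf : Imm f) : Continuous fun p : ℝ × ℝ => qi f p.1 p.2 := by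
  unfold qi
  have := hf.dcont
  apply intervalIntegral.continuous_parametric_intervalIntegral_of_continuous'
  exact this.comp (by fun_prop)

lemma qi_mul {f : ℝ → ℂ} (hf : Imm f) (s t : ℝ) : (t - s) • qi f s t = f t - f s := by
  unfold qi
  rw [intervalIntegral.smul_integral_comp_add_mul]
  rw [intervalIntegral.integral_deriv_eq_sub (fun x _ => hf.diff x) (hf.dcont.intervalIntegrable _ _)]
  simp

lemma qi_self (f : ℝ → ℂ) (s : ℝ) : qi f s s = deriv f s := by simp [qi]

lemma Kf_cont {f : ℝ → ℂ} (hf : Imm f) : Continuous fun p : ℝ × ℝ => Kf f p.1 p.2 := by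
  have h := qi_cont hf
  exact h.sub (h.comp (f := fun p : ℝ × ℝ => (p.1 + 1, p.2)) (by fun_prop))

lemma Kf_self {f : ℝ → ℂ} (hf : Imm f) (s : ℝ) : Kf f s s = deriv f s := by
  have := qi_mul hf (s + 1) s
  rw [hf.per s] at this
  simp at this
  rw [Kf, qi_self, this, sub_zero]

lemma Kf_one {f : ℝ → ℂ} (hf : Imm f) (s : ℝ) : Kf f s (s + 1) = - deriv f s := by
  have := qi_mul hf s (s + 1)
  rw [hf.per s] at this
  simp at this
  rw [Kf, qi_self, this, zero_sub, deriv_per hf.per]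

lemma Kf_eq {f : ℝ → ℂ} (hf : Imm f) {s t : ℝ} (h1 : s < t) (h2 : t < s + 1) :
    Kf f s t = ((t - s) * (1 - (t - s)))⁻¹ • (f t - f s) := by
  have a := qi_mul hf s t
  have b := qi_mul hf (s + 1) t
  rw [hf.per s, ← a] at b
  have e1 : t - s ≠ 0 := by linarith
  have e2 : 1 - (t - s) ≠ 0 := by linarith
  have e3 : t - (s + 1) = - (1 - (t - s)) := by ring
  rw [e3] at b
  rw [Kf, ← a, smul_smul]
  have : qi f (s + 1) t = - ((1 - (t - s))⁻¹ • (t - s) • qi f s t) := by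
    rw [← b, smul_smul]; field_simp; simp
  rw [this, smul_smul, sub_neg_eq_add]
  nth_rewrite 1 [← one_smul ℝ (qi f s t)]
  rw [← add_smul]
  congr 1
  field_simp
  ring

lemma linAt_of_fderiv {F : ℝ → ℝ → ℂ} {z : ℝ × ℝ} {L : ℝ × ℝ →L[ℝ] ℂ} (h : HasFDerivAt (fun p : ℝ × ℝ => F p.1 p.2) L z)
    (h0 : F z.1 z.2 = 0) : LinAt F z (L (1, 0)) (L (0, 1)) := by
  intro ε hε
  have := (hasFDerivAt_iff_isLittleO.mp h).def hε
  obtain ⟨r, hr, hr'⟩ := Metric.eventually_nhds_iff.mp this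
  refine ⟨r / 2, by positivity, fun x y hx hy => ?_⟩
  have := hr' (y := (x, y)) (by
    rw [Prod.dist_eq, Real.dist_eq, Real.dist_eq]
    exact lt_of_le_of_lt (max_le hx hy) (by linarith))
  have e : L ((x, y) - z) = (x - z.1) • L (1, 0) + (y - z.2) • L (0, 1) := by
    rw [← map_smul, ← map_smul, ← map_add]; congr 1; ext <;> simp
  rw [h0, e, sub_zero] at this
  refine this.trans (mul_le_mul_of_nonneg_left ?_ hε.le)
  rw [Prod.norm_def]
  simp only [Prod.fst_sub, Prod.snd_sub, Real.norm_eq_abs]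
  exact max_le (by linarith [abs_nonneg (y - z.2)]) (by linarith [abs_nonneg (x - z.1)])

lemma G_lin {f : ℝ → ℂ} (hf : Imm f) {x : ℝ} {z : ℝ × ℝ} (h1 : z.1 < z.1 + z.2 * (x + 1 - z.1))
    (h2 : z.1 + z.2 * (x + 1 - z.1) < z.1 + 1) (h : f z.1 = f (z.1 + z.2 * (x + 1 - z.1))) :
    ∃ ψ : ℝ, 0 < ψ ∧ LinAt (fun s u => Kf f s (s + u * (x + 1 - s))) z
      (ψ • ((1 - z.2) • deriv f (z.1 + z.2 * (x + 1 - z.1)) - deriv f z.1))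
      (ψ • (x + 1 - z.1) • deriv f (z.1 + z.2 * (x + 1 - z.1))) := by
  set t0 := z.1 + z.2 * (x + 1 - z.1) with ht0
  let ψ : ℝ × ℝ → ℝ := fun p => ((p.2 * (x + 1 - p.1)) * (1 - p.2 * (x + 1 - p.1)))⁻¹
  have hne : (z.2 * (x + 1 - z.1)) * (1 - z.2 * (x + 1 - z.1)) > 0 :=
    mul_pos (by linarith) (by linarith)
  have hψ : DifferentiableAt ℝ ψ z := by
    apply DifferentiableAt.inv
    · fun_prop
    · exact hne.ne'
  have hs : HasFDerivAt (fun p : ℝ × ℝ => p.1) (ContinuousLinearMap.fst ℝ ℝ ℝ) z := hasFDerivAt_fst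
  have hu : HasFDerivAt (fun p : ℝ × ℝ => p.2) (ContinuousLinearMap.snd ℝ ℝ ℝ) z := hasFDerivAt_snd
  have ht := hs.add (hu.mul ((hasFDerivAt_const (x + 1) z).sub hs))
  have hD := ((hf.diff t0).hasFDerivAt.comp z ht).sub ((hf.diff z.1).hasFDerivAt.comp z hs)
  have hG := hψ.hasFDerivAt.smul hD
  have hz : (f ∘ ((fun p : ℝ × ℝ => p.1) + (fun p : ℝ × ℝ => p.2) * ((fun _ => x + 1) - fun p : ℝ × ℝ => p.1)) - f ∘ Prod.fst : ℝ × ℝ → ℂ) z = 0 := by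
    change f t0 - f z.1 = 0
    rw [h, sub_self]
  rw [hz] at hG
  refine ⟨ψ z, inv_pos.mpr hne, ?_⟩
  have hev : (fun p : ℝ × ℝ => Kf f p.1 (p.1 + p.2 * (x + 1 - p.1))) =ᶠ[nhds z]
      (fun p => ψ p • (f (p.1 + p.2 * (x + 1 - p.1)) - f p.1)) := by
    have c1 : Continuous fun p : ℝ × ℝ => p.1 + p.2 * (x + 1 - p.1) := by fun_prop
    filter_upwards [(continuous_fst.tendsto z).eventually_lt (c1.tendsto z) h1,
      (c1.tendsto z).eventually_lt ((continuous_fst.add continuous_const).tendsto z) h2] with p p1 p2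
    rw [Kf_eq hf p1 p2]
    simp [ψ]
  have hG2 := hG.congr_of_eventuallyEq (f₁ := fun p : ℝ × ℝ => Kf f p.1 (p.1 + p.2 * (x + 1 - p.1))) hev
  have := linAt_of_fderiv (F := fun s u => Kf f s (s + u * (x + 1 - s))) hG2 (by
    rw [Kf_eq hf h1 h2, ← h]; simp)
  convert this using 1
  · simp [fderiv_eq_smul_deriv]
    left; ring
  · simp [fderiv_eq_smul_deriv]


lemma V_upper {g : ℝ → ℂ} {a b α : ℝ} {σ : ℂ} (hσ : σ = Complex.I ∨ σ = -Complex.I) (hα : α ≠ 0) (hab : a ≤ b)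
    (hg : ContinuousOn g (Icc a b)) (h0 : ∀ y ∈ Icc a b, g y ≠ 0) (him : ∀ y ∈ Icc a b, 0 ≤ (g y / σ).re)
    (ha : g a / σ = - (α * Complex.I)) (hb : g b / σ = α * Complex.I) :
    V g a b = Real.pi * Complex.I * ((SignType.sign α : ℤ) : ℂ) := by
  have hσ0 : σ ≠ 0 := by rcases hσ with rfl | rfl <;> simp
  rw [V_slit hσ0 hab hg, ha, hb]
  · rcases lt_or_gt_of_ne hα with h | h
    · have e1 : (α : ℂ) * Complex.I = ((-α : ℝ) : ℂ) * (-Complex.I) := by push_cast; ring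
      have e2 : -((α : ℂ) * Complex.I) = ((-α : ℝ) : ℂ) * Complex.I := by push_cast; ring
      rw [e2, e1, Complex.log_ofReal_mul (by linarith) (by simp), Complex.log_ofReal_mul (by linarith) (by simp),
        Complex.log_I, Complex.log_neg_I, sign_neg h]
      simp; ring
    · have e2 : -((α : ℂ) * Complex.I) = α * (-Complex.I) := by ring
      rw [e2, Complex.log_ofReal_mul h (by simp), Complex.log_ofReal_mul h (by simp),
        Complex.log_I, Complex.log_neg_I, sign_pos h]
      simp; ring
  · intro y hy
    rw [Complex.mem_slitPlane_iff]
    by_contra hc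
    push Not at hc
    apply div_ne_zero (h0 y hy) hσ0
    apply Complex.ext
    · exact le_antisymm hc.1 (him y hy)
    · exact hc.2

lemma theta_shift {f : ℝ → ℂ} (hf : Imm f) {θ : ℝ → ℝ} (hθ : Continuous θ)
    (h : ∀ t, deriv f t = (‖deriv f t‖ : ℂ) * Complex.exp ((θ t : ℂ) * Complex.I)) (x : ℝ) :
    V (deriv f) x (x + 1) = ((θ 1 - θ 0 : ℝ) : ℂ) * Complex.I := by
  have hn : ∀ t, (‖deriv f t‖ : ℂ) ≠ 0 := fun t => by exact_mod_cast norm_ne_zero_iff.mpr (hf.imm t)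
  rw [V_eq (L := fun t => ((Real.log ‖deriv f t‖ : ℝ) : ℂ) + θ t * Complex.I) (by linarith)]
  · have := clog_diff_const (S := univ) isPreconnected_univ (L := fun t => (θ (t + 1) : ℂ) * Complex.I)
      (M := fun t => (θ t : ℂ) * Complex.I) (by fun_prop) (by fun_prop) (fun t _ => by
        have h1 := h (t + 1)
        rw [deriv_per hf.per, h t] at h1
        have h2 := h1
        rw [norm_mul, Complex.norm_exp_ofReal_mul_I] at h2
        simp only [Complex.norm_real, norm_norm, mul_one] at h2
        exact (mul_left_cancel₀ (hn t) h2).symm) (mem_univ 0) (mem_univ x)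
    simp only [deriv_per hf.per x, zero_add] at this ⊢
    push_cast
    linear_combination this
  · apply Continuous.continuousOn
    have := hf.dcont.norm.log (fun t => norm_ne_zero_iff.mpr (hf.imm t))
    fun_prop
  · intro t _
    rw [Complex.exp_add, ← Complex.ofReal_exp, Real.exp_log (norm_pos_iff.mpr (hf.imm t)), ← h t]

lemma exists_min {f : ℝ → ℂ} (hf : Stb f) : ∃ x, (∀ t, (f x).im ≤ (f t).im) ∧ (deriv f x).im = 0 ∧ BaseOK f x := by
  obtain ⟨x, hx, hmin⟩ := isCompact_Icc.exists_isMinOn (nonempty_Icc.mpr (zero_le_one' ℝ))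
    (Complex.continuous_im.comp hf.cont).continuousOn
  have h1 : ∀ t, (f x).im ≤ (f t).im := fun t => by
    rw [← per_fract hf.per t]
    exact hmin ⟨Int.fract_nonneg _, (Int.fract_lt_one _).le⟩
  have hder : ∀ y, (∀ t, (f y).im ≤ (f t).im) → (deriv f y).im = 0 := by
    intro y hy
    have hl : IsLocalMin (fun t => (f t).im) y := Filter.Eventually.of_forall hy
    have hd : HasDerivAt (fun t => (f t).im) (deriv f y).im y :=
      (Complex.imCLM.hasFDerivAt (x := f y)).comp_hasDerivAt y (hf.diff y).hasDerivAt
    exact hl.hasDerivAt_eq_zero hd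
  refine ⟨x, h1, hder x h1, fun t t1 t2 ht => ?_⟩
  apply hf.tr x t t1 t2 ht.symm
  have := hder t (fun s => by rw [ht]; exact h1 s)
  simp [det2, this, hder x h1]

lemma whitney_sum {f : ℝ → ℂ} (hf : Stb f) {θ : ℝ → ℝ} (hθ : Continuous θ)
    (h : ∀ t, deriv f t = (‖deriv f t‖ : ℂ) * Complex.exp ((θ t : ℂ) * Complex.I)) {ω : ℤ}
    (hω : θ 1 - θ 0 = 2 * Real.pi * ω) :
    ∃ x, BaseOK f x ∧ (∑ q ∈ toFs (Ch f x), eps f q = 1 - ω ∨ ∑ q ∈ toFs (Ch f x), eps f q = -1 - ω) := by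
  classical
  obtain ⟨x, hmin, him, hbase⟩ := exists_min hf
  refine ⟨x, hbase, ?_⟩
  have hi := hf.toImm
  set α := (deriv f x).re with hα
  have hfx : deriv f x = α := by apply Complex.ext <;> simp [hα, him]
  have hα0 : α ≠ 0 := fun h0 => hi.imm x (by rw [hfx, h0]; simp)
  let T : ℝ → ℝ → ℝ := fun s u => s + u * (x + 1 - s)
  let G : ℝ → ℝ → ℂ := fun s u => Kf f s (s + u * (x + 1 - s))
  have hGc : Continuous fun q : ℝ × ℝ => G q.1 q.2 :=
    (Kf_cont hi).comp (f := fun q : ℝ × ℝ => (q.1, q.1 + q.2 * (x + 1 - q.1))) (by fun_prop)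
  let Z := (toFs (Ch f x)).image (fun q => (q.1, (q.2 - q.1) / (x + 1 - q.1)))
  have hZq : ∀ z ∈ Z, (z.1, T z.1 z.2) ∈ Ch f x := by
    intro z hz
    obtain ⟨q, hq, rfl⟩ := Finset.mem_image.mp hz
    rw [mem_toFs (hf.fin x)] at hq
    obtain ⟨q1, q2, q3, q4⟩ := hq
    have e : T q.1 ((q.2 - q.1) / (x + 1 - q.1)) = q.2 := by
      simp only [T]; rw [div_mul_cancel₀ _ (by linarith)]; ring
    simp only [e]
    exact ⟨q1, q2, q3, q4⟩
  have hlin : ∀ z ∈ Z, ∃ ψ : ℝ, 0 < ψ ∧ LinAt G z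
      (ψ • ((1 - z.2) • deriv f (T z.1 z.2) - deriv f z.1))
      (ψ • (x + 1 - z.1) • deriv f (T z.1 z.2)) := by
    intro z hz
    obtain ⟨h1, h2, h3, h4⟩ := hZq z hz
    simp only at h1 h2 h3 h4
    exact G_lin hi (x := x) h2 (by simp only [T] at h3; linarith) h4
  choose! ψ hψ hl using hlin
  have hdet : ∀ z ∈ Z, det2 (ψ z • ((1 - z.2) • deriv f (T z.1 z.2) - deriv f z.1))
      (ψ z • (x + 1 - z.1) • deriv f (T z.1 z.2)) =
      (-(ψ z ^ 2 * (x + 1 - z.1))) * det2 (deriv f z.1) (deriv f (T z.1 z.2)) := by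
    intro z hz
    simp [det2]; ring
  have hneg : ∀ z ∈ Z, -(ψ z ^ 2 * (x + 1 - z.1)) < 0 := by
    intro z hz
    obtain ⟨h1, h2, h3, h4⟩ := hZq z hz
    simp only at h1 h2 h3 h4
    have := hψ z hz
    have : 0 < x + 1 - z.1 := by linarith
    have : 0 < ψ z ^ 2 * (x + 1 - z.1) := by positivity
    linarith
  -- nonvanishing and values
  have hzero : ∀ s ∈ Icc x (x + 1), ∀ u ∈ Icc (0:ℝ) 1, G s u = 0 → (s, u) ∈ Z := by
    intro s hs u hu h0
    have t1 : s ≤ T s u := by simp only [T]; nlinarith [hs.2, hu.1]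
    have t2 : T s u ≤ x + 1 := by simp only [T]; nlinarith [hs.2, hu.2]
    change Kf f s (T s u) = 0 at h0
    rcases t1.eq_or_lt with e | t1
    · rw [← e, Kf_self hi] at h0; exact absurd h0 (hi.imm s)
    rcases (show T s u ≤ s + 1 by linarith [hs.1]).eq_or_lt with e | t3
    · rw [e, Kf_one hi, neg_eq_zero] at h0; exact absurd h0 (hi.imm s)
    rw [Kf_eq hi t1 t3] at h0
    have hne : ((T s u - s) * (1 - (T s u - s)))⁻¹ ≠ 0 :=
      inv_ne_zero (mul_ne_zero (by linarith) (by linarith))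
    have hst : f s = f (T s u) := (sub_eq_zero.mp ((smul_eq_zero.mp h0).resolve_left hne)).symm
    have hs1 : x < s := by
      rcases hs.1.eq_or_lt with e | e
      · subst e; exact absurd hst.symm (hbase _ t1 t3)
      · exact e
    have ht2 : T s u < x + 1 := by
      rcases t2.eq_or_lt with e | e
      · rw [e, hf.per] at hst; exact absurd hst (hbase s hs1 (by linarith))
      · exact e
    refine Finset.mem_image.mpr ⟨(s, T s u), (mem_toFs (hf.fin x) _).mpr ⟨hs1, t1, ht2, hst⟩, ?_⟩
    simp only [T, Prod.mk.injEq, true_and]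
    have : x + 1 - s ≠ 0 := by
      have : s < x + 1 := by linarith
      exact (by linarith : (0:ℝ) < x + 1 - s).ne'
    field_simp; ring
  have hmem : ∀ z ∈ Z, z.1 ∈ Ioo x (x + 1) ∧ z.2 ∈ Ioo (0:ℝ) 1 := by
    intro z hz
    obtain ⟨h1, h2, h3, h4⟩ := hZq z hz
    simp only [T] at h1 h2 h3 h4
    have : 0 < x + 1 - z.1 := by linarith
    refine ⟨⟨h1, by linarith⟩, ?_, ?_⟩
    · by_contra hc; push Not at hc; nlinarith
    · by_contra hc; push Not at hc; nlinarith
  have hDL := DL (by linarith : x ≤ x + 1) zero_le_one Z _ _ hGc.continuousOn hmem hzero (fun z hz => ⟨hl z hz, by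
    rw [hdet z hz]
    obtain ⟨h1, h2, h3, h4⟩ := hZq z hz
    exact mul_ne_zero (hneg z hz).ne (hf.tr _ _ h2 (by simp only at *; linarith) h4)⟩)
  have hsum : ∑ z ∈ Z, (SignType.sign (det2 (ψ z • ((1 - z.2) • deriv f (T z.1 z.2) - deriv f z.1))
      (ψ z • (x + 1 - z.1) • deriv f (T z.1 z.2))) : ℤ) = - ∑ q ∈ toFs (Ch f x), eps f q := by
    have : ∀ z ∈ Z, (SignType.sign (det2 (ψ z • ((1 - z.2) • deriv f (T z.1 z.2) - deriv f z.1))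
      (ψ z • (x + 1 - z.1) • deriv f (T z.1 z.2))) : ℤ) = - eps f (z.1, T z.1 z.2) := by
      intro z hz
      rw [hdet z hz, sign_mul, sign_neg (hneg z hz)]
      simp [eps]
    rw [Finset.sum_congr rfl this, Finset.sum_neg_distrib]
    congr 1
    have hT : ∀ q ∈ toFs (Ch f x), T q.1 ((q.2 - q.1) / (x + 1 - q.1)) = q.2 := by
      intro q hq
      rw [mem_toFs (hf.fin x)] at hq
      obtain ⟨q1, q2, q3, q4⟩ := hq
      simp only [T]; rw [div_mul_cancel₀ _ (by linarith)]; ring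
    rw [Finset.sum_image]
    · refine Finset.sum_congr rfl fun q hq => ?_
      simp only [hT q hq]
    · intro q hq r hr hqr
      simp only [Prod.mk.injEq] at hqr
      have a := hT q hq
      rw [hqr.2, hqr.1, hT r hr] at a
      exact Prod.ext hqr.1 a.symm
  rw [hsum] at hDL
  -- sides
  have hnz : ∀ s ∈ Icc x (x + 1), ∀ u ∈ Icc (0:ℝ) 1, (s = x ∨ u = 1) → G s u ≠ 0 := by
    intro s hs u hu hsu h0
    have := hmem _ (hzero s hs u hu h0)
    simp only [mem_Ioo] at this
    rcases hsu with e | e <;> linarith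
  have hxI : x ∈ Icc x (x + 1) := ⟨le_rfl, by linarith⟩
  have s1 : V (fun s => G s 0) x (x + 1) = ((θ 1 - θ 0 : ℝ) : ℂ) * Complex.I := by
    rw [← theta_shift hi hθ h x]
    congr 1
    funext s
    simp only [G]
    rw [zero_mul, add_zero, Kf_self hi]
  have s2 : V (G (x + 1)) 0 1 = 0 := by
    have : G (x + 1) = fun _ => deriv f x := by
      funext u
      simp only [G]
      rw [sub_self, mul_zero, add_zero, Kf_self hi, deriv_per hi.per]
    rw [this, V_eq (L := fun _ => Complex.log (deriv f x)) zero_le_one continuousOn_const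
      (fun _ _ => Complex.exp_log (hi.imm x)), sub_self]
  have s3 : V (fun s => G s 1) x (x + 1) = Real.pi * Complex.I * ((SignType.sign α : ℤ) : ℂ) := by
    have e : ∀ s, G s 1 = Kf f s (x + 1) := fun s => by simp only [G]; congr 1; ring
    refine V_upper (σ := -Complex.I) (Or.inr rfl) hα0 (by linarith) (Continuous.continuousOn ?_)
      (fun s hs => hnz s hs 1 ⟨zero_le_one, le_rfl⟩ (Or.inr rfl)) (fun s hs => ?_) ?_ ?_
    · exact hGc.comp (f := fun s : ℝ => (s, (1:ℝ))) (by fun_prop)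
    · rw [e]
      rcases hs.1.eq_or_lt with e | h1
      · rw [← e, Kf_one hi, hfx]; simp
      rcases hs.2.eq_or_lt with e | h2
      · rw [e, Kf_self hi, deriv_per hi.per, hfx]; simp [div_neg, Complex.div_I]
      rw [Kf_eq hi h2 (by linarith), hf.per]
      have : 0 < ((x + 1 - s) * (1 - (x + 1 - s)))⁻¹ := inv_pos.mpr (mul_pos (by linarith) (by linarith))
      simp only [Complex.div_I, neg_neg, Complex.mul_re, Complex.smul_re, Complex.smul_im,
        Complex.sub_im, Complex.I_re, Complex.I_im, smul_eq_mul, mul_zero, mul_one, zero_sub, div_neg]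
      rw [← mul_neg]
      exact mul_nonneg this.le (by linarith [hmin s])
    · rw [e, Kf_one hi, hfx]; simp [div_neg, Complex.div_I]
    · rw [e, Kf_self hi, deriv_per hi.per, hfx]; simp [div_neg, Complex.div_I]
  have s4 : V (G x) 0 1 = Real.pi * Complex.I * ((SignType.sign α : ℤ) : ℂ) := by
    have e : ∀ u, G x u = Kf f x (x + u) := fun s => by simp only [G]; congr 1; ring
    refine V_upper (σ := Complex.I) (Or.inl rfl) hα0 zero_le_one (Continuous.continuousOn ?_)
      (fun u hu => hnz x hxI u hu (Or.inl rfl)) (fun u hu => ?_) ?_ ?_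
    · exact hGc.comp (f := fun u : ℝ => (x, u)) (by fun_prop)
    · rw [e]
      rcases hu.1.eq_or_lt with e | h1
      · rw [← e, add_zero, Kf_self hi, hfx]; simp
      rcases hu.2.eq_or_lt with e | h2
      · rw [e, Kf_one hi, hfx]; simp
      rw [Kf_eq hi (by linarith) (by linarith)]
      have : 0 < ((x + u - x) * (1 - (x + u - x)))⁻¹ := inv_pos.mpr (mul_pos (by linarith) (by linarith))
      simp only [Complex.div_I, Complex.neg_re, Complex.mul_re, Complex.smul_re, Complex.smul_im,
        Complex.sub_im, Complex.I_re, Complex.I_im, smul_eq_mul, mul_zero, mul_one, zero_sub, neg_neg]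
      exact mul_nonneg this.le (by linarith [hmin (x + u)])
    · rw [e, add_zero, Kf_self hi, hfx]; simp [Complex.div_I]
    · rw [e, Kf_one hi, hfx]; simp [Complex.div_I]
  unfold bdry at hDL
  rw [s1, s2, s3, s4, hω] at hDL
  have hpi : (2 * Real.pi * Complex.I : ℂ) ≠ 0 := Complex.two_pi_I_ne_zero
  have key : ((ω : ℂ) - ((SignType.sign α : ℤ) : ℂ)) = ((-∑ q ∈ toFs (Ch f x), eps f q : ℤ) : ℂ) := by
    apply mul_left_cancel₀ hpi
    rw [← hDL]; push_cast; ring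
  have key : ω - (SignType.sign α : ℤ) = -∑ q ∈ toFs (Ch f x), eps f q := by exact_mod_cast key
  rcases lt_or_gt_of_ne hα0 with h | h
  · right; rw [sign_neg h] at key; simp at key; linarith
  · left; rw [sign_pos h] at key; simp at key; linarith

lemma global_lift {g : ℝ → ℂ} (hg : Continuous g) (h0 : ∀ t, g t ≠ 0) :
    ∃ θ : ℝ → ℝ, Continuous θ ∧ ∀ t, g t = (‖g t‖ : ℂ) * Complex.exp ((θ t : ℂ) * Complex.I) := by
  obtain ⟨F, ⟨-, hF⟩, -⟩ := Complex.isCoveringMapOn_exp.existsUnique_continuousMap_lifts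
    (⟨g, hg⟩ : C(ℝ, ℂ)) (a₀ := 0) (Complex.exp_log (h0 0)) h0
  have hF' : ∀ t, Complex.exp (F t) = g t := fun t => congrFun hF t
  refine ⟨fun t => (F t).im, by fun_prop, fun t => ?_⟩
  rw [← hF' t, Complex.norm_exp, Complex.ofReal_exp, ← Complex.exp_add, Complex.re_add_im]

def Wh (f : ℝ → ℂ) (ω : ℤ) : Prop := ∃ θ : ℝ → ℝ, Continuous θ ∧
    (∀ t : ℝ, deriv f t = (‖deriv f t‖ : ℂ) * Complex.exp ((θ t : ℂ) * Complex.I)) ∧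
    θ 1 - θ 0 = 2 * Real.pi * (ω : ℝ)

lemma whitney_of_V {f : ℝ → ℂ} (hf : Imm f) {ω : ℤ} (x : ℝ)
    (hV : V (deriv f) x (x + 1) = 2 * Real.pi * Complex.I * ω) : Wh f ω := by
  obtain ⟨θ, h1, h2⟩ := global_lift hf.dcont hf.imm
  refine ⟨θ, h1, h2, ?_⟩
  rw [theta_shift hf h1 h2] at hV
  have : ((θ 1 - θ 0 : ℝ) : ℂ) = ((2 * Real.pi * (ω : ℝ) : ℝ) : ℂ) := by
    apply mul_right_cancel₀ Complex.I_ne_zero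
    rw [hV]; push_cast; ring
  exact_mod_cast this

lemma exists_Wh {f : ℝ → ℂ} (hf : Imm f) : ∃ ω, Wh f ω := by
  obtain ⟨θ, h1, h2⟩ := global_lift hf.dcont hf.imm
  have e := h2 1
  have hper := deriv_per hf.per 0
  rw [zero_add] at hper
  rw [hper, h2 0] at e
  rw [norm_mul, Complex.norm_exp_ofReal_mul_I] at e
  simp only [Complex.norm_real, norm_norm, mul_one] at e
  have e := mul_left_cancel₀ (by exact_mod_cast norm_ne_zero_iff.mpr (hf.imm 0)) e
  rw [Complex.exp_eq_exp_iff_exists_int] at e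
  obtain ⟨n, hn⟩ := e
  refine ⟨-n, θ, h1, h2, ?_⟩
  have : (θ 0 : ℂ) = ((θ 1 + n * (2 * Real.pi) : ℝ) : ℂ) := by
    apply mul_right_cancel₀ Complex.I_ne_zero
    rw [hn]; push_cast; ring
  have : θ 0 = θ 1 + n * (2 * Real.pi) := by exact_mod_cast this
  push_cast; linarith

lemma eps_odd {f : ℝ → ℂ} (hf : Stb f) {x : ℝ} {q : ℝ × ℝ} (hq : q ∈ Ch f x) : (2 : ℤ) ∣ eps f q - 1 := by
  obtain ⟨h1, h2, h3, h4⟩ := hq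
  have := hf.tr _ _ h2 (by linarith) h4
  unfold eps
  rcases lt_or_gt_of_ne this with h | h
  · rw [sign_neg h]; norm_num
  · rw [sign_pos h]; norm_num

lemma cross_parity {f : ℝ → ℂ} (hf : Stb f) {ω : ℤ} (hw : Wh f ω) :
    ∃ x, BaseOK f x ∧ Odd (((Ch f x).ncard : ℤ) + ω) := by
  obtain ⟨θ, h1, h2, h3⟩ := hw
  obtain ⟨x, hx, hs⟩ := whitney_sum hf h1 h2 h3
  refine ⟨x, hx, ?_⟩
  have hc : (Ch f x).ncard = (toFs (Ch f x)).card := by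
    rw [← Set.ncard_coe_finset]; congr 1; ext q; simp [mem_toFs (hf.fin x)]
  have h2 : (2 : ℤ) ∣ ∑ q ∈ toFs (Ch f x), (eps f q - 1) :=
    Finset.dvd_sum fun q hq => eps_odd hf ((mem_toFs (hf.fin x) q).mp hq)
  rw [Finset.sum_sub_distrib, Finset.sum_const, nsmul_eq_mul, mul_one] at h2
  rw [hc, Int.odd_iff]
  rcases hs with h | h <;> omega

lemma planar_parity {c : PlanarCurve} (hs : c.Stable) {ω : ℤ} (hw : c.HasWhitney ω) :
    Odd ((c.crossings : ℤ) + ω) := by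
  have hi : Imm c.toFun := Imm.of_curve c.periodic c.smooth c.immersion
  have hf := Stb.of_stableF hi hs
  obtain ⟨x, hx, ho⟩ := cross_parity hf hw
  rwa [← show c.crossings = (Ch c.toFun x).ncard from crossings_eq hi.per hi.diff hi.imm hf.tri hx] at ho

lemma planar_B_eq {ω : ℤ} {n : ℕ} (hpar : Odd ((n : ℤ) + ω)) :
    PlanarCurve.B ω (n + 1) = PlanarCurve.B ω n := by
  ext c
  refine ⟨fun h => ⟨h.1, h.2.1, ?_⟩, fun h => ⟨h.1, h.2.1, h.2.2.trans (Nat.le_succ n)⟩⟩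
  have h1 := planar_parity h.1 h.2.1
  have h2 := h.2.2
  rw [Int.odd_iff] at h1 hpar
  omega

lemma Sph.of_curve (c : SphericalCurve) : Sph c.toFun := ⟨c.norm_one, c.periodic, c.smooth, c.immersion⟩

lemma sph_crossings {c : SphericalCurve} (hs : c.Stable) (v : S2) (hv : ∀ t, c.toFun t ≠ v) {x : ℝ}
    (hx : BaseOK (fun t => PV v (c.toFun t)) x) : c.crossings = (Ch (fun t => PV v (c.toFun t)) x).ncard := by
  have hf := StS.of_stableF (Sph.of_curve c) hs
  rw [Ch_PV v hf.toSph hv]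
  exact crossings_eq hf.per hf.diff hf.imm hf.tri ((Base_PV v hf.toSph hv x).mp hx)

lemma proj_eq (c : SphericalCurve) (v : S2) (t : ℝ) :
    PV v (c.toFun t) = Complex.orthonormalBasisOneI.repr.symm (c.proj v t) := PV_eq v (c.pt t)

lemma proj_eq2 (c : SphericalCurve) (v : S2) :
    c.proj v = fun t => Complex.orthonormalBasisOneI.repr (PV v (c.toFun t)) := by
  funext t; rw [proj_eq, LinearIsometryEquiv.apply_symm_apply]

lemma proj_deriv (c : SphericalCurve) (v : S2) (hv : ∀ t, c.toFun t ≠ v) (t : ℝ) :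
    deriv (c.proj v) t = Complex.orthonormalBasisOneI.repr (deriv (fun t => PV v (c.toFun t)) t) := by
  rw [proj_eq2]
  have := (PV_Imm v (Sph.of_curve c) hv).diff t
  exact (Complex.orthonormalBasisOneI.repr.toContinuousLinearEquiv.toContinuousLinearMap.hasFDerivAt.comp_hasDerivAt t
    this.hasDerivAt).deriv

lemma ang_eq (z : ℂ) (θ : ℝ) : (Complex.orthonormalBasisOneI.repr z = ‖Complex.orthonormalBasisOneI.repr z‖ •
          ((WithLp.equiv 2 (Fin 2 → ℝ)).symm ![Real.cos θ, Real.sin θ])) ↔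
    z = (‖z‖ : ℂ) * Complex.exp ((θ : ℂ) * Complex.I) := by
  rw [LinearIsometryEquiv.norm_map]
  have : ‖z‖ • (WithLp.equiv 2 (Fin 2 → ℝ)).symm ![Real.cos θ, Real.sin θ] =
      Complex.orthonormalBasisOneI.repr ((‖z‖ : ℂ) * Complex.exp ((θ : ℂ) * Complex.I)) := by
    ext i
    fin_cases i <;> simp [Complex.exp_ofReal_mul_I_re, Complex.exp_ofReal_mul_I_im]
  rw [this, EmbeddingLike.apply_eq_iff_eq]

lemma sph_Wh_iff (c : SphericalCurve) (ω : ZMod 2) : c.HasWhitney ω ↔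
    ∃ v : S2, (∀ t, c.toFun t ≠ v) ∧ ∃ m : ℤ, Wh (fun t => PV v (c.toFun t)) m ∧ ω = (m : ZMod 2) := by
  constructor
  · rintro ⟨v, hv, m, θ, h1, h2, h3, h4⟩
    refine ⟨v, hv, m, ⟨θ, h1, fun t => ?_, h3⟩, h4⟩
    have := h2 t
    rwa [proj_deriv c v hv, ang_eq] at this
  · rintro ⟨v, hv, m, ⟨θ, h1, h2, h3⟩, h4⟩
    refine ⟨v, hv, m, θ, h1, fun t => ?_, h3, h4⟩
    rw [proj_deriv c v hv, ang_eq]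
    exact h2 t

lemma zmod_odd {a b : ℤ} (h : Odd (a + b)) {ω : ℤ} : (ω : ZMod 2) = (b : ZMod 2) ↔ Odd (a + ω) := by
  rw [ZMod.intCast_eq_intCast_iff_dvd_sub]
  rw [Int.odd_iff] at h ⊢
  push_cast
  omega

lemma sph_parity {c : SphericalCurve} (hs : c.Stable) (ω : ℤ) :
    c.HasWhitney (ω : ZMod 2) ↔ Odd ((c.crossings : ℤ) + ω) := by
  have hf := StS.of_stableF (Sph.of_curve c) hs
  rw [sph_Wh_iff]
  constructor
  · rintro ⟨v, hv, m, hw, hm⟩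
    obtain ⟨x, hx, ho⟩ := cross_parity (hf.stb v hv) hw
    rw [← sph_crossings hs v hv hx] at ho
    exact (zmod_odd ho).mp hm
  · intro h
    obtain ⟨v, hv⟩ := exists_off hf.toSph
    obtain ⟨m, hw⟩ := exists_Wh (hf.stb v hv).toImm
    obtain ⟨x, hx, ho⟩ := cross_parity (hf.stb v hv) hw
    rw [← sph_crossings hs v hv hx] at ho
    exact ⟨v, hv, m, hw, (zmod_odd ho).mpr h⟩

lemma sph_B_eq {ω : ℤ} {n : ℕ} (hpar : Odd ((n : ℤ) + ω)) :
    SphericalCurve.B (ω : ZMod 2) (n + 1) = SphericalCurve.B (ω : ZMod 2) n := by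
  ext c
  refine ⟨fun h => ⟨h.1, h.2.1, ?_⟩, fun h => ⟨h.1, h.2.1, h.2.2.trans (Nat.le_succ n)⟩⟩
  have h1 := (sph_parity h.1 ω).mp h.2.1
  have h2 := h.2.2
  rw [Int.odd_iff] at h1 hpar
  omega


/-- Explicit list of self-intersection parameters. -/
structure Prs {E : Type*} (f : ℝ → E) (P : Finset (ℝ × ℝ)) : Prop where
  per : Function.Periodic f 1
  iff : ∀ s t, 0 ≤ s → s < t → t < 1 → (f s = f t ↔ (s, t) ∈ P)
  bd : ∀ q ∈ P, 0 < q.1 ∧ q.1 < q.2 ∧ q.2 < 1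
  ne : ∀ q ∈ P, ∀ r ∈ P, q.2 ≠ r.1

lemma Prs.base {E : Type*} {f : ℝ → E} {P : Finset (ℝ × ℝ)} (h : Prs f P) (t : ℝ) (h1 : 0 < t) (h2 : t < 0 + 1) :
    f t ≠ f 0 := by
  intro e
  have := h.bd _ ((h.iff 0 t le_rfl h1 (by linarith)).mp e.symm)
  simp at this

lemma Prs.ch {E : Type*} {f : ℝ → E} {P : Finset (ℝ × ℝ)} (h : Prs f P) :
    {q : ℝ × ℝ | 0 < q.1 ∧ q.1 < q.2 ∧ q.2 < 0 + 1 ∧ f q.1 = f q.2} = ↑P := by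
  ext q
  simp only [mem_ofPred_eq, Finset.mem_coe, zero_add]
  constructor
  · rintro ⟨h1, h2, h3, h4⟩
    exact (h.iff _ _ h1.le h2 h3).mp h4
  · intro hq
    obtain ⟨h1, h2, h3⟩ := h.bd q hq
    exact ⟨h1, h2, h3, (h.iff _ _ h1.le h2 h3).mpr hq⟩

lemma Prs.mult {E : Type*} {f : ℝ → E} {P : Finset (ℝ × ℝ)} (h : Prs f P) (p : E) :
    {r ∈ Ico (0:ℝ) 1 | f r = p}.ncard ≤ 2 := by
  by_contra hc
  push Not at hc
  have hfin := Set.finite_of_ncard_pos (by omega : 0 < {r ∈ Ico (0:ℝ) 1 | f r = p}.ncard)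
  have key : ∀ a b c : ℝ, a ∈ Ico (0:ℝ) 1 → c ∈ Ico (0:ℝ) 1 → a < b → b < c → f a = p → f b = p → f c = p → False := by
    intro a b c ha hc hab hbc h1 h2 h3
    have m1 := (h.iff a b ha.1 hab (hbc.trans hc.2)).mp (h1.trans h2.symm)
    have m2 := (h.iff b c (ha.1.trans hab.le) hbc hc.2).mp (h2.trans h3.symm)
    exact h.ne _ m1 _ m2 rfl
  obtain ⟨a, b, c, ⟨ha, ea⟩, ⟨hb, eb⟩, ⟨hc, ec⟩, n1, n2, n3⟩ := (Set.two_lt_ncard_iff hfin).mp hc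
  rcases lt_or_gt_of_ne n1 with g1 | g1 <;> rcases lt_or_gt_of_ne n2 with g2 | g2 <;>
    rcases lt_or_gt_of_ne n3 with g3 | g3
  · exact key a b c ha hc g1 g3 ea eb ec
  · exact key a c b ha hb g2 g3 ea ec eb
  · exact absurd (g1.trans g3) (not_lt.mpr g2.le)
  · exact key c a b hc hb g2 g1 ec ea eb
  · exact key b a c hb hc g1 g2 eb ea ec
  · exact absurd (g2.trans g3) (not_lt.mpr g1.le)
  · exact key b c a hb ha g3 g2 eb ec ea
  · exact key c b a hc ha g3 g1 ec eb ea

lemma Prs.fin {E : Type*} {f : ℝ → E} {P : Finset (ℝ × ℝ)} (h : Prs f P) :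
    {p : E | 2 ≤ {r ∈ Ico (0:ℝ) 1 | f r = p}.ncard}.Finite := by
  apply Set.Finite.subset (P.finite_toSet.image (fun q => f q.1))
  intro p hp
  have hp : 2 ≤ {r ∈ Ico (0:ℝ) 1 | f r = p}.ncard := hp
  have hfin := Set.finite_of_ncard_pos (by omega : 0 < {r ∈ Ico (0:ℝ) 1 | f r = p}.ncard)
  obtain ⟨a, b, ⟨ha, ea⟩, ⟨hb, eb⟩, n⟩ := (Set.one_lt_ncard_iff hfin).mp hp
  rcases lt_or_gt_of_ne n with g | g
  · exact ⟨(a, b), (h.iff a b ha.1 g hb.2).mp (ea.trans eb.symm), ea⟩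
  · exact ⟨(b, a), (h.iff b a hb.1 g ha.2).mp (eb.trans ea.symm), eb⟩

lemma Prs.inj {E F : Type*} {f : ℝ → E} {P : Finset (ℝ × ℝ)} (h : Prs f P) {g : ℝ → F}
    (hg : ∀ s t, g s = g t ↔ f s = f t) : Prs g P where
  per := fun t => (hg _ _).mpr (h.per t)
  iff := fun s t a b c => (hg s t).trans (h.iff s t a b c)
  bd := h.bd
  ne := h.ne

lemma Prs.tri {E : Type*} [NormedAddCommGroup E] [NormedSpace ℝ E] {f : ℝ → E} {P : Finset (ℝ × ℝ)} (h : Prs f P)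
    (hd : Differentiable ℝ f) (hi : ∀ t, deriv f t ≠ 0) :
    ∀ s t u, s < t → t < u → u < s + 1 → f s = f t → f t = f u → False := by
  intro s t u h1 h2 h3 h4 h5
  have h6 := three_le_mult h.per hd hi h1 h2 h3 h4 h5
  have := h.mult (f s)
  omega

lemma Prs.cross {E : Type*} [NormedAddCommGroup E] [NormedSpace ℝ E] {f : ℝ → E} {P : Finset (ℝ × ℝ)} (h : Prs f P)
    (hd : Differentiable ℝ f) (hi : ∀ t, deriv f t ≠ 0) :
    {p : E | 2 ≤ {r ∈ Ico (0:ℝ) 1 | f r = p}.ncard}.ncard = P.card := by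
  rw [crossings_eq h.per hd hi (h.tri hd hi) h.base, h.ch, Set.ncard_coe_finset]

/-- explicit planar curve with all crossing signs equal to `σ` -/
structure Ex (f : ℝ → ℂ) (P : Finset (ℝ × ℝ)) (σ : ℤ) : Prop extends Prs f P where
  sm : ContDiff ℝ (⊤ : ℕ∞) f
  imm : ∀ t, deriv f t ≠ 0
  hσ : σ ^ 2 = 1
  sg : ∀ q ∈ P, eps f q = σ

def Ex.curve {f : ℝ → ℂ} {P : Finset (ℝ × ℝ)} {σ : ℤ} (h : Ex f P σ) : PlanarCurve := ⟨f, h.per, h.sm, h.imm⟩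

lemma Ex.stable {f : ℝ → ℂ} {P : Finset (ℝ × ℝ)} {σ : ℤ} (h : Ex f P σ) : PlanarCurve.StableF f := by
  refine ⟨h.toPrs.fin, fun p => ⟨h.toPrs.mult p, fun _ => ?_⟩⟩
  have key : ∀ s ∈ Set.Ico (0:ℝ) 1, ∀ t ∈ Set.Ico (0:ℝ) 1, s < t → f s = f t →
    det2 (deriv f s) (deriv f t) ≠ 0 := by
    intro s hs t ht hst e hz
    have h1 := h.sg _ ((h.iff s t hs.1 hst ht.2).mp e)
    unfold eps at h1
    simp only [hz, sign_zero] at h1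
    have := h.hσ
    rw [← h1] at this; simp at this
  intro s hs t ht hst e1 e2
  rcases lt_or_gt_of_ne hst with g | g
  · exact key s hs t ht g (e1.trans e2.symm)
  · rw [det2_swap]; exact neg_ne_zero.mpr (key t ht s hs g (e2.trans e1.symm))

lemma Ex.toImm {f : ℝ → ℂ} {P : Finset (ℝ × ℝ)} {σ : ℤ} (h : Ex f P σ) : Imm f := Imm.of_curve h.per h.sm h.imm

lemma Ex.cr {f : ℝ → ℂ} {P : Finset (ℝ × ℝ)} {σ : ℤ} (h : Ex f P σ) : h.curve.crossings = P.card :=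
  h.toPrs.cross h.toImm.diff h.imm

lemma toFs_coe (P : Finset (ℝ × ℝ)) : toFs (↑P : Set (ℝ × ℝ)) = P := by
  ext q; rw [mem_toFs P.finite_toSet]; simp

lemma Ex.J {f : ℝ → ℂ} {P : Finset (ℝ × ℝ)} {σ : ℤ} (h : Ex f P σ) : Jinv f = JF (fun _ => 1) P := by
  rw [Jinv_eq (Stb.of_stableF h.toImm h.stable) (x := 0) h.toPrs.base, Jv, Ch, h.toPrs.ch, toFs_coe]
  exact JF_sgn h.hσ (fun q hq => by rw [h.sg q hq, mul_one])


abbrev SI := SphericalCurve.stereoInv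

lemma SI0 (z : ℂ) : SI z 0 = 2 * z.re / (z.re ^ 2 + z.im ^ 2 + 1) := by
  simp [SphericalCurve.stereoInv, Complex.normSq_apply]; ring
lemma SI1 (z : ℂ) : SI z 1 = 2 * z.im / (z.re ^ 2 + z.im ^ 2 + 1) := by
  simp [SphericalCurve.stereoInv, Complex.normSq_apply]; ring
lemma SI2 (z : ℂ) : SI z 2 = 1 - 2 / (z.re ^ 2 + z.im ^ 2 + 1) := by
  have : z.re ^ 2 + z.im ^ 2 + 1 ≠ 0 := by positivity
  simp [SphericalCurve.stereoInv, Complex.normSq_apply, ← pow_two]; field_simp; ring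

lemma SI_norm (z : ℂ) : ‖SI z‖ = 1 := by
  have : z.re ^ 2 + z.im ^ 2 + 1 ≠ 0 := by positivity
  have h : ‖SI z‖ ^ 2 = 1 := by
    rw [EuclideanSpace.norm_sq_eq, Fin.sum_univ_three, SI0, SI1, SI2]
    simp only [Real.norm_eq_abs, sq_abs]
    field_simp; ring
  exact (pow_eq_one_iff_of_nonneg (norm_nonneg _) two_ne_zero).mp h

lemma SI_inj {z w : ℂ} (h : SI z = SI w) : z = w := by
  have h0 := congrArg (fun v : E3 => v 0) h
  have h1 := congrArg (fun v : E3 => v 1) h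
  have h2 := congrArg (fun v : E3 => v 2) h
  simp only [SI0, SI1, SI2] at h0 h1 h2
  have hz : 0 < z.re ^ 2 + z.im ^ 2 + 1 := by positivity
  have hw : 0 < w.re ^ 2 + w.im ^ 2 + 1 := by positivity
  have e : z.re ^ 2 + z.im ^ 2 + 1 = w.re ^ 2 + w.im ^ 2 + 1 := by
    have : 2 / (z.re ^ 2 + z.im ^ 2 + 1) = 2 / (w.re ^ 2 + w.im ^ 2 + 1) := by linarith
    rw [div_eq_div_iff hz.ne' hw.ne'] at this; linarith
  rw [e, div_left_inj' hw.ne'] at h0 h1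
  exact Complex.ext (by linarith) (by linarith)

lemma SI_comp_deriv {f : ℝ → ℂ} (hf : Differentiable ℝ f) (t : ℝ) (hd : Differentiable ℝ (fun t => SI (f t))) :
    let a := (f t).re; let b := (f t).im; let a' := (deriv f t).re; let b' := (deriv f t).im
    let R := a ^ 2 + b ^ 2 + 1; let R' := 2 * (a * a' + b * b')
    deriv (fun t => SI (f t)) t 0 = (2 * a' * R - 2 * a * R') / R ^ 2 ∧
    deriv (fun t => SI (f t)) t 1 = (2 * b' * R - 2 * b * R') / R ^ 2 ∧
    deriv (fun t => SI (f t)) t 2 = 2 * R' / R ^ 2 := by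
  intro a b a' b' R R'
  have hR : R ≠ 0 := by positivity
  have hc : ∀ i : Fin 3, deriv (fun t => SI (f t)) t i = deriv (fun t => SI (f t) i) t := fun i =>
    (((EuclideanSpace.proj i : E3 →L[ℝ] ℝ).hasFDerivAt.comp_hasDerivAt t (hd t).hasDerivAt).deriv).symm
  have ha : HasDerivAt (fun t => (f t).re) a' t :=
    Complex.reCLM.hasFDerivAt.comp_hasDerivAt t (hf t).hasDerivAt
  have hb : HasDerivAt (fun t => (f t).im) b' t :=
    Complex.imCLM.hasFDerivAt.comp_hasDerivAt t (hf t).hasDerivAt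
  have hRd : HasDerivAt (fun t => (f t).re ^ 2 + (f t).im ^ 2 + 1) R' t :=
    (((ha.pow 2).add (hb.pow 2)).add_const 1).congr_deriv (by simp only [R', a, b]; push_cast; ring)
  rw [hc, hc, hc]
  simp only [SI0, SI1, SI2]
  refine ⟨?_, ?_, ?_⟩
  · exact ((ha.const_mul 2).div hRd hR).deriv
  · exact ((hb.const_mul 2).div hRd hR).deriv
  · refine ((((hasDerivAt_const t (2:ℝ)).div hRd hR).const_sub 1).congr_deriv ?_).deriv
    simp only [zero_mul, zero_sub]; ring

lemma SI_smooth {f : ℝ → ℂ} (hf : ContDiff ℝ (⊤ : ℕ∞) f) : ContDiff ℝ (⊤ : ℕ∞) (fun t => SI (f t)) := by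
  have hR : ∀ t, (f t).re ^ 2 + (f t).im ^ 2 + 1 ≠ 0 := fun t => by positivity
  have ha : ContDiff ℝ (⊤ : ℕ∞) (fun t => (f t).re) := Complex.reCLM.contDiff.comp hf
  have hb : ContDiff ℝ (⊤ : ℕ∞) (fun t => (f t).im) := Complex.imCLM.contDiff.comp hf
  have hRR : ContDiff ℝ (⊤ : ℕ∞) (fun t => (f t).re ^ 2 + (f t).im ^ 2 + 1) := ((ha.pow 2).add (hb.pow 2)).add contDiff_const
  rw [contDiff_euclidean]
  intro i
  fin_cases i
  · simp only [Fin.zero_eta, SI0]; exact (contDiff_const.mul ha).div hRR hR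
  · simp only [Fin.mk_one, SI1]; exact (contDiff_const.mul hb).div hRR hR
  · simp only [Fin.reduceFinMk, SI2]; exact contDiff_const.sub (contDiff_const.div hRR hR)

lemma SI_det {f : ℝ → ℂ} (hf : ContDiff ℝ (⊤ : ℕ∞) f) {s t : ℝ} (h : f s = f t) :
    ∃ A : ℝ, A < 0 ∧ det3 (SI (f s)) (deriv (fun t => SI (f t)) s) (deriv (fun t => SI (f t)) t) =
      A * det2 (deriv f s) (deriv f t) := by
  have hd : Differentiable ℝ f := hf.differentiable (by simp)
  have hd2 : Differentiable ℝ (fun t => SI (f t)) := (SI_smooth hf).differentiable (by simp)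
  obtain ⟨s0, s1, s2⟩ := SI_comp_deriv hd s hd2
  obtain ⟨t0, t1, t2⟩ := SI_comp_deriv hd t hd2
  have hR : 0 < (f s).re ^ 2 + (f s).im ^ 2 + 1 := by positivity
  refine ⟨-(2 / ((f s).re ^ 2 + (f s).im ^ 2 + 1)) ^ 2, by have := div_pos two_pos hR; nlinarith, ?_⟩
  unfold det3 det2
  rw [s0, s1, s2, t0, t1, t2, SI0, SI1, SI2, ← h]
  field_simp
  ring

lemma Ex.sph {f : ℝ → ℂ} {P : Finset (ℝ × ℝ)} {σ : ℤ} (h : Ex f P σ) : Sph (fun t => SI (f t)) where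
  nrm := fun t => SI_norm _
  per := fun t => by simp only [h.per t]
  sm := SI_smooth h.sm
  imm := fun t e => by
    have hd2 : Differentiable ℝ (fun t => SI (f t)) := (SI_smooth h.sm).differentiable (by simp)
    obtain ⟨s0, s1, s2⟩ := SI_comp_deriv h.toImm.diff t hd2
    rw [e] at s0 s1 s2
    have hR : (f t).re ^ 2 + (f t).im ^ 2 + 1 ≠ 0 := by positivity
    simp only [PiLp.zero_apply] at s0 s1 s2
    rw [eq_comm, div_eq_zero_iff, or_iff_left (pow_ne_zero 2 hR)] at s0 s1 s2
    have e : (f t).re * (deriv f t).re + (f t).im * (deriv f t).im = 0 := by linarith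
    rw [e] at s0 s1
    simp only [mul_zero, sub_zero] at s0 s1
    apply h.imm t
    apply Complex.ext
    · have := (mul_eq_zero.mp s0).resolve_right hR; simpa using this
    · have := (mul_eq_zero.mp s1).resolve_right hR; simpa using this

lemma Ex.prsS {f : ℝ → ℂ} {P : Finset (ℝ × ℝ)} {σ : ℤ} (h : Ex f P σ) : Prs (fun t => SI (f t)) P :=
  h.toPrs.inj fun s t => ⟨fun e => SI_inj e, fun e => by simp only [e]⟩

def Ex.curveS {f : ℝ → ℂ} {P : Finset (ℝ × ℝ)} {σ : ℤ} (h : Ex f P σ) : SphericalCurve :=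
  ⟨fun t => SI (f t), h.sph.nrm, h.sph.per, h.sph.sm, h.sph.imm⟩

lemma Ex.sgS {f : ℝ → ℂ} {P : Finset (ℝ × ℝ)} {σ : ℤ} (h : Ex f P σ) {q : ℝ × ℝ} (hq : q ∈ P) :
    epsS (fun t => SI (f t)) q = -σ := by
  obtain ⟨b1, b2, b3⟩ := h.bd q hq
  obtain ⟨A, hA, e⟩ := SI_det h.sm ((h.iff q.1 q.2 b1.le b2 b3).mpr hq)
  unfold epsS
  simp only [e, sign_mul, sign_neg hA]
  have := h.sg q hq
  unfold eps at this
  rw [← this]; simp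

lemma det3_swap (a b c : E3) : det3 a b c = - det3 a c b := by unfold det3; ring

lemma Ex.stableS {f : ℝ → ℂ} {P : Finset (ℝ × ℝ)} {σ : ℤ} (h : Ex f P σ) : h.curveS.Stable := by
  refine ⟨h.prsS.fin, fun p => ⟨h.prsS.mult p, fun _ => ?_⟩⟩
  have key : ∀ s ∈ Set.Ico (0:ℝ) 1, ∀ t ∈ Set.Ico (0:ℝ) 1, s < t → SI (f s) = SI (f t) →
    det3 (SI (f s)) (deriv (fun t => SI (f t)) s) (deriv (fun t => SI (f t)) t) ≠ 0 := by
    intro s hs t ht hst e hz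
    have h1 := h.sgS ((h.prsS.iff s t hs.1 hst ht.2).mp e)
    unfold epsS at h1
    simp only [hz, sign_zero] at h1
    have := h.hσ
    rw [← neg_sq, ← h1] at this; simp at this
  intro s hs t ht hst e1 e2
  have e1 : SI (f s) = p := e1
  have e2 : SI (f t) = p := e2
  rcases lt_or_gt_of_ne hst with g | g
  · rw [← e1]; exact key s hs t ht g (e1.trans e2.symm)
  · rw [det3_swap, ← e2]; exact neg_ne_zero.mpr (key t ht s hs g (e2.trans e1.symm))

lemma Ex.crS {f : ℝ → ℂ} {P : Finset (ℝ × ℝ)} {σ : ℤ} (h : Ex f P σ) : h.curveS.crossings = P.card :=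
  h.prsS.cross h.sph.diff h.sph.imm

lemma Ex.JS {f : ℝ → ℂ} {P : Finset (ℝ × ℝ)} {σ : ℤ} (h : Ex f P σ) : JS h.curveS.toFun = JF (fun _ => 1) P := by
  obtain ⟨v, hv⟩ := exists_off h.sph
  have hs := StS.of_stableF h.sph h.stableS
  rw [show h.curveS.toFun = fun t => SI (f t) from rfl, JS_eq' v h.sph hv (hs.stb v hv) (x := 0) h.prsS.base, JvS,
    ChS, h.prsS.ch, toFs_coe]
  exact JF_sgn (σ := -σ) (by rw [neg_sq]; exact h.hσ) (fun q hq => by rw [h.sgS hq, mul_one])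

/-- lower bounds for diameters -/
lemma planar_lower {ω : ℤ} {n : ℕ} {f g : ℝ → ℂ} {P Q : Finset (ℝ × ℝ)} {σ τ : ℤ} (hf : Ex f P σ) (hg : Ex g Q τ)
    (wf : Wh f ω) (wg : Wh g ω) (cf : P.card ≤ n) (cg : Q.card ≤ n) {b : ℝ}
    (hb : 4 * b ≤ ((JF (fun _ => 1) P - JF (fun _ => 1) Q : ℤ) : ℝ)) :
    ENNReal.ofReal b ≤ (PlanarCurve.diam (PlanarCurve.B ω n) : ℝ≥0∞) := by
  have m1 : hf.curve ∈ PlanarCurve.B ω n := ⟨hf.stable, wf, by rw [hf.cr]; exact cf⟩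
  have m2 : hg.curve ∈ PlanarCurve.B ω n := ⟨hg.stable, wg, by rw [hg.cr]; exact cg⟩
  have h1 : (⌈b⌉₊ : ℕ∞) ≤ PlanarCurve.dist hf.curve hg.curve := by
    apply le_sInf
    rintro m ⟨k, rfl, seq, hs⟩
    have := planar_dist hs
    rw [show hf.curve.toFun = f from rfl, show hg.curve.toFun = g from rfl, hf.J, hg.J] at this
    have h2 := (le_abs_self _).trans this
    have h2 : ((JF (fun _ => 1) P - JF (fun _ => 1) Q : ℤ) : ℝ) ≤ 4 * k := by exact_mod_cast h2
    have h3 : b ≤ k := by linarith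
    exact_mod_cast Nat.ceil_le.mpr h3
  have h2 : (⌈b⌉₊ : ℕ∞) ≤ PlanarCurve.diam (PlanarCurve.B ω n) :=
    h1.trans (le_iSup₂_of_le hf.curve m1 (le_iSup₂_of_le hg.curve m2 le_rfl))
  have h3 : ENNReal.ofReal b ≤ ((⌈b⌉₊ : ℕ) : ℝ≥0∞) := by
    rw [← ENNReal.ofReal_natCast]; exact ENNReal.ofReal_le_ofReal (Nat.le_ceil b)
  refine h3.trans ?_
  have := ENat.toENNReal_mono h2
  simpa using this

lemma sph_lower {ω : ℤ} {n : ℕ} {f g : ℝ → ℂ} {P Q : Finset (ℝ × ℝ)} {σ τ : ℤ} (hf : Ex f P σ) (hg : Ex g Q τ)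
    (wf : Odd ((P.card : ℤ) + ω)) (wg : Odd ((Q.card : ℤ) + ω)) (cf : P.card ≤ n) (cg : Q.card ≤ n) {b : ℝ}
    (hb : 4 * b ≤ ((JF (fun _ => 1) P - JF (fun _ => 1) Q : ℤ) : ℝ)) :
    ENNReal.ofReal b ≤ (SphericalCurve.diam (SphericalCurve.B (ω : ZMod 2) n) : ℝ≥0∞) := by
  have m1 : hf.curveS ∈ SphericalCurve.B (ω : ZMod 2) n :=
    ⟨hf.stableS, (sph_parity hf.stableS ω).mpr (by rw [hf.crS]; exact wf), by rw [hf.crS]; exact cf⟩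
  have m2 : hg.curveS ∈ SphericalCurve.B (ω : ZMod 2) n :=
    ⟨hg.stableS, (sph_parity hg.stableS ω).mpr (by rw [hg.crS]; exact wg), by rw [hg.crS]; exact cg⟩
  have h1 : (⌈b⌉₊ : ℕ∞) ≤ SphericalCurve.dist hf.curveS hg.curveS := by
    apply le_sInf
    rintro m ⟨k, rfl, seq, hs⟩
    have := sph_dist hs
    rw [hf.JS, hg.JS] at this
    have h2 := (le_abs_self _).trans this
    have h2 : ((JF (fun _ => 1) P - JF (fun _ => 1) Q : ℤ) : ℝ) ≤ 4 * k := by exact_mod_cast h2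
    have h3 : b ≤ k := by linarith
    exact_mod_cast Nat.ceil_le.mpr h3
  have h2 : (⌈b⌉₊ : ℕ∞) ≤ SphericalCurve.diam (SphericalCurve.B (ω : ZMod 2) n) :=
    h1.trans (le_iSup₂_of_le hf.curveS m1 (le_iSup₂_of_le hg.curveS m2 le_rfl))
  have h3 : ENNReal.ofReal b ≤ ((⌈b⌉₊ : ℕ) : ℝ≥0∞) := by
    rw [← ENNReal.ofReal_natCast]; exact ENNReal.ofReal_le_ofReal (Nat.le_ceil b)
  refine h3.trans ?_
  have := ENat.toENNReal_mono h2
  simpa using this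


def PA (m : ℕ) : Finset (ℝ × ℝ) :=
  (Finset.range (m - 1)).image fun k : ℕ => (((k + 1 : ℕ) : ℝ) / (2 * m), 1 - ((k + 1 : ℕ) : ℝ) / (2 * m))

def PB (N : ℕ) : Finset (ℝ × ℝ) :=
  (Finset.range N).image fun j : ℕ => ((4 * (j : ℝ) + 1) / (4 * N), (4 * (j : ℝ) + 3) / (4 * N))

lemma mem_PA {m : ℕ} (hm : 1 ≤ m) {q : ℝ × ℝ} : q ∈ PA m ↔
    ∃ k : ℕ, 1 ≤ k ∧ k < m ∧ q = ((k : ℝ) / (2 * m), 1 - (k : ℝ) / (2 * m)) := by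
  simp only [PA, Finset.mem_image, Finset.mem_range]
  constructor
  · rintro ⟨k, hk, rfl⟩; exact ⟨k + 1, by omega, by omega, rfl⟩
  · rintro ⟨k, h1, h2, rfl⟩; exact ⟨k - 1, by omega, by rw [Nat.sub_add_cancel h1]⟩

lemma PA_bd {m : ℕ} (hm : 1 ≤ m) {q : ℝ × ℝ} (hq : q ∈ PA m) : 0 < q.1 ∧ q.1 < 1 / 2 ∧ q.2 = 1 - q.1 := by
  obtain ⟨k, h1, h2, rfl⟩ := (mem_PA hm).mp hq
  have h1 : (1:ℝ) ≤ k := by exact_mod_cast h1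
  have h2 : (k:ℝ) < m := by exact_mod_cast h2
  have h3 : (0:ℝ) < 2 * m := by linarith
  refine ⟨by positivity, ?_, rfl⟩
  simp only
  rw [div_lt_div_iff₀ h3 two_pos]; linarith

lemma PA_card {m : ℕ} (hm : 1 ≤ m) : (PA m).card = m - 1 := by
  rw [PA, Finset.card_image_of_injective, Finset.card_range]
  intro a b h
  have h3 : (0:ℝ) < 2 * m := by positivity
  have := (Prod.mk.inj h).1
  rw [div_left_inj' h3.ne'] at this
  have : a + 1 = b + 1 := by exact_mod_cast this
  omega

lemma PA_J {m : ℕ} (hm : 1 ≤ m) : JF (fun _ => 1) (PA m) = ((m : ℤ) - 1) ^ 2 := by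
  have : Dsum (fun _ => 1) (PA m) (PA m) = 0 := by
    unfold Dsum
    refine Finset.sum_eq_zero fun q hq => Finset.sum_eq_zero fun r hr => ?_
    rw [if_neg]
    have := PA_bd hm hq
    have := PA_bd hm hr
    push Not; linarith
  rw [JF, this, Finset.sum_const, PA_card hm, nsmul_eq_mul]
  push_cast [hm]; ring

lemma PB_inj {N : ℕ} (hN : 1 ≤ N) : Function.Injective
    (fun j : ℕ => ((4 * (j : ℝ) + 1) / (4 * (N:ℝ)), (4 * (j : ℝ) + 3) / (4 * (N:ℝ)))) := by
  intro a b h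
  have h3 : (0:ℝ) < 4 * N := by positivity
  have := (Prod.mk.inj h).1
  rw [div_left_inj' h3.ne'] at this
  have : (a:ℝ) = b := by linarith
  exact_mod_cast this

lemma PB_card {N : ℕ} (hN : 1 ≤ N) : (PB N).card = N := by
  rw [PB, Finset.card_image_of_injective _ (PB_inj hN), Finset.card_range]

lemma sum_lt_range (N : ℕ) : 2 * (∑ j ∈ Finset.range N, ∑ k ∈ Finset.range N, if j < k then (1:ℤ) else 0) = N * (N - 1) := by
  induction N with
  | zero => simp
  | succ N ih =>
    rw [Finset.sum_range_succ]
    simp_rw [Finset.sum_range_succ _ N]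
    rw [Finset.sum_add_distrib, mul_add, mul_add, ih]
    have e1 : ∑ j ∈ Finset.range N, (if j < N then (1:ℤ) else 0) = N := by
      rw [Finset.sum_congr rfl (g := fun _ => 1) (fun j hj => if_pos (Finset.mem_range.mp hj))]; simp
    have e2 : ∑ j ∈ Finset.range N, (if N < j then (1:ℤ) else 0) = 0 :=
      Finset.sum_eq_zero fun j hj => if_neg (by have := Finset.mem_range.mp hj; omega)
    rw [e1, e2]; simp; ring

lemma PB_J {N : ℕ} (hN : 1 ≤ N) : JF (fun _ => 1) (PB N) = 2 * N - (N : ℤ) ^ 2 := by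
  have h3 : (0:ℝ) < 4 * N := by positivity
  have h : 2 * Dsum (fun _ => 1) (PB N) (PB N) = N * (N - 1) := by
    rw [← sum_lt_range]
    congr 1
    unfold Dsum PB
    rw [Finset.sum_image (PB_inj hN).injOn]
    refine Finset.sum_congr rfl fun j _ => ?_
    rw [Finset.sum_image (PB_inj hN).injOn]
    refine Finset.sum_congr rfl fun k _ => ?_
    simp only [mul_one]
    refine if_congr ?_ rfl rfl
    rw [div_lt_div_iff_of_pos_right h3]
    constructor
    · intro h; by_contra hc; push Not at hc
      have : (k:ℝ) ≤ j := by exact_mod_cast hc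
      linarith
    · intro h
      have : (j:ℝ) + 1 ≤ k := by exact_mod_cast h
      linarith
  rw [JF, Finset.sum_const, PB_card hN, nsmul_eq_mul]
  linarith

lemma Wh.conj {f : ℝ → ℂ} {ω : ℤ} (hd : Differentiable ℝ f) (h : Wh f ω) :
    Wh (fun t => (starRingEnd ℂ) (f t)) (-ω) := by
  obtain ⟨θ, h1, h2, h3⟩ := h
  have hde : ∀ t, deriv (fun t => (starRingEnd ℂ) (f t)) t = (starRingEnd ℂ) (deriv f t) := fun t =>
    (Complex.conjCLE.toContinuousLinearMap.hasFDerivAt.comp_hasDerivAt t (hd t).hasDerivAt).deriv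
  refine ⟨fun t => -θ t, h1.neg, fun t => ?_, ?_⟩
  · rw [hde, Complex.norm_conj]
    conv_lhs => rw [h2 t]
    rw [map_mul, Complex.conj_ofReal, ← Complex.exp_conj, map_mul, Complex.conj_I, Complex.conj_ofReal]
    congr 2; push_cast; ring
  · push_cast; linarith

lemma Ex.conj {f : ℝ → ℂ} {P : Finset (ℝ × ℝ)} {σ : ℤ} (h : Ex f P σ) :
    Ex (fun t => (starRingEnd ℂ) (f t)) P (-σ) := by
  have hd := h.toImm.diff
  have hde : ∀ t, deriv (fun t => (starRingEnd ℂ) (f t)) t = (starRingEnd ℂ) (deriv f t) := fun t =>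
    (Complex.conjCLE.toContinuousLinearMap.hasFDerivAt.comp_hasDerivAt t (hd t).hasDerivAt).deriv
  refine { toPrs := h.toPrs.inj fun s t => (starRingEnd ℂ).injective.eq_iff, sm := ?_, imm := ?_, hσ := ?_, sg := ?_ }
  · exact Complex.conjCLE.contDiff.comp h.sm
  · intro t; rw [hde]; simpa using h.imm t
  · rw [neg_sq]; exact h.hσ
  · intro q hq
    rw [← h.sg q hq]
    unfold eps
    rw [hde, hde]
    have : det2 ((starRingEnd ℂ) (deriv f q.1)) ((starRingEnd ℂ) (deriv f q.2)) = -det2 (deriv f q.1) (deriv f q.2) := by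
      simp [det2]; ring
    rw [this, Left.sign_neg]; simp


lemma fix_sin {u : ℝ} (h : u = Real.pi / 2 * Real.sin u) : u = 0 ∨ u = Real.pi / 2 ∨ u = -(Real.pi / 2) := by
  have hp := Real.pi_pos
  have key : ∀ v : ℝ, 0 < v → v = Real.pi / 2 * Real.sin v → v = Real.pi / 2 := by
    intro v hv e
    have h1 := Real.sin_le_one v
    have h2 : v ≤ Real.pi / 2 := by nlinarith
    by_contra hc
    have h3 := Real.mul_lt_sin hv (lt_of_le_of_ne h2 hc)
    have : Real.pi / 2 * (2 / Real.pi * v) < Real.pi / 2 * Real.sin v := by gcongr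
    rw [← e] at this
    have e2 : Real.pi / 2 * (2 / Real.pi * v) = v := by field_simp
    linarith
  rcases lt_trichotomy u 0 with g | g | g
  · right; right
    have := key (-u) (by linarith) (by rw [Real.sin_neg]; linarith)
    linarith
  · left; exact g
  · right; left; exact key u g h

lemma fix_sin' {u : ℝ} (h : u = -(Real.pi / 2 * Real.sin u)) : u = 0 := by
  have hp := Real.pi_pos
  have h1 := Real.sin_le_one u
  have h2 := Real.neg_one_le_sin u
  have hu1 : u ≤ Real.pi / 2 := by nlinarith
  have hu2 : -(Real.pi / 2) ≤ u := by nlinarith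
  rcases lt_trichotomy u 0 with g | g | g
  · have := Real.sin_neg_of_neg_of_neg_pi_lt g (by linarith); nlinarith
  · exact g
  · have := Real.sin_pos_of_pos_of_lt_pi g (by linarith); nlinarith

lemma int_lt {a b : ℤ} {x : ℝ} (h1 : (a : ℝ) < x) (h2 : x < b) (h : b ≤ a + 1) (n : ℤ) : x ≠ n := by
  rintro rfl
  have : a < n := by exact_mod_cast h1
  have : n < b := by exact_mod_cast h2
  omega

lemma B_real {N : ℕ} (hN : 1 ≤ N) {s t : ℝ} (hs : 0 ≤ s) (hst : s < t) (ht : t < 1) :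
    (Real.cos (2 * Real.pi * N * s) = Real.cos (2 * Real.pi * N * t) ∧
      ∃ n : ℤ, 2 * Real.pi * s + Real.pi / (2 * N) * Real.sin (2 * Real.pi * N * s) =
        2 * Real.pi * t + Real.pi / (2 * N) * Real.sin (2 * Real.pi * N * t) + n * (2 * Real.pi)) ↔ (s, t) ∈ PB N := by
  have hp := Real.pi_pos
  have hN1 : (1:ℝ) ≤ N := by exact_mod_cast hN
  have hN0 : (0:ℝ) < N := by linarith
  constructor
  · rintro ⟨hc, n, hn⟩
    have notint : ∀ k : ℤ, s - t ≠ k := int_lt (a := -1) (b := 0) (by push_cast; linarith) (by push_cast; linarith) (by norm_num)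
    rw [Real.cos_eq_cos_iff] at hc
    obtain ⟨k, hk | hk⟩ := hc
    · exfalso
      have e : Real.sin (2 * Real.pi * N * t) = Real.sin (2 * Real.pi * N * s) := by
        rw [hk, ← Real.sin_add_int_mul_two_pi (2 * Real.pi * N * s) k]; congr 1; ring
      rw [e] at hn
      apply notint n
      have : 2 * Real.pi * (s - t) = 2 * Real.pi * n := by linarith
      exact mul_left_cancel₀ (by positivity) this
    · have e : Real.sin (2 * Real.pi * N * t) = -Real.sin (2 * Real.pi * N * s) := by
        rw [hk, ← Real.sin_neg, ← Real.sin_add_int_mul_two_pi (-(2 * Real.pi * N * s)) k]; congr 1; ring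
      rw [e] at hn
      set S := Real.sin (2 * Real.pi * N * s) with hS
      have hn2 : t = s + S / (2 * N) - n := by
        have : 2 * Real.pi * (t - (s + S / (2 * N) - n)) = 0 := by
          have e3 : Real.pi / (2 * N) * S = Real.pi * (S / (2 * N)) := by ring
          have e4 : Real.pi / (2 * N) * -S = -(Real.pi * (S / (2 * N))) := by ring
          rw [e3, e4] at hn; linarith
        have := (mul_eq_zero.mp this).resolve_left (by positivity)
        linarith
      set u := ((k + N * n : ℤ) : ℝ) * Real.pi - 2 * Real.pi * N * s with hu
      have hu1 : u = Real.pi / 2 * S := by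
        rw [hn2] at hk
        have : 2 * Real.pi * N * (s + S / (2 * N) - n) = 2 * Real.pi * N * s + Real.pi * S - 2 * Real.pi * N * n := by
          field_simp
        rw [this] at hk
        rw [hu]; push_cast; linarith
      have hS2 : S = Real.sin (((k + N * n : ℤ) : ℝ) * Real.pi - u) := by rw [hS, hu]; congr 1; ring
      have hS0 : S ≠ 0 := by
        intro h0; rw [h0] at hn2
        exact notint n (by rw [hn2]; ring)
      have hu0 : u ≠ 0 := by rw [hu1]; positivity
      obtain ⟨i, hi | hi⟩ := Int.even_or_odd' (k + N * n)
      · exfalso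
        apply hu0
        apply fix_sin'
        rw [hi] at hS2
        have : Real.sin (((2 * i : ℤ) : ℝ) * Real.pi - u) = -Real.sin u := by
          rw [← Real.sin_neg, ← Real.sin_add_int_mul_two_pi (-u) i]; congr 1; push_cast; ring
        rw [this] at hS2
        rw [← mul_neg, ← hS2]; exact hu1
      · rw [hi] at hS2 hu
        have : Real.sin (((2 * i + 1 : ℤ) : ℝ) * Real.pi - u) = Real.sin u := by
          rw [← Real.sin_pi_sub u, ← Real.sin_add_int_mul_two_pi (Real.pi - u) i]; congr 1; push_cast; ring
        rw [this] at hS2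
        push_cast at hu
        have half : 0 < 1 / (2 * (N:ℝ)) ∧ 1 / (2 * (N:ℝ)) ≤ 1 / 2 :=
          ⟨by positivity, by apply one_div_le_one_div_of_le <;> linarith⟩
        rcases fix_sin (u := u) (by rw [← hS2]; exact hu1) with g | g | g
        · exact absurd g hu0
        · have hS1 : S = 1 := by rw [hS2, g, Real.sin_pi_div_two]
          rw [hS1] at hn2
          have hs' : s = (4 * i + 1) / (4 * N) := by
            rw [eq_div_iff (by positivity)]
            apply mul_left_cancel₀ hp.ne'
            linarith
          have hn0 : n = 0 := by
            have h1 : (n:ℝ) < 1 := by linarith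
            have h2 : (-1:ℝ) < n := by linarith
            have h1 : n < 1 := by exact_mod_cast h1
            have h2 : -1 < n := by exact_mod_cast h2
            omega
          have hi0 : 0 ≤ i := by
            by_contra hc
            have : (i:ℝ) ≤ -1 := by exact_mod_cast (by omega : i ≤ -1)
            have : s < 0 := by rw [hs']; apply div_neg_of_neg_of_pos <;> linarith
            linarith
          have hiN : i < N := by
            by_contra hc
            have : (N:ℝ) ≤ i := by exact_mod_cast (by omega : (N:ℤ) ≤ i)
            have : 1 < s := by rw [hs', lt_div_iff₀ (by positivity)]; linarith
            linarith
          lift i to ℕ using hi0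
          refine Finset.mem_image.mpr ⟨i, Finset.mem_range.mpr (by exact_mod_cast hiN), Prod.ext ?_ ?_⟩
          · simp only; rw [hs']; push_cast; ring
          · simp only; rw [hn2, hs', hn0]; push_cast; field_simp; ring
        · exfalso
          have hS1 : S = -1 := by rw [hS2, g, Real.sin_neg, Real.sin_pi_div_two]
          rw [hS1, neg_div] at hn2
          have hs' : s = (4 * i + 3) / (4 * N) := by
            rw [eq_div_iff (by positivity)]
            apply mul_left_cancel₀ hp.ne'
            linarith
          have hn0 : n = -1 := by
            have h1 : (n:ℝ) < 0 := by linarith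
            have h2 : (-2:ℝ) < n := by linarith
            have h1 : n < 0 := by exact_mod_cast h1
            have h2 : -2 < n := by exact_mod_cast h2
            omega
          have ht' : t = 1 + (4 * i + 1) / (4 * N) := by
            rw [hn2, hs', hn0]; push_cast; field_simp; ring
          rcases lt_or_ge i 0 with hc | hc
          · have : (i:ℝ) ≤ -1 := by exact_mod_cast (by omega : i ≤ -1)
            have : s < 0 := by rw [hs']; apply div_neg_of_neg_of_pos <;> linarith
            linarith
          · have : (0:ℝ) ≤ i := by exact_mod_cast hc
            have : 0 ≤ (4 * (i:ℝ) + 1) / (4 * N) := by positivity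
            linarith
  · intro h
    obtain ⟨j, hj, e⟩ := Finset.mem_image.mp h
    obtain ⟨rfl, rfl⟩ := Prod.mk.inj e
    have e1 : 2 * Real.pi * N * ((4 * (j:ℝ) + 1) / (4 * N)) = Real.pi / 2 + j * (2 * Real.pi) := by field_simp; ring
    have e2 : 2 * Real.pi * N * ((4 * (j:ℝ) + 3) / (4 * N)) = (Real.pi / 2 + Real.pi) + j * (2 * Real.pi) := by field_simp; ring
    rw [e1, e2, Real.cos_add_nat_mul_two_pi, Real.cos_add_nat_mul_two_pi, Real.sin_add_nat_mul_two_pi,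
      Real.sin_add_nat_mul_two_pi, Real.cos_add_pi, Real.sin_add_pi, Real.cos_pi_div_two, Real.sin_pi_div_two]
    refine ⟨by simp, 0, ?_⟩
    push_cast; field_simp; ring


lemma det2_scale (k u v : ℂ) : det2 (k * u) (k * v) = Complex.normSq k * det2 u v := by
  simp [det2, Complex.normSq_apply]; ring

def eB (N : ℕ) (t : ℝ) : ℂ := Complex.exp (((2 * Real.pi * N * t : ℝ) : ℂ) * Complex.I)
def gB (N : ℕ) (t : ℝ) : ℂ := ((2 * Real.pi * t : ℝ) : ℂ) * Complex.I + ((Real.pi / (2 * N) : ℝ) : ℂ) * eB N t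
def fB (N : ℕ) (t : ℝ) : ℂ := Complex.exp (gB N t)

lemma hasDerivAt_lin (a t : ℝ) : HasDerivAt (fun t : ℝ => ((a * t : ℝ) : ℂ) * Complex.I) ((a : ℂ) * Complex.I) t := by
  have : HasDerivAt (fun t : ℝ => a * t) a t := by simpa using (hasDerivAt_id t).const_mul a
  exact this.ofReal_comp.mul_const _

lemma eB_deriv (N : ℕ) (t : ℝ) : HasDerivAt (eB N) (eB N t * (((2 * Real.pi * N : ℝ) : ℂ) * Complex.I)) t :=
  (hasDerivAt_lin (2 * Real.pi * N) t).cexp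

lemma fB_deriv {N : ℕ} (hN : 1 ≤ N) (t : ℝ) :
    HasDerivAt (fB N) (fB N t * (2 * Real.pi * Complex.I) * (1 + ((Real.pi / 2 : ℝ) : ℂ) * eB N t)) t := by
  have h : HasDerivAt (gB N) _ t := (hasDerivAt_lin (2 * Real.pi) t).add ((eB_deriv N t).const_mul ((Real.pi / (2 * N) : ℝ) : ℂ))
  refine h.cexp.congr_deriv ?_
  have : (N : ℂ) ≠ 0 := by exact_mod_cast (by omega : N ≠ 0)
  change fB N t * _ = _
  push_cast
  field_simp

lemma eB_norm (N : ℕ) (t : ℝ) : ‖eB N t‖ = 1 := Complex.norm_exp_ofReal_mul_I _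

lemma eB_per (N : ℕ) : Function.Periodic (eB N) 1 := by
  intro t
  unfold eB
  rw [Complex.exp_eq_exp_iff_exists_int]
  exact ⟨N, by push_cast; ring⟩

lemma eB_smooth (N : ℕ) : ContDiff ℝ (⊤ : ℕ∞) (eB N) := by
  unfold eB
  exact ((Complex.ofRealCLM.contDiff.comp (contDiff_const.mul contDiff_id)).mul contDiff_const).cexp

lemma fB_smooth (N : ℕ) : ContDiff ℝ (⊤ : ℕ∞) (fB N) := by
  unfold fB gB
  exact (((Complex.ofRealCLM.contDiff.comp (contDiff_const.mul contDiff_id)).mul contDiff_const).add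
    (contDiff_const.mul (eB_smooth N))).cexp

lemma fB_factor_ne (N : ℕ) (t : ℝ) : 1 + ((Real.pi / 2 : ℝ) : ℂ) * eB N t ≠ 0 := by
  intro h
  have h1 : ((Real.pi / 2 : ℝ) : ℂ) * eB N t = -1 := by linear_combination h
  have h2 := congrArg norm h1
  rw [norm_mul, eB_norm, norm_neg, norm_one, Complex.norm_real, Real.norm_eq_abs, abs_of_pos (by positivity)] at h2
  linarith [Real.pi_gt_three]

lemma PB_mem_eB {N : ℕ} (hN : 1 ≤ N) {q : ℝ × ℝ} (hq : q ∈ PB N) : eB N q.1 = Complex.I ∧ eB N q.2 = -Complex.I := by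
  obtain ⟨j, hj, rfl⟩ := Finset.mem_image.mp hq
  have : (N : ℝ) ≠ 0 := by exact_mod_cast (by omega : N ≠ 0)
  have e1 : 2 * Real.pi * N * ((4 * (j:ℝ) + 1) / (4 * N)) = Real.pi / 2 + j * (2 * Real.pi) := by field_simp; ring
  have e2 : 2 * Real.pi * N * ((4 * (j:ℝ) + 3) / (4 * N)) = (Real.pi / 2 + Real.pi) + j * (2 * Real.pi) := by field_simp; ring
  unfold eB
  simp only
  rw [e1, e2]
  constructor
  · rw [Complex.exp_mul_I, ← Complex.ofReal_cos, ← Complex.ofReal_sin, Real.cos_add_nat_mul_two_pi, Real.sin_add_nat_mul_two_pi]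
    simp
  · rw [Complex.exp_mul_I, ← Complex.ofReal_cos, ← Complex.ofReal_sin, Real.cos_add_nat_mul_two_pi, Real.sin_add_nat_mul_two_pi,
      Real.cos_add_pi, Real.sin_add_pi]
    simp

lemma PB_bd {N : ℕ} (hN : 1 ≤ N) {q : ℝ × ℝ} (hq : q ∈ PB N) : 0 < q.1 ∧ q.1 < q.2 ∧ q.2 < 1 := by
  obtain ⟨j, hj, rfl⟩ := Finset.mem_image.mp hq
  have hN0 : (0:ℝ) < N := by exact_mod_cast hN
  have hj : (j:ℝ) + 1 ≤ N := by exact_mod_cast Finset.mem_range.mp hj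
  refine ⟨by positivity, ?_, ?_⟩
  · simp only; gcongr; norm_num
  · simp only; rw [div_lt_one (by positivity)]; linarith

lemma fB_eq_iff (N : ℕ) (s t : ℝ) : fB N s = fB N t ↔
    (Real.cos (2 * Real.pi * N * s) = Real.cos (2 * Real.pi * N * t) ∧
      ∃ n : ℤ, 2 * Real.pi * s + Real.pi / (2 * N) * Real.sin (2 * Real.pi * N * s) =
        2 * Real.pi * t + Real.pi / (2 * N) * Real.sin (2 * Real.pi * N * t) + n * (2 * Real.pi)) ∨ (N = 0 ∧ fB N s = fB N t) := by
  rcases Nat.eq_zero_or_pos N with h0 | h0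
  · constructor
    · intro h; exact Or.inr ⟨h0, h⟩
    · rintro (⟨h1, n, h2⟩ | h)
      · subst h0
        unfold fB
        rw [Complex.exp_eq_exp_iff_exists_int]
        refine ⟨n, ?_⟩
        simp at h2
        unfold gB
        simp
        have : 2 * (Real.pi:ℂ) * s = 2 * Real.pi * t + n * (2 * Real.pi) := by exact_mod_cast h2
        linear_combination Complex.I * this
      · exact h.2
  have re : ∀ t, (gB N t).re = Real.pi / (2 * N) * Real.cos (2 * Real.pi * N * t) := by
    intro t; unfold gB eB
    rw [Complex.add_re, Complex.re_ofReal_mul, Complex.re_ofReal_mul, Complex.exp_ofReal_mul_I_re]; simp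
  have im : ∀ t, (gB N t).im = 2 * Real.pi * t + Real.pi / (2 * N) * Real.sin (2 * Real.pi * N * t) := by
    intro t; unfold gB eB
    rw [Complex.add_im, Complex.im_ofReal_mul, Complex.im_ofReal_mul, Complex.exp_ofReal_mul_I_im]; simp
  have hb : Real.pi / (2 * N) ≠ 0 := by positivity
  unfold fB
  rw [Complex.exp_eq_exp_iff_exists_int]
  constructor
  · rintro ⟨n, hn⟩
    left
    constructor
    · have := congrArg Complex.re hn
      rw [Complex.add_re, re, re] at this
      apply mul_left_cancel₀ hb
      simpa using this
    · refine ⟨n, ?_⟩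
      have := congrArg Complex.im hn
      rw [Complex.add_im, im, im] at this
      simpa using this
  · rintro (⟨h1, n, h2⟩ | h)
    · refine ⟨n, Complex.ext ?_ ?_⟩
      · rw [Complex.add_re, re, re, h1]; simp
      · rw [Complex.add_im, im, im, h2]; simp
    · omega

lemma Ex_B {N : ℕ} (hN : 1 ≤ N) : Ex (fB N) (PB N) (-1) where
  per := by
    intro t
    unfold fB
    rw [Complex.exp_eq_exp_iff_exists_int]
    refine ⟨1, ?_⟩
    unfold gB
    rw [eB_per N t]; push_cast; ring
  iff := by
    intro s t h1 h2 h3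
    rw [fB_eq_iff, ← B_real hN h1 h2 h3]
    constructor
    · rintro (h | h)
      · exact h
      · omega
    · exact Or.inl
  bd := fun q hq => PB_bd hN hq
  ne := by
    intro q hq r hr e
    have h1 := (PB_mem_eB hN hq).2
    have h2 := (PB_mem_eB hN hr).1
    rw [e, h2] at h1
    have := congrArg Complex.im h1
    norm_num at this
  sm := fB_smooth N
  imm := by
    intro t
    rw [(fB_deriv hN t).deriv]
    refine mul_ne_zero (mul_ne_zero (Complex.exp_ne_zero _) ?_) (fB_factor_ne N t)
    simp [Real.pi_ne_zero]
  hσ := by norm_num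
  sg := by
    intro q hq
    obtain ⟨h1, h2⟩ := PB_mem_eB hN hq
    obtain ⟨b1, b2, b3⟩ := PB_bd hN hq
    have e : fB N q.1 = fB N q.2 := by
      rw [fB_eq_iff]; exact Or.inl ((B_real hN b1.le b2 b3).mpr hq)
    unfold eps
    rw [(fB_deriv hN _).deriv, (fB_deriv hN _).deriv, h1, h2, e, det2_scale]
    have k : 0 < Complex.normSq (fB N q.2 * (2 * Real.pi * Complex.I)) := by
      rw [Complex.normSq_pos]
      refine mul_ne_zero (Complex.exp_ne_zero _) ?_
      simp [Real.pi_ne_zero]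
    have k2 : det2 (1 + ((Real.pi / 2 : ℝ) : ℂ) * Complex.I) (1 + ((Real.pi / 2 : ℝ) : ℂ) * -Complex.I) = -Real.pi := by
      unfold det2
      rw [Complex.add_re, Complex.add_im, Complex.add_re, Complex.add_im, Complex.re_ofReal_mul, Complex.im_ofReal_mul,
        Complex.re_ofReal_mul, Complex.im_ofReal_mul]
      simp; ring
    rw [k2, sign_neg (by nlinarith [Real.pi_pos])]; simp

lemma Wh_B {N : ℕ} (hN : 1 ≤ N) : Wh (fB N) (N + 1) := by
  refine whitney_of_V (Ex_B hN).toImm 0 ?_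
  have hpi : (Real.pi : ℂ) ≠ 0 := by exact_mod_cast Real.pi_ne_zero
  set ψ : ℝ → ℂ := fun t => 1 + ((2 / Real.pi : ℝ) : ℂ) * Complex.exp (-(((2 * Real.pi * N * t : ℝ) : ℂ) * Complex.I)) with hψ
  have hsl : ∀ t, ψ t ∈ Complex.slitPlane := by
    intro t
    apply Complex.mem_slitPlane_of_norm_lt_one
    rw [norm_mul, ← neg_mul, ← Complex.ofReal_neg, Complex.norm_exp_ofReal_mul_I, Complex.norm_real, Real.norm_eq_abs,
      abs_of_pos (by positivity), mul_one, div_lt_one Real.pi_pos]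
    linarith [Real.pi_gt_three]
  have hψc : Continuous ψ := by rw [hψ]; fun_prop
  set k : ℂ := Real.pi * Real.pi * Complex.I with hk
  have hk0 : k ≠ 0 := by simp [hk, Real.pi_ne_zero]
  have hgc : Continuous (gB N) := by unfold gB eB; fun_prop
  rw [V_eq (L := fun t => Complex.log k + gB N t + ((2 * Real.pi * N * t : ℝ) : ℂ) * Complex.I + Complex.log (ψ t)) (by norm_num)]
  · have e1 : ψ (0 + 1) = ψ 0 := by
      rw [hψ]; simp only
      congr 2
      rw [Complex.exp_eq_exp_iff_exists_int]
      exact ⟨-N, by push_cast; ring⟩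
    rw [e1]
    unfold gB
    rw [eB_per N 0]
    push_cast; ring
  · refine Continuous.continuousOn ?_
    refine Continuous.add (by fun_prop) ?_
    exact hψc.clog hsl
  · intro t _
    rw [Complex.exp_add, Complex.exp_add, Complex.exp_add, Complex.exp_log hk0, Complex.exp_log (Complex.slitPlane_ne_zero (hsl t)),
      (fB_deriv hN t).deriv, hψ, hk]
    change _ * fB N t * eB N t * _ = _
    have : eB N t * Complex.exp (-(((2 * Real.pi * N * t : ℝ) : ℂ) * Complex.I)) = 1 := by
      unfold eB; rw [← Complex.exp_add, add_neg_cancel, Complex.exp_zero]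
    have e : (Real.pi : ℂ) * ((2 / Real.pi : ℝ) : ℂ) = 2 := by push_cast; field_simp
    simp only
    push_cast at this e ⊢
    linear_combination (Real.pi * Complex.I * fB N t * 2) * this + (Real.pi * Complex.I * fB N t * eB N t *
      Complex.exp (-((2 * (Real.pi:ℂ) * N * t) * Complex.I))) * e


def rA (t : ℝ) : ℝ := 1 + 1 / 2 * Real.cos (2 * Real.pi * t)
def cA (m : ℕ) (t : ℝ) : ℂ := (rA t : ℂ) * eB m t
def wA (m : ℕ) (t : ℝ) : ℂ := ((-(Real.pi * Real.sin (2 * Real.pi * t)) : ℝ) : ℂ) + ((2 * Real.pi * m * rA t : ℝ) : ℂ) * Complex.I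

lemma rA_pos (t : ℝ) : 0 < rA t := by unfold rA; linarith [Real.neg_one_le_cos (2 * Real.pi * t)]
lemma rA_ne (t : ℝ) : (rA t : ℂ) ≠ 0 := by exact_mod_cast (rA_pos t).ne'
lemma eB_ne (m : ℕ) (t : ℝ) : eB m t ≠ 0 := Complex.exp_ne_zero _
lemma cA_ne (m : ℕ) (t : ℝ) : cA m t ≠ 0 := mul_ne_zero (rA_ne t) (eB_ne m t)
lemma cA_norm (m : ℕ) (t : ℝ) : ‖cA m t‖ = rA t := by
  rw [cA, norm_mul, eB_norm, Complex.norm_real, Real.norm_eq_abs, abs_of_pos (rA_pos t), mul_one]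
lemma rA_per : Function.Periodic rA 1 := by
  intro t; unfold rA
  rw [mul_add, mul_one, Real.cos_add_two_pi]
lemma rA_neg (t : ℝ) : rA (-t) = rA t := by
  unfold rA; rw [mul_neg, Real.cos_neg]
lemma cA_per (m : ℕ) : Function.Periodic (cA m) 1 := by
  intro t; unfold cA; rw [rA_per t, eB_per m t]
lemma rA_smooth : ContDiff ℝ (⊤ : ℕ∞) rA := by
  unfold rA
  exact contDiff_const.add (contDiff_const.mul (contDiff_const.mul contDiff_id).cos)
lemma cA_smooth (m : ℕ) : ContDiff ℝ (⊤ : ℕ∞) (cA m) :=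
  (Complex.ofRealCLM.contDiff.comp rA_smooth).mul (eB_smooth m)

lemma cA_deriv (m : ℕ) (t : ℝ) : HasDerivAt (cA m) (eB m t * wA m t) t := by
  have h1 : HasDerivAt (fun t : ℝ => 2 * Real.pi * t) (2 * Real.pi) t := by
    simpa using (hasDerivAt_id t).const_mul (2 * Real.pi)
  have h2 : HasDerivAt rA _ t := (h1.cos.const_mul (1 / 2)).const_add 1
  refine (h2.ofReal_comp.mul (eB_deriv m t)).congr_deriv ?_
  unfold wA; push_cast; ring

lemma eB_half {m l : ℕ} {t : ℝ} (h : 2 * (m:ℝ) * t = l) : eB m (-t) = eB m t := by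
  unfold eB
  rw [Complex.exp_eq_exp_iff_exists_int]
  refine ⟨-l, ?_⟩
  have : 2 * (m:ℂ) * t = l := by exact_mod_cast h
  push_cast
  linear_combination (-2 * Real.pi * Complex.I) * this

lemma cA_half {m l : ℕ} {t : ℝ} (h : 2 * (m:ℝ) * t = l) : cA m (-t) = cA m t := by
  unfold cA; rw [rA_neg, eB_half h]

lemma rA_eq {s t : ℝ} (h : rA s = rA t) : ∃ k : ℤ, t = s + k ∨ t = -s + k := by
  have h : Real.cos (2 * Real.pi * s) = Real.cos (2 * Real.pi * t) := by unfold rA at h; linarith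
  rw [Real.cos_eq_cos_iff] at h
  have hp : 2 * Real.pi ≠ 0 := by positivity
  obtain ⟨k, h | h⟩ := h
  · exact ⟨k, Or.inl (mul_left_cancel₀ hp (by linarith))⟩
  · exact ⟨k, Or.inr (mul_left_cancel₀ hp (by linarith))⟩

lemma cA_int (m : ℕ) (t : ℝ) (k : ℤ) : cA m (t + k) = cA m t := by
  have := (cA_per m).int_mul k t
  simpa using this

lemma cA_add_ne {m l : ℕ} {t0 : ℝ} (h : 2 * (m:ℝ) * t0 = l) (t : ℝ) : cA m t + cA m t0 ≠ 0 := by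
  intro e
  have e1 : cA m t = -cA m t0 := by linear_combination e
  have e2 := congrArg norm e1
  rw [norm_neg, cA_norm, cA_norm] at e2
  obtain ⟨k, hk | hk⟩ := rA_eq e2.symm
  · rw [hk, cA_int] at e1
    exact cA_ne m t0 (by linear_combination e1 / 2)
  · rw [hk, cA_int, cA_half h] at e1
    exact cA_ne m t0 (by linear_combination e1 / 2)

lemma cA_iff {m : ℕ} (hm : 1 ≤ m) {s t : ℝ} (hs : 0 ≤ s) (hst : s < t) (ht : t < 1) :
    cA m s = cA m t ↔ (s, t) ∈ PA m := by
  have hm0 : (0:ℝ) < m := by exact_mod_cast hm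
  constructor
  · intro e
    have e2 := congrArg norm e
    rw [cA_norm, cA_norm] at e2
    obtain ⟨k, hk | hk⟩ := rA_eq e2
    · exfalso
      exact int_lt (a := 0) (b := 1) (x := t - s) (by push_cast; linarith) (by push_cast; linarith) (by norm_num) k (by linarith)
    · have hk1 : k = 1 := by
        have h1 : (0:ℝ) < k := by linarith
        have h2 : (k:ℝ) < 2 := by linarith
        have h1 : 0 < k := by exact_mod_cast h1
        have h2 : k < 2 := by exact_mod_cast h2
        omega
      rw [hk1] at hk
      push_cast at hk
      unfold cA at e
      rw [e2] at e
      have e3 := mul_left_cancel₀ (rA_ne t) e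
      unfold eB at e3
      rw [Complex.exp_eq_exp_iff_exists_int] at e3
      obtain ⟨j, hj⟩ := e3
      have hj2 := congrArg Complex.im hj
      simp at hj2
      rw [hk] at hj2
      have hj3 : 2 * (m:ℝ) * s = ((m + j : ℤ) : ℝ) := by
        apply mul_left_cancel₀ (by positivity : 2 * Real.pi ≠ 0)
        push_cast; linarith
      have hs2 : s < 1 / 2 := by linarith
      have hs0 : 0 < s := by linarith
      have k1 : (0:ℝ) < ((m + j : ℤ) : ℝ) := by rw [← hj3]; positivity
      have k2 : ((m + j : ℤ) : ℝ) < m := by rw [← hj3]; nlinarith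
      generalize (m + j : ℤ) = K at *
      have k1 : 0 < K := by exact_mod_cast k1
      have k2 : K < m := by exact_mod_cast k2
      lift K to ℕ using k1.le
      rw [mem_PA hm]
      have hs' : s = K / (2 * m) := by rw [eq_div_iff (by positivity)]; push_cast at hj3; linarith
      refine ⟨K, by omega, by omega, ?_⟩
      rw [hk, ← hs']
      congr 1; ring
  · intro h
    obtain ⟨k, h1, h2, e⟩ := (mem_PA hm).mp h
    obtain ⟨e1, e2⟩ := Prod.mk.inj e
    have e3 : 2 * (m:ℝ) * s = k := by rw [e1]; field_simp
    rw [← e1] at e2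
    have : t = -s + ((1:ℤ) : ℝ) := by rw [e2]; push_cast; ring
    rw [this, cA_int, cA_half e3]

lemma wA_ne {m : ℕ} (hm : 1 ≤ m) (t : ℝ) : wA m t ≠ 0 := by
  intro h
  have := congrArg Complex.im h
  unfold wA at this
  rw [Complex.add_im, Complex.im_ofReal_mul, Complex.ofReal_im, Complex.I_im, zero_add, mul_one, Complex.zero_im] at this
  have h1 := rA_pos t
  have : (0:ℝ) < m := by exact_mod_cast hm
  have : 0 < 2 * Real.pi * m * rA t := by positivity
  linarith

def fA (m : ℕ) (t0 : ℝ) (t : ℝ) : ℂ := (cA m t + cA m t0)⁻¹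

lemma fA_deriv {m l : ℕ} {t0 : ℝ} (h : 2 * (m:ℝ) * t0 = l) (t : ℝ) :
    HasDerivAt (fA m t0) (-(eB m t * wA m t) / (cA m t + cA m t0) ^ 2) t :=
  ((cA_deriv m t).add_const (cA m t0)).inv (cA_add_ne h t)

lemma Ex_A {m l : ℕ} (hm : 1 ≤ m) {t0 : ℝ} (h : 2 * (m:ℝ) * t0 = l) : Ex (fA m t0) (PA m) (-1) := by
  have hc : Prs (cA m) (PA m) := by
    refine ⟨cA_per m, fun s t a b c => cA_iff hm a b c, fun q hq => ?_, fun q hq r hr => ?_⟩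
    · obtain ⟨h1, h2, h3⟩ := PA_bd hm hq
      refine ⟨h1, ?_, ?_⟩ <;> linarith
    · obtain ⟨h1, h2, h3⟩ := PA_bd hm hq
      obtain ⟨h1, h2, h3⟩ := PA_bd hm hr
      intro e; linarith
  refine { toPrs := hc.inj fun s t => ?_, sm := ?_, imm := ?_, hσ := by norm_num, sg := ?_ }
  · unfold fA; rw [inv_inj, add_left_inj]
  · exact ((cA_smooth m).add contDiff_const).inv fun t => cA_add_ne h t
  · intro t
    rw [(fA_deriv h t).deriv]
    exact div_ne_zero (neg_ne_zero.mpr (mul_ne_zero (eB_ne m t) (wA_ne hm t))) (pow_ne_zero _ (cA_add_ne h t))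
  · intro q hq
    obtain ⟨b1, b2, b3⟩ := PA_bd hm hq
    have ec : cA m q.1 = cA m q.2 := (cA_iff hm b1.le (by linarith) (by linarith)).mpr hq
    have er : rA q.1 = rA q.2 := by rw [← cA_norm m, ← cA_norm m, ec]
    have ee : eB m q.1 = eB m q.2 := by
      unfold cA at ec; rw [er] at ec; exact mul_left_cancel₀ (rA_ne _) ec
    unfold eps
    have d : ∀ t, deriv (fA m t0) t = (-eB m t / (cA m t + cA m t0) ^ 2) * wA m t := by
      intro t; rw [(fA_deriv h t).deriv]; ring
    rw [d, d, ec, ee, det2_scale]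
    have k : 0 < Complex.normSq (-eB m q.2 / (cA m q.2 + cA m t0) ^ 2) := by
      rw [Complex.normSq_pos]
      exact div_ne_zero (neg_ne_zero.mpr (eB_ne m _)) (pow_ne_zero _ (cA_add_ne h _))
    have es : Real.sin (2 * Real.pi * q.2) = -Real.sin (2 * Real.pi * q.1) := by
      rw [b3, mul_sub, mul_one, Real.sin_two_pi_sub]
    have hs : 0 < Real.sin (2 * Real.pi * q.1) := by
      apply Real.sin_pos_of_pos_of_lt_pi
      · have := Real.pi_pos; positivity
      · nlinarith [Real.pi_pos]
    have k2 : det2 (wA m q.1) (wA m q.2) = -(2 * (Real.pi * Real.sin (2 * Real.pi * q.1)) * (2 * Real.pi * m * rA q.2)) := by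
      unfold det2 wA
      rw [Complex.add_re, Complex.add_im, Complex.add_re, Complex.add_im, Complex.re_ofReal_mul, Complex.im_ofReal_mul,
        Complex.re_ofReal_mul, Complex.im_ofReal_mul, es, er]
      simp only [Complex.ofReal_re, Complex.ofReal_im, Complex.I_re, Complex.I_im]; ring
    have k3 : 0 < 2 * (Real.pi * Real.sin (2 * Real.pi * q.1)) * (2 * Real.pi * m * rA q.2) := by
      have := rA_pos q.2
      have := Real.pi_pos
      have : (0:ℝ) < m := by exact_mod_cast hm
      positivity
    rw [k2, sign_neg (by nlinarith)]; simp

lemma slit_of_le {z : ℂ} (h : ‖z‖ ≤ 1) (h0 : 1 + z ≠ 0) : 1 + z ∈ Complex.slitPlane := by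
  rw [Complex.mem_slitPlane_iff]
  have h1 := (abs_le.mp (Complex.abs_re_le_norm z)).1
  by_contra hc
  push Not at hc
  obtain ⟨h2, h3⟩ := hc
  apply h0
  simp at h2 h3
  apply Complex.ext
  · simp; linarith
  · simpa using h3

lemma cA_cont (m : ℕ) : Continuous (cA m) := (cA_smooth m).continuous

lemma rA_anti {s t : ℝ} (h : |s| ≤ |t|) (ht : |t| ≤ 1 / 2) : rA t ≤ rA s := by
  have e : ∀ t, rA |t| = rA t := by
    intro t; rcases abs_choice t with g | g <;> rw [g]
    exact rA_neg t
  rw [← e s, ← e t]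
  unfold rA
  have := Real.pi_pos
  have := Real.cos_le_cos_of_nonneg_of_le_pi (x := 2 * Real.pi * |s|) (y := 2 * Real.pi * |t|) (by positivity)
    (by nlinarith) (by gcongr)
  linarith

lemma V_cA {m l : ℕ} (hm : 1 ≤ m) (hl : l ≤ m) {t0 : ℝ} (h : 2 * (m:ℝ) * t0 = l) :
    V (fun t => cA m t + cA m t0) (-1 / 2) (1 / 2) = 2 * Real.pi * Complex.I * l := by
  have hm0 : (0:ℝ) < m := by exact_mod_cast hm
  have hl' : (l:ℝ) ≤ m := by exact_mod_cast hl
  have h0 : 0 ≤ t0 := by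
    by_contra hc
    push Not at hc
    have : (0:ℝ) ≤ l := by positivity
    nlinarith
  have h1 : t0 ≤ 1 / 2 := by
    by_contra hc
    push Not at hc
    nlinarith
  have hcont : Continuous (fun t => cA m t + cA m t0) := (cA_cont m).add continuous_const
  rw [V_add (m := -t0) (by linarith) (by linarith) hcont.continuousOn (fun t _ => cA_add_ne h t),
    V_add (a := -t0) (m := t0) (by linarith) (by linarith) hcont.continuousOn (fun t _ => cA_add_ne h t)]
  have outer : ∀ t, t0 ≤ |t| → |t| ≤ 1 / 2 → (cA m t + cA m t0) / cA m t0 ∈ Complex.slitPlane := by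
    intro t g1 g2
    have e : (cA m t + cA m t0) / cA m t0 = 1 + cA m t / cA m t0 := by
      rw [add_div, div_self (cA_ne m t0), add_comm]
    have e0 : (cA m t + cA m t0) / cA m t0 ≠ 0 := div_ne_zero (cA_add_ne h t) (cA_ne m t0)
    rw [e] at e0 ⊢
    refine slit_of_le ?_ e0
    rw [norm_div, cA_norm, cA_norm, div_le_one (rA_pos _)]
    exact rA_anti (by rw [abs_of_nonneg h0]; exact g1) g2
  have v1 := V_slit (f := fun t => cA m t + cA m t0) (k := cA m t0) (a := -1 / 2) (b := -t0) (cA_ne m t0) (by linarith) hcont.continuousOn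
    (by
      intro x hx
      have hx1 := hx.1
      have hx2 := hx.2
      apply outer
      · rw [abs_of_nonpos (by linarith)]; linarith
      · rw [abs_of_nonpos (by linarith)]; linarith)
  have v3 := V_slit (f := fun t => cA m t + cA m t0) (k := cA m t0) (a := t0) (b := 1 / 2) (cA_ne m t0) (by linarith) hcont.continuousOn
    (by
      intro x hx
      have hx1 := hx.1
      have hx2 := hx.2
      apply outer
      · rw [abs_of_nonneg (by linarith)]; linarith
      · rw [abs_of_nonneg (by linarith)]; linarith)
  have ep : cA m (-1 / 2) = cA m (1 / 2) := by
    have := cA_per m (-1 / 2)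
    rw [← this]; norm_num
  have v2 : V (fun t => cA m t + cA m t0) (-t0) t0 = 2 * Real.pi * Complex.I * l := by
    have inner : ∀ t ∈ Icc (-t0) t0, 1 + cA m t0 / cA m t ∈ Complex.slitPlane := by
      intro t ht
      have g : |t| ≤ t0 := abs_le.mpr ht
      refine slit_of_le ?_ ?_
      · rw [norm_div, cA_norm, cA_norm, div_le_one (rA_pos _)]
        apply rA_anti <;> rw [abs_of_nonneg h0]
        · exact g
        · exact h1
      · have e : (cA m t + cA m t0) / cA m t = 1 + cA m t0 / cA m t := by
          rw [add_div, div_self (cA_ne m t)]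
        rw [← e]
        exact div_ne_zero (cA_add_ne h t) (cA_ne m t)
    rw [V_eq (L := fun t => ((2 * Real.pi * m * t : ℝ) : ℂ) * Complex.I + Complex.log (rA t) + Complex.log (1 + cA m t0 / cA m t))
      (by linarith)]
    · rw [cA_half h, rA_neg]
      have : 2 * (m:ℂ) * t0 = l := by exact_mod_cast h
      push_cast
      linear_combination (2 * Real.pi * Complex.I) * this
    · refine ContinuousOn.add (Continuous.continuousOn ?_) (ContinuousOn.clog ?_ inner)
      · refine Continuous.add (by fun_prop) (Continuous.clog (Complex.continuous_ofReal.comp rA_smooth.continuous) fun t => ?_)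
        exact Complex.ofReal_mem_slitPlane.mpr (rA_pos t)
      · exact (continuous_const.add (continuous_const.div (cA_cont m) (cA_ne m))).continuousOn
    · intro t ht
      rw [Complex.exp_add, Complex.exp_add, Complex.exp_log (rA_ne t), Complex.exp_log (Complex.slitPlane_ne_zero (inner t ht))]
      change eB m t * rA t * _ = _
      have : eB m t * rA t = cA m t := by rw [cA, mul_comm]
      rw [this]
      have := cA_ne m t
      field_simp
  rw [v1, v2, v3]
  rw [ep, cA_half h]
  ring

lemma V_cA' {m : ℕ} (hm : 1 ≤ m) :
    V (fun t => eB m t * wA m t) (-1 / 2) (1 / 2) = 2 * Real.pi * Complex.I * m := by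
  have hm0 : (0:ℝ) < m := by exact_mod_cast hm
  set ψ : ℝ → ℂ := fun t => ((2 * Real.pi * m * rA t : ℝ) : ℂ) + ((Real.pi * Real.sin (2 * Real.pi * t) : ℝ) : ℂ) * Complex.I with hψ
  have hsl : ∀ t, ψ t ∈ Complex.slitPlane := by
    intro t
    rw [Complex.mem_slitPlane_iff]
    left
    rw [hψ]; simp only
    rw [Complex.add_re, Complex.re_ofReal_mul, Complex.ofReal_re]
    simp only [Complex.I_re, mul_zero, add_zero]
    have := rA_pos t
    have := Real.pi_pos
    positivity
  have hr := rA_smooth.continuous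
  have hψc : Continuous ψ := by rw [hψ]; fun_prop
  have e1 : ψ (1 / 2) = ψ (-1 / 2) := by
    have a1 : rA (1 / 2) = rA (-1 / 2) := by rw [← rA_neg]; norm_num
    have a2 : 2 * Real.pi * (1 / 2) = Real.pi := by ring
    have a3 : 2 * Real.pi * (-1 / 2) = -Real.pi := by ring
    rw [hψ]; simp only
    rw [a1, a2, a3, Real.sin_neg, Real.sin_pi, neg_zero]
  rw [V_eq (L := fun t => ((2 * Real.pi * m * t : ℝ) : ℂ) * Complex.I + Complex.log Complex.I + Complex.log (ψ t)) (by norm_num)]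
  · rw [e1]; push_cast; ring
  · refine Continuous.continuousOn (Continuous.add (by fun_prop) (hψc.clog hsl))
  · intro t _
    rw [Complex.exp_add, Complex.exp_add, Complex.exp_log Complex.I_ne_zero, Complex.exp_log (Complex.slitPlane_ne_zero (hsl t))]
    change eB m t * _ * _ = _
    rw [hψ]; simp only
    unfold wA
    push_cast
    linear_combination (eB m t * Real.pi * Complex.sin (2 * Real.pi * t)) * Complex.I_sq

lemma Wh_A {m l : ℕ} (hm : 1 ≤ m) (hl : l ≤ m) {t0 : ℝ} (h : 2 * (m:ℝ) * t0 = l) : Wh (fA m t0) (m - 2 * l) := by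
  refine whitney_of_V (Ex_A hm h).toImm (-1 / 2) ?_
  have hle : (-1 / 2 : ℝ) ≤ 1 / 2 := by norm_num
  have w1 := V_cA' hm
  have w2 := V_cA hm hl h
  have hwc : Continuous (wA m) := by
    have hr := rA_smooth.continuous
    unfold wA; fun_prop
  obtain ⟨L1, c1, d1⟩ := V_exists (g := fun t => eB m t * wA m t) hle (((eB_smooth m).continuous.mul hwc).continuousOn)
    (fun t _ => mul_ne_zero (eB_ne m t) (wA_ne hm t))
  obtain ⟨L2, c2, d2⟩ := V_exists (g := fun t => cA m t + cA m t0) hle (((cA_cont m).add continuous_const).continuousOn)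
    (fun t _ => cA_add_ne h t)
  rw [V_eq hle c1 d1] at w1
  rw [V_eq hle c2 d2] at w2
  have e : (-1 / 2 : ℝ) + 1 = 1 / 2 := by norm_num
  rw [e, V_eq (L := fun t => Real.pi * Complex.I + L1 t - (L2 t + L2 t)) hle]
  · push_cast; linear_combination w1 - 2 * w2
  · exact (continuousOn_const.add c1).sub (c2.add c2)
  · intro t ht
    rw [Complex.exp_sub, Complex.exp_add, Complex.exp_add, d1 t ht, d2 t ht, (fA_deriv h t).deriv, Complex.exp_pi_mul_I]
    rw [sq]; ring


lemma A_exists {m : ℕ} (hm : 1 ≤ m) {ω : ℤ} (h : ω.natAbs ≤ m) (hp : Even ((m:ℤ) + ω)) :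
    ∃ f, Ex f (PA m) (-1) ∧ Wh f ω := by
  obtain ⟨r, hr⟩ := hp
  obtain ⟨l, hl⟩ : ∃ l : ℕ, (m:ℤ) - 2 * l = ω := ⟨(m - r).toNat, by omega⟩
  have hm0 : (m:ℝ) ≠ 0 := by exact_mod_cast (by omega : m ≠ 0)
  have h0 : 2 * (m:ℝ) * ((l:ℝ) / (2 * m)) = l := by field_simp
  refine ⟨_, Ex_A hm h0, ?_⟩
  have := Wh_A hm (by omega : l ≤ m) h0
  rwa [hl] at this

def bnd (ω : ℤ) (n : ℕ) : ℝ := 1 / 12 * (n : ℝ) ^ 2 + 1 / 6 * ((ω.natAbs : ℝ) - 1) * n +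
  (if ω = 0 then 1 / 12 else 1 / 12 * ((ω : ℝ) ^ 2 - 6 * (ω.natAbs : ℝ) + 5))

lemma abs_sq (ω : ℤ) : (ω : ℝ) ^ 2 = (ω.natAbs : ℝ) ^ 2 := by
  have : ((ω.natAbs : ℝ)) = |(ω : ℝ)| := by
    rw [← Int.cast_abs, Int.abs_eq_natAbs]; simp
  rw [this, _root_.sq_abs]

lemma second {ω : ℤ} {n : ℕ} (hn : ω.natAbs ≤ n) (hpar : Odd ((n : ℤ) + ω)) :
    ∃ (g : ℝ → ℂ) (Q : Finset (ℝ × ℝ)) (τ : ℤ), Ex g Q τ ∧ Wh g ω ∧ Q.card ≤ n ∧ Odd ((Q.card : ℤ) + ω) ∧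
      4 * bnd ω n ≤ (((n:ℤ) ^ 2 - JF (fun _ => 1) Q : ℤ) : ℝ) := by
  have hn1 : ω.natAbs + 1 ≤ n := by
    obtain ⟨r, hr⟩ := hpar
    omega
  have hw : (ω.natAbs : ℝ) + 1 ≤ n := by exact_mod_cast hn1
  unfold bnd
  rw [abs_sq]
  rcases Nat.lt_or_ge ω.natAbs 2 with h2 | h2
  · rcases Nat.eq_zero_or_pos ω.natAbs with h0 | h0
    · have hω : ω = 0 := by omega
      subst hω
      obtain ⟨g, hg, wg⟩ := A_exists (m := 2) (ω := 0) (by norm_num) (by norm_num) (by decide)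
      refine ⟨g, _, _, hg, wg, ?_, ?_, ?_⟩
      · rw [PA_card (by norm_num)]; omega
      · rw [PA_card (by norm_num)]; decide
      · rw [PA_J (by norm_num)]
        have hw1 : (1:ℝ) ≤ n := by simpa using hw
        simp
        nlinarith
    · have h1 : ω.natAbs = 1 := by omega
      obtain ⟨g, hg, wg⟩ := A_exists (m := 1) (ω := ω) (by norm_num) (by omega) (by rw [Int.even_iff]; omega)
      refine ⟨g, _, _, hg, wg, ?_, ?_, ?_⟩
      · rw [PA_card (by norm_num)]; omega
      · rw [PA_card (by norm_num), Int.odd_iff]; omega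
      · rw [PA_J (by norm_num), if_neg (by omega), h1]
        push_cast
        nlinarith [sq_nonneg (n:ℝ)]
  · obtain ⟨N, hN⟩ : ∃ N, ω.natAbs = N + 1 := ⟨ω.natAbs - 1, by omega⟩
    have hN1 : 1 ≤ N := by omega
    have hb : 4 * (1 / 12 * (n : ℝ) ^ 2 + 1 / 6 * ((ω.natAbs : ℝ) - 1) * n +
        (if ω = 0 then 1 / 12 else 1 / 12 * ((ω.natAbs : ℝ) ^ 2 - 6 * (ω.natAbs : ℝ) + 5))) ≤
        (((n:ℤ) ^ 2 - JF (fun _ => 1) (PB N) : ℤ) : ℝ) := by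
      rw [PB_J hN1, if_neg (by omega)]
      rw [hN] at hw ⊢
      push_cast at hw ⊢
      have : (1:ℝ) ≤ N := by exact_mod_cast hN1
      nlinarith
    rcases le_or_gt 0 ω with hs | hs
    · have hω : ω = N + 1 := by omega
      refine ⟨_, _, _, Ex_B hN1, by rw [hω]; exact Wh_B hN1, ?_, ?_, hb⟩
      · rw [PB_card hN1]; omega
      · rw [PB_card hN1, Int.odd_iff]; omega
    · have hω : ω = -((N:ℤ) + 1) := by omega
      refine ⟨_, _, _, (Ex_B hN1).conj, by rw [hω]; exact (Wh_B hN1).conj (Ex_B hN1).toImm.diff, ?_, ?_, hb⟩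
      · rw [PB_card hN1]; omega
      · rw [PB_card hN1, Int.odd_iff]; omega

lemma bnd_ge {ω : ℤ} {n : ℕ} (hn : ω.natAbs ≤ n) (hpar : Odd ((n : ℤ) + ω)) : 1 / 12 * ((n : ℝ) - 1) ^ 2 ≤ bnd ω n := by
  have hn1 : ω.natAbs + 1 ≤ n := by
    obtain ⟨r, hr⟩ := hpar
    omega
  have hw : (ω.natAbs : ℝ) + 1 ≤ n := by exact_mod_cast hn1
  unfold bnd
  rw [abs_sq]
  split_ifs with h
  · subst h; simp; nlinarith
  · have h1 : (1:ℝ) ≤ ω.natAbs := by exact_mod_cast (by omega : 1 ≤ ω.natAbs)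
    nlinarith [sq_nonneg ((ω.natAbs : ℝ) - 1)]

theorem final (ω : ℤ) (n : ℕ) (hn : ω.natAbs ≤ n) (hpar : Odd ((n : ℤ) + ω)) :
    (PlanarCurve.diam (PlanarCurve.B ω (n + 1)) = PlanarCurve.diam (PlanarCurve.B ω n) ∧
      ENNReal.ofReal (bnd ω n) ≤ (PlanarCurve.diam (PlanarCurve.B ω n) : ℝ≥0∞)) ∧
    (SphericalCurve.diam (SphericalCurve.B (ω : ZMod 2) (n + 1)) =
        SphericalCurve.diam (SphericalCurve.B (ω : ZMod 2) n) ∧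
      ENNReal.ofReal (bnd ω n) ≤ (SphericalCurve.diam (SphericalCurve.B (ω : ZMod 2) n) : ℝ≥0∞)) ∧
    (1 / 12 * ((n : ℝ) - 1) ^ 2 ≤ bnd ω n) := by
  obtain ⟨g, Q, τ, hg, wg, cg, pg, hb⟩ := second hn hpar
  obtain ⟨f, hf, wf⟩ := A_exists (m := n + 1) (ω := ω) (by omega) (by omega) (by
    rw [Int.even_iff]; rw [Int.odd_iff] at hpar; push_cast; omega)
  have cf : (PA (n + 1)).card = n := by rw [PA_card (by omega)]; omega
  have hb2 : 4 * bnd ω n ≤ ((JF (fun _ => 1) (PA (n + 1)) - JF (fun _ => 1) Q : ℤ) : ℝ) := by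
    have : JF (fun _ => 1) (PA (n + 1)) = (n:ℤ) ^ 2 := by rw [PA_J (by omega)]; push_cast; ring
    rw [this]; exact hb
  refine ⟨⟨by rw [planar_B_eq hpar], planar_lower hf hg wf wg cf.le cg hb2⟩,
    ⟨by rw [sph_B_eq hpar], sph_lower hf hg (by rw [cf]; exact hpar) pg cf.le cg hb2⟩, bnd_ge hn hpar⟩


/-- For every integer `ω` and natural `n ≥ |ω|` of opposite parity to
`ω`, both for planar and for spherical curves:
`diam B^ω_{n+1} = diam B^ω_n ≥ (1/12)n² + (1/6)(|ω|-1)n + k_ω ≥ (1/12)(n-1)²`,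
where `k_0 = 1/12` and `k_ω = (1/12)(ω² - 6|ω| + 5)` for `ω ≠ 0`. -/
theorem statement3 (ω : ℤ) (n : ℕ) (hn : ω.natAbs ≤ n) (hpar : Odd ((n : ℤ) + ω)) :
    (PlanarCurve.diam (PlanarCurve.B ω (n + 1)) = PlanarCurve.diam (PlanarCurve.B ω n) ∧
      ENNReal.ofReal (1 / 12 * (n : ℝ) ^ 2 + 1 / 6 * ((ω.natAbs : ℝ) - 1) * n +
          (if ω = 0 then 1 / 12 else 1 / 12 * ((ω : ℝ) ^ 2 - 6 * (ω.natAbs : ℝ) + 5)))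
        ≤ (PlanarCurve.diam (PlanarCurve.B ω n) : ℝ≥0∞)) ∧
    (SphericalCurve.diam (SphericalCurve.B (ω : ZMod 2) (n + 1)) =
        SphericalCurve.diam (SphericalCurve.B (ω : ZMod 2) n) ∧
      ENNReal.ofReal (1 / 12 * (n : ℝ) ^ 2 + 1 / 6 * ((ω.natAbs : ℝ) - 1) * n +
          (if ω = 0 then 1 / 12 else 1 / 12 * ((ω : ℝ) ^ 2 - 6 * (ω.natAbs : ℝ) + 5)))
        ≤ (SphericalCurve.diam (SphericalCurve.B (ω : ZMod 2) n) : ℝ≥0∞)) ∧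
    (1 / 12 * ((n : ℝ) - 1) ^ 2 ≤
      1 / 12 * (n : ℝ) ^ 2 + 1 / 6 * ((ω.natAbs : ℝ) - 1) * n +
        (if ω = 0 then 1 / 12 else 1 / 12 * ((ω : ℝ) ^ 2 - 6 * (ω.natAbs : ℝ) + 5))) := by
  exact final ω n hn hpar

end CurvePaper
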